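/- Let k be an algebraically closed field and n₁ ≥ n₂ ≥ 1. Let Y and Z be closed irreducible subvarieties of P := ℙ^{n₁} × ℙ^{n₂} over k with dim Y + dim Z > 2n₁ + n₂. Then Y ∩ Z is nonempty and connected. -/

import Mathlib

/-!
The connectedness content of Corollary 4.3: if `Y, Z ⊆ ℙ^{n₁} × ℙ^{n₂}` are closed
irreducible subvarieties with `dim Y + dim Z > 2n₁ + n₂`, then `Y ∩ Z` is nonempty and
connected.
-/

open AlgebraicGeometry CategoryTheory CategoryTheory.Limits MvPolynomial

attribute [local instance] MvPolynomial.gradedAlgebra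

noncomputable section

/-- Projective `n`-space over `k`, as the `Proj` of the standard graded polynomial ring
`k[x₀, …, xₙ]`. -/
def ProjSpace (k : Type) [Field k] (n : ℕ) : Scheme :=
  Proj (homogeneousSubmodule (Fin (n + 1)) k)

/-- The structure morphism `ℙⁿ_k ⟶ Spec k`. -/
def ProjSpace.structMap (k : Type) [Field k] (n : ℕ) : ProjSpace k n ⟶ Spec (.of k) :=
  Proj.toSpecZero _ ≫ Spec.map (CommRingCat.ofHom
    (algebraMap k (homogeneousSubmodule (Fin (n + 1)) k 0)))

/-- `ℙⁿ_k` as a scheme over `Spec k`. -/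
abbrev ProjOver (k : Type) [Field k] (n : ℕ) : Over (Spec (CommRingCat.of k)) :=
  Over.mk (ProjSpace.structMap k n)

theorem ringKrullDim_eq_of_isIntegral (R S : Type*) [CommRing R] [CommRing S] [Algebra R S]
    [Algebra.IsIntegral R S] [FaithfulSMul R S] : ringKrullDim R = ringKrullDim S := by
  apply le_antisymm
  · rcases subsingleton_or_nontrivial R with h | h
    · simp [ringKrullDim_eq_bot_of_subsingleton]
    refine iSup_le fun l => ?_
    obtain ⟨Q, hQ, hQl⟩ := Ideal.exists_ideal_over_prime_of_isIntegral (S := S)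
      l.head.asIdeal ⊥ (by
        intro x hx
        have : algebraMap R S x = 0 := hx
        rw [(FaithfulSMul.algebraMap_eq_zero_iff R S).1 this]; exact zero_mem _)
    have : Q.LiesOver l.head.asIdeal := ⟨hQl.2.symm⟩
    have := hQl.1
    have := Algebra.HasGoingUp.of_isIntegral (R := R) (S := S)
    obtain ⟨L, hL, -⟩ := Ideal.exists_ltSeries_of_hasGoingUp (S := S) l Q
    rw [← hL]
    exact le_iSup (fun p : LTSeries (PrimeSpectrum S) => (p.length : WithBot ℕ∞)) L
  · refine Order.krullDim_le_of_strictMono (PrimeSpectrum.comap (algebraMap R S)) ?_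
    intro p q hpq
    exact Ideal.IsIntegral.comap_lt_comap (R := R) (I := p.asIdeal) (J := q.asIdeal) hpq

theorem height_le_of_liesOver_of_hasGoingDown {R S : Type*} [CommRing R] [CommRing S]
    [IsNoetherianRing R] [IsNoetherianRing S] [Algebra R S] [Algebra.HasGoingDown R S]
    (p : Ideal R) [p.IsPrime] (P : Ideal S) [P.IsPrime] [P.LiesOver p] :
    p.height ≤ P.height := by
  rw [Ideal.height_eq_height_add_of_liesOver_of_hasGoingDown p P]
  exact le_self_add

section
variable {k : Type*} [Field k]

theorem MvPolynomial.ringKrullDim_field (σ : Type*) [Finite σ] :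
    ringKrullDim (MvPolynomial σ k) = (Nat.card σ : WithBot ℕ∞) := by
  rw [MvPolynomial.ringKrullDim_of_isNoetherianRing]; simp

instance MvPolynomial.finiteRingKrullDim_field (σ : Type*) [Finite σ] :
    FiniteRingKrullDim (MvPolynomial σ k) := by
  rw [finiteRingKrullDim_iff_ne_bot_and_top, MvPolynomial.ringKrullDim_field]
  exact ⟨by simp, ne_of_beq_false rfl⟩

theorem MvPolynomial.height_eq_of_isMaximal [IsAlgClosed k] {σ : Type*} [Finite σ]
    (m : Ideal (MvPolynomial σ k)) [hm : m.IsMaximal] : m.height = Nat.card σ := by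
  obtain ⟨p, hp, hp'⟩ := Ideal.exists_isMaximal_height (R := MvPolynomial σ k)
  rw [ringKrullDim_field] at hp'
  have hp' : p.height = Nat.card σ := by exact_mod_cast hp'
  obtain ⟨x, rfl⟩ := isMaximal_iff_eq_vanishingIdeal_singleton.1 hp
  obtain ⟨y, rfl⟩ := isMaximal_iff_eq_vanishingIdeal_singleton.1 hm
  have key : ∀ c : σ → k, (aeval (fun i => X i + C (c i))).comp
      (aeval (fun i => X i - C (c i))) = AlgHom.id k (MvPolynomial σ k) := by
    intro c; ext i; simp [MvPolynomial.algHom_C, MvPolynomial.algebraMap_eq]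
  have key' : ∀ c : σ → k, (aeval (fun i => X i - C (c i))).comp
      (aeval (fun i => X i + C (c i))) = AlgHom.id k (MvPolynomial σ k) := by
    intro c; ext i; simp [MvPolynomial.algHom_C, MvPolynomial.algebraMap_eq]
  let e : MvPolynomial σ k ≃ₐ[k] MvPolynomial σ k :=
    AlgEquiv.ofAlgHom (aeval (fun i => X i + C (y i - x i))) (aeval (fun i => X i - C (y i - x i)))
      (key _) (key' _)
  rw [← hp', ← RingEquiv.height_comap e.toRingEquiv (vanishingIdeal k {x})]
  congr 1
  have h : (aeval x).comp (e : MvPolynomial σ k →ₐ[k] MvPolynomial σ k) = aeval y := by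
    ext i; simp [e]
  ext f
  have h' : aeval x (e f) = aeval y f := by rw [← h]; rfl
  change _ ↔ e f ∈ vanishingIdeal k {x}
  simp only [mem_vanishingIdeal_iff, Set.mem_singleton_iff, forall_eq, h']

theorem ringKrullDim_le_quotient_add_one [IsAlgClosed k] {B : Type*} [CommRing B] [IsDomain B]
    [Algebra k B] [Algebra.FiniteType k B] (f : B) (P : Ideal B)
    (hP : P ∈ (Ideal.span {f}).minimalPrimes) :
    ringKrullDim B ≤ ringKrullDim (B ⧸ P) + 1 := by
  obtain ⟨d, g, hg, hgi⟩ := exists_integral_inj_algHom_of_fg k B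
  let _ : Algebra (MvPolynomial (Fin d) k) B := g.toAlgebra
  have : Algebra.IsIntegral (MvPolynomial (Fin d) k) B := ⟨hgi⟩
  have : FaithfulSMul (MvPolynomial (Fin d) k) B := (faithfulSMul_iff_algebraMap_injective _ _).2 hg
  have : IsNoetherianRing B := Algebra.FiniteType.isNoetherianRing k B
  have hPp : P.IsPrime := hP.1.1
  set q := P.under (MvPolynomial (Fin d) k) with hq
  have : P.LiesOver q := ⟨rfl⟩
  have hq1 : q.height ≤ 1 := (height_le_of_liesOver_of_hasGoingDown q P).trans
    (Ideal.height_le_one_of_isPrincipal_of_mem_minimalPrimes _ _ hP)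
  have : Algebra.IsIntegral (MvPolynomial (Fin d) k ⧸ q) (B ⧸ P) := inferInstance
  have : FaithfulSMul (MvPolynomial (Fin d) k ⧸ q) (B ⧸ P) := inferInstance
  rw [← ringKrullDim_eq_of_isIntegral (MvPolynomial (Fin d) k ⧸ q) (B ⧸ P),
    ← ringKrullDim_eq_of_isIntegral (MvPolynomial (Fin d) k) B]
  by_cases h0 : q = ⊥
  · rw [h0, ringKrullDim_eq_of_ringEquiv (RingEquiv.quotientBot (MvPolynomial (Fin d) k))]
    exact le_add_of_nonneg_right zero_le_one
  obtain ⟨p, hp, hpp⟩ := Ideal.IsPrime.exists_mem_prime_of_ne_bot (I := q) inferInstance h0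
  have hq1 : q.height = 1 := by
    refine le_antisymm hq1 ?_
    rw [Order.one_le_iff_ne_zero, Ne, Ideal.height_eq_zero_iff_eq_bot]
    exact h0
  rw [Ideal.eq_span_singleton_of_height_eq_one hq1 hp hpp]
  obtain ⟨m, hm, hqm⟩ := Ideal.exists_le_maximal q (Ideal.IsPrime.ne_top inferInstance)
  have := Ideal.height_le_ringKrullDim_quotient_add_one (hqm hp)
  rw [height_eq_of_isMaximal] at this
  rwa [ringKrullDim_field]

/-- The Krull dimension of the quotient by an ideal, as a natural number. -/
def Ideal.quotDim {R : Type*} [CommRing R] (P : Ideal R) : ℕ :=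
  ((ringKrullDim (R ⧸ P)).unbotD 0).toNat

theorem Ideal.coe_quotDim {R : Type*} [CommRing R] [FiniteRingKrullDim R] (P : Ideal R)
    (hP : P ≠ ⊤) : (P.quotDim : WithBot ℕ∞) = ringKrullDim (R ⧸ P) := by
  have : Nontrivial (R ⧸ P) := Ideal.Quotient.nontrivial_iff.2 hP
  have h1 : ringKrullDim (R ⧸ P) ≠ ⊤ := fun h => ringKrullDim_ne_top (R := R) <| top_le_iff.1 <|
    h ▸ ringKrullDim_quotient_le P
  have h2 : ringKrullDim (R ⧸ P) ≠ ⊥ :=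
    fun h => by simpa [h] using ringKrullDim_nonneg_of_nontrivial (R := R ⧸ P)
  unfold Ideal.quotDim
  cases h : ringKrullDim (R ⧸ P) with
  | bot => exact absurd h h2
  | coe a =>
    cases a with
    | top => exact absurd h h1
    | coe a => rfl

theorem Ideal.quotDim_succ_le_of_lt {R : Type*} [CommRing R] [FiniteRingKrullDim R]
    {P Q : Ideal R} [P.IsPrime] (hQ : Q ≠ ⊤) (h : P < Q) : Q.quotDim + 1 ≤ P.quotDim := by
  obtain ⟨f, hfQ, hfP⟩ := SetLike.exists_of_lt h
  have h1 := ringKrullDim_quotient_succ_le_of_nonZeroDivisor (R := R ⧸ P)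
    (r := Ideal.Quotient.mk P f) (mem_nonZeroDivisors_of_ne_zero (by
      rwa [Ne, Ideal.Quotient.eq_zero_iff_mem]))
  have h2 : ringKrullDim (R ⧸ Q) ≤
      ringKrullDim ((R ⧸ P) ⧸ Ideal.span {Ideal.Quotient.mk P f}) := by
    refine ringKrullDim_le_of_surjective (Ideal.Quotient.lift _ (Ideal.Quotient.factor h.le) ?_) ?_
    · intro a ha
      obtain ⟨b, rfl⟩ := Ideal.mem_span_singleton'.1 ha
      simp [Ideal.Quotient.eq_zero_iff_mem.2 hfQ]
    · exact Ideal.Quotient.lift_surjective_of_surjective _ _ (Ideal.Quotient.factor_surjective h.le)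
  have h3 : ringKrullDim (R ⧸ Q) + 1 ≤ ringKrullDim (R ⧸ P) :=
    (add_le_add_left h2 1).trans h1
  rw [← coe_quotDim _ hQ, ← coe_quotDim _ (Ideal.IsPrime.ne_top ‹_›)] at h3
  exact_mod_cast h3

theorem Ideal.quotDim_anti {R : Type*} [CommRing R] [FiniteRingKrullDim R]
    {P Q : Ideal R} (hQ : Q ≠ ⊤) (h : P ≤ Q) : Q.quotDim ≤ P.quotDim := by
  have h3 : ringKrullDim (R ⧸ Q) ≤ ringKrullDim (R ⧸ P) :=
    ringKrullDim_le_of_surjective _ (Ideal.Quotient.factor_surjective h)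
  rw [← coe_quotDim _ hQ, ← coe_quotDim _ (fun h' => hQ (top_le_iff.1 (h' ▸ h)))] at h3
  exact_mod_cast h3

section
variable [IsAlgClosed k] {σ : Type*} [Finite σ]

theorem quotDim_le_succ (Q : Ideal (MvPolynomial σ k)) [Q.IsPrime] (f : MvPolynomial σ k)
    (P : Ideal (MvPolynomial σ k)) (hP : P ∈ (Q ⊔ Ideal.span {f}).minimalPrimes) :
    Q.quotDim ≤ P.quotDim + 1 := by
  have hPp : P.IsPrime := hP.1.1
  have hQP : Q ≤ P := le_sup_left.trans hP.1.2
  have hker : RingHom.ker (Ideal.Quotient.mk Q) ≤ P := by rwa [Ideal.mk_ker]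
  have hcm : (P.map (Ideal.Quotient.mk Q)).comap (Ideal.Quotient.mk Q) = P := by
    rw [Ideal.comap_map_of_surjective' _ Ideal.Quotient.mk_surjective, sup_eq_left.2 hker]
  have h1 : P.map (Ideal.Quotient.mk Q) ∈
      (Ideal.span {Ideal.Quotient.mk Q f}).minimalPrimes := by
    refine ⟨⟨Ideal.map_isPrime_of_surjective Ideal.Quotient.mk_surjective hker, ?_⟩, ?_⟩
    · rw [Ideal.span_singleton_le_iff_mem]
      exact Ideal.mem_map_of_mem _ (hP.1.2 (le_sup_right (a := Q) (Ideal.mem_span_singleton_self f)))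
    · rintro J ⟨hJ, hfJ⟩ hJP
      have := hP.2 (y := J.comap (Ideal.Quotient.mk Q)) ⟨inferInstance, ?_⟩ ?_
      · rw [← Ideal.map_le_iff_le_comap] at this
        exact this
      · refine sup_le (fun x hx => ?_) ?_
        · simp [Ideal.Quotient.eq_zero_iff_mem.2 hx]
        · rw [Ideal.span_singleton_le_iff_mem, Ideal.mem_comap]
          exact (Ideal.span_singleton_le_iff_mem (I := J)).1 hfJ
      · rw [← hcm]; exact Ideal.comap_mono hJP
  have h2 := ringKrullDim_le_quotient_add_one (k := k) (Ideal.Quotient.mk Q f) _ h1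
  rw [ringKrullDim_eq_of_ringEquiv (DoubleQuot.quotQuotEquivQuotOfLE hQP),
    ← Ideal.coe_quotDim _ (Ideal.IsPrime.ne_top ‹_›),
    ← Ideal.coe_quotDim _ (Ideal.IsPrime.ne_top ‹_›)] at h2
  exact_mod_cast h2

theorem quotDim_le_add_card (Q : Ideal (MvPolynomial σ k)) [Q.IsPrime]
    (s : Finset (MvPolynomial σ k))
    (P : Ideal (MvPolynomial σ k))
    (hP : P ∈ (Q ⊔ Ideal.span (s : Set (MvPolynomial σ k))).minimalPrimes) :
    Q.quotDim ≤ P.quotDim + s.card := by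
  classical
  induction s using Finset.induction_on generalizing P with
  | empty =>
    simp only [Finset.coe_empty, Ideal.span_empty, bot_le, sup_of_le_left,
      Ideal.minimalPrimes_eq_subsingleton_self, Set.mem_singleton_iff] at hP
    simp [hP]
  | insert f s hf ih =>
    have hPp : P.IsPrime := hP.1.1
    rw [Finset.coe_insert, Set.insert_eq, Set.union_comm, Ideal.span_union, ← sup_assoc] at hP
    obtain ⟨P', hP', hPP⟩ := Ideal.exists_minimalPrimes_le (le_sup_left.trans hP.1.2)
    have := hP'.1.1
    have h1 := ih P' hP'
    have h2 : P ∈ (P' ⊔ Ideal.span {f}).minimalPrimes := by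
      refine ⟨⟨hP.1.1, sup_le hPP (le_sup_right.trans hP.1.2)⟩, ?_⟩
      rintro J ⟨hJ, hJ'⟩ hJP
      exact hP.2 ⟨hJ, sup_le (hP'.1.2.trans (le_sup_left.trans hJ')) (le_sup_right.trans hJ')⟩ hJP
    have h3 := quotDim_le_succ P' f P h2
    rw [Finset.card_insert_of_notMem hf]
    omega
end
end

section

open scoped TensorProduct

variable {k : Type*} [Field k]

section

variable {σ τ : Type*}

/-- The ideal generated by `P` in the first and `P'` in the second set of variables. -/
def Ideal.external (P : Ideal (MvPolynomial σ k)) (P' : Ideal (MvPolynomial τ k)) :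
    Ideal (MvPolynomial (σ ⊕ τ) k) :=
  P.map (rename (R := k) (Sum.inl : σ → σ ⊕ τ)) ⊔ P'.map (rename (R := k) (Sum.inr : τ → σ ⊕ τ))

/-- The quotient map by `P.external P'`, onto the coordinate ring of the product. -/
def externalHom (P : Ideal (MvPolynomial σ k)) (P' : Ideal (MvPolynomial τ k)) :
    MvPolynomial (σ ⊕ τ) k →ₐ[k] (MvPolynomial σ k ⧸ P) ⊗[k] (MvPolynomial τ k ⧸ P') :=
  aeval (Sum.elim (fun i => Ideal.Quotient.mk P (X i) ⊗ₜ[k] 1)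
    (fun j => 1 ⊗ₜ[k] Ideal.Quotient.mk P' (X j)))

theorem externalHom_rename_inl (P : Ideal (MvPolynomial σ k)) (P' : Ideal (MvPolynomial τ k))
    (f : MvPolynomial σ k) :
    externalHom P P' (rename Sum.inl f) = Ideal.Quotient.mk P f ⊗ₜ 1 := by
  have : (externalHom P P').comp (rename Sum.inl) =
      (Algebra.TensorProduct.includeLeft).comp (Ideal.Quotient.mkₐ k P) := by
    ext i; simp [externalHom]
  exact DFunLike.congr_fun this f

theorem externalHom_rename_inr (P : Ideal (MvPolynomial σ k)) (P' : Ideal (MvPolynomial τ k))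
    (f : MvPolynomial τ k) :
    externalHom P P' (rename Sum.inr f) = 1 ⊗ₜ Ideal.Quotient.mk P' f := by
  have : (externalHom P P').comp (rename Sum.inr) =
      (Algebra.TensorProduct.includeRight).comp (Ideal.Quotient.mkₐ k P') := by
    ext i; simp [externalHom]
  exact DFunLike.congr_fun this f

theorem ker_externalHom (P : Ideal (MvPolynomial σ k)) (P' : Ideal (MvPolynomial τ k)) :
    RingHom.ker (externalHom P P') = P.external P' := by
  apply le_antisymm
  · let φ : MvPolynomial σ k ⧸ P →ₐ[k] MvPolynomial (σ ⊕ τ) k ⧸ P.external P' :=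
      Ideal.quotientMapₐ _ (rename Sum.inl) (Ideal.map_le_iff_le_comap.1 le_sup_left)
    let ψ : MvPolynomial τ k ⧸ P' →ₐ[k] MvPolynomial (σ ⊕ τ) k ⧸ P.external P' :=
      Ideal.quotientMapₐ _ (rename Sum.inr) (Ideal.map_le_iff_le_comap.1 le_sup_right)
    let Ψ := Algebra.TensorProduct.lift φ ψ (fun _ _ => Commute.all _ _)
    have h : Ψ.comp (externalHom P P') = Ideal.Quotient.mkₐ k _ := by
      ext i
      rcases i with i | i <;> simp [Ψ, externalHom, φ, ψ]
    intro f hf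
    have hf : externalHom P P' f = 0 := hf
    have := DFunLike.congr_fun h f
    rw [AlgHom.comp_apply, hf, map_zero] at this
    exact Ideal.Quotient.eq_zero_iff_mem.1 this.symm
  · refine sup_le (Ideal.map_le_iff_le_comap.2 fun f hf => ?_)
      (Ideal.map_le_iff_le_comap.2 fun f hf => ?_)
    · simp [RingHom.mem_ker, externalHom_rename_inl, Ideal.Quotient.eq_zero_iff_mem.2 hf]
    · simp [RingHom.mem_ker, externalHom_rename_inr, Ideal.Quotient.eq_zero_iff_mem.2 hf]

theorem comap_inl_external (P : Ideal (MvPolynomial σ k)) (P' : Ideal (MvPolynomial τ k))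
    [P'.IsPrime] : (P.external P').comap (rename (R := k) Sum.inl) = P := by
  ext f
  rw [Ideal.mem_comap, ← ker_externalHom, RingHom.mem_ker, externalHom_rename_inl,
    ← Ideal.Quotient.eq_zero_iff_mem]
  exact (Algebra.TensorProduct.includeLeft_injective (S := k) (A := MvPolynomial σ k ⧸ P)
    (algebraMap k (MvPolynomial τ k ⧸ P')).injective).eq_iff' (map_zero _)

theorem comap_inr_external (P : Ideal (MvPolynomial σ k)) (P' : Ideal (MvPolynomial τ k))
    [P.IsPrime] : (P.external P').comap (rename (R := k) Sum.inr) = P' := by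
  ext f
  rw [Ideal.mem_comap, ← ker_externalHom, RingHom.mem_ker, externalHom_rename_inr,
    ← Ideal.Quotient.eq_zero_iff_mem]
  exact (Algebra.TensorProduct.includeRight_injective  (B := MvPolynomial τ k ⧸ P')
    (algebraMap k (MvPolynomial σ k ⧸ P)).injective).eq_iff' (map_zero _)

end

variable [IsAlgClosed k]

theorem exists_algHom_apply_ne_zero {A : Type*} [CommRing A] [IsReduced A] [Algebra k A]
    [Algebra.FiniteType k A] {a : A} (ha : a ≠ 0) : ∃ χ : A →ₐ[k] k, χ a ≠ 0 := by
  have hJ : IsJacobsonRing A := isJacobsonRing_of_finiteType (A := k)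
  have h : a ∉ Ideal.jacobson (⊥ : Ideal A) := by
    rw [isJacobsonRing_iff.1 hJ ⊥ (fun x ⟨n, hn⟩ => by
      simpa using IsReduced.eq_zero x ⟨n, by simpa using hn⟩)]
    simpa using ha
  rw [Ideal.jacobson, Ideal.mem_sInf] at h
  push Not at h
  obtain ⟨m, ⟨-, hm⟩, ham⟩ := h
  let _ := Ideal.Quotient.field m
  have : Algebra.FiniteType k (A ⧸ m) := inferInstance
  have : Module.Finite k (A ⧸ m) := finite_of_finite_type_of_isJacobsonRing _ _
  have : Algebra.IsAlgebraic k (A ⧸ m) := inferInstance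
  let ψ : (A ⧸ m) →ₐ[k] k := IsAlgClosed.lift
  refine ⟨ψ.comp (Ideal.Quotient.mkₐ k m), fun h => ham ?_⟩
  have h : ψ (Ideal.Quotient.mk m a) = 0 := h
  rwa [map_eq_zero, Ideal.Quotient.eq_zero_iff_mem] at h

theorem isDomain_tensorProduct {A B : Type*} [CommRing A] [CommRing B] [IsDomain A] [IsDomain B]
    [Algebra k A] [Algebra k B] [Algebra.FiniteType k A] : IsDomain (A ⊗[k] B) := by
  let b := Module.Basis.ofVectorSpace k B
  let b' := Algebra.TensorProduct.basis A b
  let Φ : (A →ₐ[k] k) → (A ⊗[k] B →ₐ[k] B) := fun χ =>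
    Algebra.TensorProduct.lift ((Algebra.ofId k B).comp χ) (AlgHom.id k B)
      (fun _ _ => Commute.all _ _)
  have hΦ : ∀ χ u, b.repr (Φ χ u) = (b'.repr u).mapRange χ (map_zero χ) := by
    intro χ u
    induction u using TensorProduct.induction_on with
    | zero => simp
    | add x y hx hy => rw [map_add, map_add, hx, hy, map_add, Finsupp.mapRange_add (map_add χ)]
    | tmul x y =>
      ext i
      simp [Φ, b', Algebra.ofId_apply, ← Algebra.smul_def]
  have : NoZeroDivisors (A ⊗[k] B) := by
    refine ⟨fun {u v} huv => ?_⟩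
    by_contra! h
    have key : ∀ u : A ⊗[k] B, u ≠ 0 → ∃ i, b'.repr u i ≠ 0 := by
      intro u hu
      by_contra! h
      exact hu (b'.repr.map_eq_zero_iff.1 (Finsupp.ext h))
    obtain ⟨i, hi⟩ := key u h.1
    obtain ⟨j, hj⟩ := key v h.2
    obtain ⟨χ, hχ⟩ := exists_algHom_apply_ne_zero (k := k) (mul_ne_zero hi hj)
    rw [map_mul] at hχ
    have h0 : Φ χ u * Φ χ v = 0 := by rw [← map_mul, huv, map_zero]
    rcases mul_eq_zero.1 h0 with h0 | h0
    · have := DFunLike.congr_fun (hΦ χ u) i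
      rw [h0] at this
      exact left_ne_zero_of_mul hχ (by simpa using this.symm)
    · have := DFunLike.congr_fun (hΦ χ v) j
      rw [h0] at this
      exact right_ne_zero_of_mul hχ (by simpa using this.symm)
  have : Nontrivial (A ⊗[k] B) := by
    obtain ⟨χ, -⟩ := exists_algHom_apply_ne_zero (k := k) (one_ne_zero (α := A))
    exact (Φ χ).toRingHom.domain_nontrivial
  exact NoZeroDivisors.to_isDomain _

variable {σ : Type*} [Finite σ] {τ : Type*} [Finite τ]

theorem exists_isPrime_gt_quotDim_le (P : Ideal (MvPolynomial σ k)) [hP : P.IsPrime] {n : ℕ}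
    (h : n + 1 ≤ P.quotDim) :
    ∃ P' : Ideal (MvPolynomial σ k), P'.IsPrime ∧ P < P' ∧ n ≤ P'.quotDim := by
  have hmax : ¬ P.IsMaximal := by
    intro hm
    let _ := Ideal.Quotient.field P
    have h1 := Ideal.coe_quotDim P hP.ne_top
    rw [ringKrullDim_eq_zero_of_field] at h1
    have h2 : P.quotDim = 0 := by exact_mod_cast h1
    omega
  obtain ⟨m, hm, hPm⟩ := Ideal.exists_le_maximal P hP.ne_top
  have hlt : P < m := lt_of_le_of_ne hPm (fun h => hmax (h ▸ hm))
  obtain ⟨f, hfm, hfP⟩ := SetLike.exists_of_lt hlt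
  obtain ⟨P', hP', -⟩ := Ideal.exists_minimalPrimes_le (J := m) (I := P ⊔ Ideal.span {f})
    (sup_le hPm ((Ideal.span_singleton_le_iff_mem _).2 hfm))
  refine ⟨P', hP'.1.1, lt_of_le_of_ne (le_sup_left.trans hP'.1.2) ?_, ?_⟩
  · rintro rfl
    exact hfP (hP'.1.2 (le_sup_right (a := P) (Ideal.mem_span_singleton_self f)))
  · have := quotDim_le_succ P f P' hP'
    omega

instance isPrime_external (P : Ideal (MvPolynomial σ k)) (P' : Ideal (MvPolynomial τ k))
    [P.IsPrime] [P'.IsPrime] : (P.external P').IsPrime := by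
  rw [← ker_externalHom]
  have := isDomain_tensorProduct (k := k) (A := MvPolynomial σ k ⧸ P) (B := MvPolynomial τ k ⧸ P')
  exact RingHom.ker_isPrime _

theorem quotDim_external_le (P : Ideal (MvPolynomial σ k)) (P' : Ideal (MvPolynomial τ k))
    [P.IsPrime] [P'.IsPrime] : P.quotDim + P'.quotDim ≤ (P.external P').quotDim := by
  obtain ⟨n, hn⟩ : ∃ n, n = P.quotDim := ⟨_, rfl⟩
  obtain ⟨m, hm⟩ : ∃ m, m = P'.quotDim := ⟨_, rfl⟩
  rw [← hn, ← hm]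
  replace hn := hn.le
  replace hm := hm.le
  induction n generalizing P with
  | zero =>
    induction m generalizing P' with
    | zero => simp
    | succ m ih =>
      obtain ⟨J, hJ, hlt, hJm⟩ := exists_isPrime_gt_quotDim_le P' hm
      have h1 := ih J hJm
      have h2 : P.external P' < P.external J := by
        refine lt_of_le_of_ne (sup_le_sup le_rfl (Ideal.map_mono hlt.le)) (fun h => hlt.ne ?_)
        rw [← comap_inr_external P P', h, comap_inr_external]
      have := Ideal.quotDim_succ_le_of_lt (Ideal.IsPrime.ne_top inferInstance) h2
      omega
  | succ n ih =>
      obtain ⟨J, hJ, hlt, hJm⟩ := exists_isPrime_gt_quotDim_le P hn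
      have h1 := ih J hJm
      have h2 : P.external P' < J.external P' := by
        refine lt_of_le_of_ne (sup_le_sup (Ideal.map_mono hlt.le) le_rfl) (fun h => hlt.ne ?_)
        rw [← comap_inl_external P P', h, comap_inl_external]
      have := Ideal.quotDim_succ_le_of_lt (Ideal.IsPrime.ne_top inferInstance) h2
      omega
end

section
variable {ι : Type*} {k : Type*} [Field k]

theorem MvPolynomial.totalDegree_le_of_coeff {p : MvPolynomial ι k} {n : ℕ}
    (h : ∀ s, coeff s p ≠ 0 → s.degree ≤ n) : p.totalDegree ≤ n :=
  Finset.sup_le fun s hs => h s (mem_support_iff.1 hs)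

theorem MvPolynomial.degree_le_of_coeff_ne_zero {p : MvPolynomial ι k} {s : ι →₀ ℕ}
    (h : coeff s p ≠ 0) : s.degree ≤ p.totalDegree :=
  le_totalDegree (mem_support_iff.2 h)

theorem MvPolynomial.exists_dvd_sub_of_dvd_sub {i j l : ι} (hil : i ≠ l) (hjl : j ≠ l)
    {N n C : ℕ} {p q : MvPolynomial ι k} (hp : p.totalDegree ≤ n + C)
    (h : X i ^ N ∣ X l ^ n * p - X j ^ n * q) :
    ∃ c : MvPolynomial ι k, c.totalDegree ≤ C ∧ X i ^ N ∣ p - X j ^ n * c := by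
  classical
  set p₀ := p.modMonomial (Finsupp.single i N) with hp₀
  have hpp : X i ^ N ∣ p - p₀ := by
    refine ⟨p.divMonomial (Finsupp.single i N), ?_⟩
    rw [X_pow_eq_monomial, hp₀, sub_eq_iff_eq_add, divMonomial_add_modMonomial]
  have hcoeff : ∀ s, coeff s p₀ ≠ 0 → ¬ Finsupp.single i N ≤ s ∧ coeff s p ≠ 0 := by
    intro s hs
    have hns : ¬ Finsupp.single i N ≤ s := fun hle => hs (coeff_modMonomial_of_le _ hle)
    exact ⟨hns, by rwa [hp₀, coeff_modMonomial_of_not_le _ hns] at hs⟩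
  have key : ∀ s, coeff s p₀ ≠ 0 → Finsupp.single j n ≤ s := by
    intro s hs
    obtain ⟨hns, hs⟩ := hcoeff s hs
    have h1 : coeff (Finsupp.single l n + s) (X l ^ n * p - X j ^ n * q) = 0 := by
      obtain ⟨r, hr⟩ := h
      rw [hr, X_pow_eq_monomial, coeff_monomial_mul', if_neg]
      rw [Finsupp.single_le_iff] at hns ⊢
      simpa [Finsupp.single_apply, hil, hil.symm] using hns
    rw [coeff_sub, X_pow_eq_monomial, coeff_monomial_mul, one_mul, X_pow_eq_monomial,
      coeff_monomial_mul'] at h1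
    split_ifs at h1 with h2
    · rw [Finsupp.single_le_iff] at h2 ⊢
      simpa [Finsupp.single_apply, hjl, hjl.symm] using h2
    · exact absurd (by simpa using h1) hs
  have hp₀j : X j ^ n * p₀.divMonomial (Finsupp.single j n) = p₀ := by
    conv_rhs => rw [← divMonomial_add_modMonomial p₀ (Finsupp.single j n)]
    rw [X_pow_eq_monomial, left_eq_add]
    ext s
    by_cases hs : Finsupp.single j n ≤ s
    · rw [coeff_modMonomial_of_le _ hs, coeff_zero]
    · rw [coeff_modMonomial_of_not_le _ hs, coeff_zero]
      by_contra h'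
      exact hs (key s h')
  refine ⟨p₀.divMonomial (Finsupp.single j n), totalDegree_le_of_coeff fun s hs => ?_, ?_⟩
  · rw [coeff_divMonomial] at hs
    have := (degree_le_of_coeff_ne_zero (hcoeff _ hs).2).trans hp
    rw [map_add, Finsupp.degree_single] at this
    omega
  · rwa [hp₀j]

theorem MvPolynomial.X_pow_dvd_of_X_pow_dvd_mul {i j : ι} (hij : i ≠ j) {N n : ℕ}
    {p : MvPolynomial ι k} (h : X i ^ N ∣ X j ^ n * p) : X i ^ N ∣ p := by
  refine Prime.pow_dvd_of_dvd_mul_left X_prime _ (fun h' => hij ?_) h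
  simpa [X_dvd_X] using X_prime.dvd_of_dvd_pow h'

theorem MvPolynomial.eq_zero_of_X_pow_dvd {i : ι} {N : ℕ} {p : MvPolynomial ι k}
    (hp : p.totalDegree < N) (h : X i ^ N ∣ p) : p = 0 := by
  by_contra hp0
  obtain ⟨q, rfl⟩ := h
  have hq : q ≠ 0 := right_ne_zero_of_mul hp0
  rw [totalDegree_mul_of_isDomain (pow_ne_zero _ (X_ne_zero i)) hq, totalDegree_X_pow] at hp
  omega

theorem eq_zero_of_forall_pow_dvd {B : Type*} [CommRing B] [IsDomain B] [IsNoetherianRing B]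
    (p : Ideal B) [hp : p.IsPrime] {x u : B} (hx : x ∈ p) (N₀ : ℕ)
    (h : ∀ N, N₀ ≤ N → ∃ t ∉ p, x ^ N ∣ t * u) : u = 0 := by
  have h1 : algebraMap B (Localization.AtPrime p) u ∈
      ⨅ N, (IsLocalRing.maximalIdeal (Localization.AtPrime p)) ^ N := by
    rw [Ideal.mem_iInf]
    intro N
    obtain ⟨t, ht, r, hr⟩ := h (N₀ + N) (by omega)
    have hu : IsUnit (algebraMap B (Localization.AtPrime p) t) :=
      IsLocalization.map_units _ (⟨t, ht⟩ : p.primeCompl)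
    rw [← Ideal.unit_mul_mem_iff_mem _ hu, ← map_mul, hr, pow_add, mul_comm (x ^ N₀), mul_assoc,
      map_mul, map_pow]
    refine Ideal.mul_mem_right _ _ (Ideal.pow_mem_pow ?_ _)
    rw [← Localization.AtPrime.map_eq_maximalIdeal]
    exact Ideal.mem_map_of_mem _ hx
  rw [Ideal.iInf_pow_eq_bot_of_isLocalRing _ (Ideal.IsPrime.ne_top inferInstance),
    Ideal.mem_bot] at h1
  exact (IsLocalization.injective (Localization.AtPrime p) p.primeCompl_le_nonZeroDivisors)
    (by rw [h1, map_zero])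

theorem false_of_algebraMap_retraction {B : Type*} [CommRing B] [IsDomain B] [IsNoetherianRing B]
    [Algebra (MvPolynomial ι k) B] [FaithfulSMul (MvPolynomial ι k) B] {κ : Type*}
    (φ : B →ₗ[MvPolynomial ι k] κ →₀ MvPolynomial ι k)
    (ψ : (κ →₀ MvPolynomial ι k) →ₗ[MvPolynomial ι k] B) {s : MvPolynomial ι k} (hs : s ≠ 0)
    (hψφ : ∀ u, ψ (φ u) = s • u) {i j l : ι} (hij : i ≠ j) (hil : i ≠ l) (hjl : j ≠ l)
    {x y z : B} (hx : algebraMap (MvPolynomial ι k) B (X i) = x)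
    (hy : algebraMap (MvPolynomial ι k) B (X j) = y)
    (hz : algebraMap (MvPolynomial ι k) B (X l) = z)
    (p₁ p₂ : Ideal B) [p₁.IsPrime] [p₂.IsPrime] (hx₁ : x ∈ p₁) (hx₂ : x ∈ p₂) (hy₁ : y ∉ p₁)
    (hy₂ : y ∉ p₂) (C : ℕ)
    (n : ℕ → ℕ) (a b a' b' : ℕ → B) (hab : ∀ N, y ^ n N = a N + b N)
    (hab' : ∀ N, z ^ n N = a' N + b' N)
    (hd : ∀ N N', N ≤ N' → x ^ N ∣ a N * b N') (hd' : ∀ N N', N ≤ N' → x ^ N ∣ b N * a N')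
    (hd₁ : ∀ N, x ^ N ∣ b' N * a N) (hd₂ : ∀ N, x ^ N ∣ b N * a' N)
    (ha : ∀ N, 0 < N → a N ∈ p₁) (hb : ∀ N, 0 < N → b N ∈ p₂)
    (hdeg : ∀ N i, (φ (a N) i).totalDegree ≤ n N + C) : False := by
  have e1 : ∀ N t, ∃ c : MvPolynomial ι k, c.totalDegree ≤ C ∧
      X i ^ N ∣ φ (a N) t - X j ^ n N * c := by
    intro N t
    refine exists_dvd_sub_of_dvd_sub (q := φ (a' N) t) hil hjl (hdeg N t) ?_
    obtain ⟨w, hw⟩ : x ^ N ∣ z ^ n N * a N - y ^ n N * a' N := by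
      rw [hab N, hab' N]
      have : (a' N + b' N) * a N - (a N + b N) * a' N = b' N * a N - b N * a' N := by ring
      rw [this]
      exact dvd_sub (hd₁ N) (hd₂ N)
    refine ⟨φ w t, ?_⟩
    have h1 : (X l ^ n N : MvPolynomial ι k) • a N - (X j ^ n N : MvPolynomial ι k) • a' N =
        (X i ^ N : MvPolynomial ι k) • w := by
      simp only [Algebra.smul_def, map_pow, hx, hy, hz, hw]
    have h2 := congrArg (fun u => φ u t) h1
    simpa using h2
  choose c hcd hc using e1
  have hcc : ∀ N, C < N → ∀ t, c N t = c (C + 1) t := by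
    intro N hN t
    obtain ⟨w, hw⟩ : x ^ (C + 1) ∣ y ^ n N * a (C + 1) - y ^ n (C + 1) * a N := by
      rw [hab N, hab (C + 1)]
      have : (a N + b N) * a (C + 1) - (a (C + 1) + b (C + 1)) * a N =
        a (C + 1) * b N - b (C + 1) * a N := by ring
      rw [this]
      exact dvd_sub (hd _ _ hN) (hd' _ _ hN)
    have h1 : (X j ^ n N : MvPolynomial ι k) • a (C + 1) -
        (X j ^ n (C + 1) : MvPolynomial ι k) • a N = (X i ^ (C + 1) : MvPolynomial ι k) • w := by
      simp only [Algebra.smul_def, map_pow, hx, hy, hw]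
    have h2 : X j ^ n N * φ (a (C + 1)) t - X j ^ n (C + 1) * φ (a N) t =
        X i ^ (C + 1) * φ w t := by
      simpa using congrArg (fun u => φ u t) h1
    have h3 : (X i ^ (C + 1) : MvPolynomial ι k) ∣
        X j ^ (n N + n (C + 1)) * (c N t - c (C + 1) t) := by
      have : X j ^ (n N + n (C + 1)) * (c N t - c (C + 1) t) =
        X j ^ n N * (φ (a (C + 1)) t - X j ^ n (C + 1) * c (C + 1) t) -
        X j ^ n (C + 1) * (φ (a N) t - X j ^ n N * c N t) -
        (X j ^ n N * φ (a (C + 1)) t - X j ^ n (C + 1) * φ (a N) t) := by ring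
      rw [this, h2]
      exact dvd_sub (dvd_sub ((hc _ _).mul_left _)
        (((pow_dvd_pow _ hN).trans (hc _ _)).mul_left _)) (dvd_mul_right _ _)
    have h4 : (X i ^ (C + 1) : MvPolynomial ι k) ∣ c N t - c (C + 1) t :=
      X_pow_dvd_of_X_pow_dvd_mul hij h3
    refine sub_eq_zero.1 (eq_zero_of_X_pow_dvd (i := i) (N := C + 1) ?_ h4)
    exact Nat.lt_succ_of_le ((totalDegree_sub _ _).trans (max_le (hcd _ _) (hcd _ _)))
  have hcs : ∀ t, φ (a (C + 1)) t = 0 → c (C + 1) t = 0 := by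
    intro t ht
    have h := hc (C + 1) t
    rw [ht, zero_sub, dvd_neg] at h
    exact eq_zero_of_X_pow_dvd (Nat.lt_succ_of_le (hcd _ _))
      (X_pow_dvd_of_X_pow_dvd_mul hij h)
  let c₀ : κ →₀ MvPolynomial ι k := Finsupp.ofSupportFinite (c (C + 1))
    ((φ (a (C + 1))).hasFiniteSupport.subset fun t ht h => ht (hcs t (by simpa using h)))
  have hc₀ : ∀ t, c₀ t = c (C + 1) t := fun _ => rfl
  set β := ψ c₀ with hβ
  set σ := algebraMap (MvPolynomial ι k) B s with hσ
  have hσ0 : σ ≠ 0 := by rwa [hσ, Ne, FaithfulSMul.algebraMap_eq_zero_iff]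
  have key : ∀ N, C < N → x ^ N ∣ y ^ n N * β - σ * a N := by
    intro N hN
    have h1 : ∃ w : κ →₀ MvPolynomial ι k,
      (X j ^ n N : MvPolynomial ι k) • c₀ - φ (a N) = (X i ^ N : MvPolynomial ι k) • w := by
      have h2 := fun t => (dvd_sub_comm.1 (hc N t))
      choose w hw using h2
      have hfin : Function.HasFiniteSupport w := by
        refine ((X j ^ n N : MvPolynomial ι k) • c₀ - φ (a N)).hasFiniteSupport.subset ?_
        intro t ht h
        have h' : X j ^ n N * c N t - φ (a N) t = 0 := by
          rw [hcc N hN, ← hc₀]; simpa using h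
        rw [hw] at h'
        exact ht ((mul_eq_zero.1 h').resolve_left (pow_ne_zero _ (X_ne_zero i)))
      refine ⟨Finsupp.ofSupportFinite w hfin, ?_⟩
      ext1 t
      have h' : Finsupp.ofSupportFinite w hfin t = w t := rfl
      have := hw t
      rw [hcc N hN, ← hc₀] at this
      simpa [h'] using this
    obtain ⟨w, hw⟩ := h1
    refine ⟨ψ w, ?_⟩
    have := congrArg ψ hw
    simpa [hψφ, Algebra.smul_def, hx, hy] using this
  have hββ : β ^ 2 - σ * β = 0 := by
    refine eq_zero_of_forall_pow_dvd p₁ hx₁ (C + 1) fun N hN => ⟨y ^ (2 * n N), ?_, ?_⟩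
    · exact fun h => hy₁ (Ideal.IsPrime.mem_of_pow_mem ‹_› _ h)
    obtain ⟨w, hw⟩ := key N hN
    obtain ⟨v, hv⟩ := hd N N le_rfl
    have h1 : y ^ n N * β = σ * a N + x ^ N * w := by rw [← hw]; ring
    refine ⟨w * (2 * σ * a N + x ^ N * w) - σ * y ^ n N * w - σ ^ 2 * v, ?_⟩
    have h2 : y ^ (2 * n N) * (β ^ 2 - σ * β) = (y ^ n N * β) ^ 2 -
      σ * y ^ n N * (y ^ n N * β) := by ring
    rw [h2, h1]
    have h3 : σ * y ^ n N * (σ * a N) = σ ^ 2 * (a N * a N) + σ ^ 2 * (a N * b N) := by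
      rw [hab N]; ring
    rw [mul_add (σ * y ^ n N), h3, hv]
    ring
  have hββ : β * (β - σ) = 0 := by rw [← hββ]; ring
  rcases mul_eq_zero.1 hββ with h | h
  · refine hσ0 (eq_zero_of_forall_pow_dvd p₂ hx₂ (C + 1) fun N hN => ⟨a N, ?_, ?_⟩)
    · intro h
      refine hy₂ (Ideal.IsPrime.mem_of_pow_mem ‹_› (n N) ?_)
      rw [hab]
      exact add_mem h (hb N (by omega))
    · have := key N hN
      rwa [h, mul_zero, zero_sub, dvd_neg, mul_comm] at this
  · refine hσ0 (eq_zero_of_forall_pow_dvd p₁ hx₁ (C + 1) fun N hN => ⟨b N, ?_, ?_⟩)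
    · intro h
      refine hy₁ (Ideal.IsPrime.mem_of_pow_mem ‹_› (n N) ?_)
      rw [hab]
      exact add_mem (ha N (by omega)) h
    · have := key N hN
      rw [sub_eq_zero.1 h, hab N] at this
      have e : (a N + b N) * σ - σ * a N = b N * σ := by ring
      rwa [e] at this
end

section
variable {k : Type*} [Field k] {τ : Type*}

local notation "𝓗" => homogeneousSubmodule τ k

theorem isHomogeneous_of_mem_minimalPrimes {I P : Ideal (MvPolynomial τ k)}
    (hI : I.IsHomogeneous 𝓗) (hP : P ∈ I.minimalPrimes) : P.IsHomogeneous 𝓗 := by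
  classical
  have h1 : (P.homogeneousCore 𝓗).toIdeal ≤ P := Ideal.toIdeal_homogeneousCore_le _ _
  have h2 : I ≤ (P.homogeneousCore 𝓗).toIdeal := by
    intro f hf
    rw [← DirectSum.sum_support_decompose 𝓗 f]
    refine sum_mem fun i _ => ?_
    exact Ideal.mem_homogeneousCore_of_homogeneous_of_mem
      (SetLike.isHomogeneousElem_coe _) (hP.1.2 (hI i hf))
  have := hP.1.1
  have h3 := hP.2 (y := (P.homogeneousCore 𝓗).toIdeal)
    ⟨Ideal.IsPrime.homogeneousCore this, h2⟩ h1
  have h4 : P = (P.homogeneousCore 𝓗).toIdeal := le_antisymm h3 h1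
  rw [h4]
  exact HomogeneousIdeal.isHomogeneous _

theorem exists_isHomogeneous_mem_notMem {I P : Ideal (MvPolynomial τ k)}
    (hI : I.IsHomogeneous 𝓗) (h : ¬ I ≤ P) :
    ∃ f ∈ I, f ∉ P ∧ ∃ e, f.IsHomogeneous e := by
  classical
  by_contra! h'
  refine h fun f hf => ?_
  rw [← DirectSum.sum_support_decompose 𝓗 f]
  refine sum_mem fun i _ => ?_
  by_contra h''
  exact h' _ (hI i hf) h'' i (DirectSum.decompose 𝓗 f i).2

theorem mem_idealOfVars_of_isHomogeneous {f : MvPolynomial τ k} {e : ℕ} (hf : f.IsHomogeneous e)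
    {n : ℕ} (hn : n ≤ e) : f ∈ idealOfVars τ k ^ n := by
  rw [mem_pow_idealOfVars_iff]
  intro s hs
  have := hf (mem_support_iff.1 hs)
  rw [Finsupp.degree_eq_weight_one]
  exact hn.trans this.ge

theorem eq_C_of_isHomogeneous_zero {f : MvPolynomial τ k} (hf : f.IsHomogeneous 0) :
    f = C (coeff 0 f) :=
  totalDegree_eq_zero_iff_eq_C.1 (Nat.le_zero.1 hf.totalDegree_le)

theorem le_idealOfVars {I : Ideal (MvPolynomial τ k)} (hI : I.IsHomogeneous 𝓗) (h : I ≠ ⊤) :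
    I ≤ idealOfVars τ k := by
  by_contra h'
  obtain ⟨f, hf, hfm, e, he⟩ := exists_isHomogeneous_mem_notMem hI h'
  rcases Nat.eq_zero_or_pos e with rfl | h0
  · rw [eq_C_of_isHomogeneous_zero he] at hf hfm
    refine h (Ideal.eq_top_of_isUnit_mem _ hf (IsUnit.map _ (isUnit_iff_ne_zero.2 fun h0 => ?_)))
    exact hfm (by rw [h0, map_zero]; exact zero_mem _)
  · exact hfm (pow_one (idealOfVars τ k) ▸ mem_idealOfVars_of_isHomogeneous he h0)

theorem exists_isHomogeneous_avoid (s : Finset (Ideal (MvPolynomial τ k)))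
    (hs : ∀ P ∈ s, P.IsPrime ∧ P.IsHomogeneous 𝓗)
    (hs' : ∀ P ∈ s, ∀ P' ∈ s, P ≤ P' → P = P') (J : Ideal (MvPolynomial τ k))
    (hJ : J.IsHomogeneous 𝓗) (hJm : J ≤ idealOfVars τ k) (hsJ : ∀ P ∈ s, ¬ J ≤ P) :
    ∃ f ∈ J, (∃ e, 0 < e ∧ f.IsHomogeneous e) ∧ ∀ P ∈ s, f ∉ P := by
  classical
  induction s using Finset.induction_on with
  | empty => exact ⟨0, zero_mem _, ⟨1, one_pos, isHomogeneous_zero _ _ _⟩, by simp⟩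
  | insert P₀ s hP₀ ih =>
    obtain ⟨f, hfJ, ⟨a, ha, hfa⟩, hf⟩ := ih (fun P hP => hs P (Finset.mem_insert_of_mem hP))
      (fun P hP P' hP' => hs' P (Finset.mem_insert_of_mem hP) P' (Finset.mem_insert_of_mem hP'))
      (fun P hP => hsJ P (Finset.mem_insert_of_mem hP))
    have hP₀p := (hs P₀ (Finset.mem_insert_self _ _)).1
    by_cases hfP : f ∈ P₀
    swap
    · exact ⟨f, hfJ, ⟨a, ha, hfa⟩, fun P hP => (Finset.mem_insert.1 hP).elim
        (fun h => h ▸ hfP) (hf P)⟩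
    have h1 : ∀ P ∈ s, ∃ g ∈ P, g ∉ P₀ ∧ ∃ e, g.IsHomogeneous e := fun P hP =>
      exists_isHomogeneous_mem_notMem (hs P (Finset.mem_insert_of_mem hP)).2 fun h =>
        hP₀ (hs' P (Finset.mem_insert_of_mem hP) P₀ (Finset.mem_insert_self _ _) h ▸ hP)
    choose! g hgP hgP₀ e hge using h1
    obtain ⟨h, hhJ, hhP₀, b, hhb⟩ := exists_isHomogeneous_mem_notMem hJ
      (hsJ P₀ (Finset.mem_insert_self _ _))
    have hb : 0 < b := by
      rw [Nat.pos_iff_ne_zero]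
      rintro rfl
      rw [eq_C_of_isHomogeneous_zero hhb] at hhJ hhP₀
      have h2 := hJm hhJ
      rw [← pow_one (idealOfVars τ k), C_mem_pow_idealOfVars_iff] at h2
      simp only [one_ne_zero, or_false] at h2
      exact hhP₀ (by rw [h2, map_zero]; exact zero_mem _)
    set u := h * ∏ P ∈ s, g P with hu
    have huP₀ : u ∉ P₀ := by
      intro hmem
      rcases hP₀p.mem_or_mem hmem with h | h
      · exact hhP₀ h
      · rw [Ideal.IsPrime.prod_mem_iff] at h
        obtain ⟨P, hP, h⟩ := h
        exact hgP₀ P hP h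
    have hud : u.IsHomogeneous (b + ∑ P ∈ s, e P) := hhb.mul (IsHomogeneous.prod _ _ _ hge)
    have huP : ∀ P ∈ s, u ∈ P := fun P hP =>
      Ideal.mul_mem_left _ _ (Ideal.mem_of_dvd _ (Finset.dvd_prod_of_mem g hP) (hgP P hP))
    set c := b + ∑ P ∈ s, e P with hc
    have hc0 : 0 < c := by omega
    refine ⟨f ^ c + u ^ a, add_mem (Ideal.pow_mem_of_mem _ hfJ _ hc0)
      (Ideal.pow_mem_of_mem _ (Ideal.mul_mem_right _ _ hhJ) _ ha), ⟨a * c, by positivity, ?_⟩, ?_⟩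
    · exact (hfa.pow c).add (mul_comm c a ▸ hud.pow a)
    · intro P hP hmem
      rcases Finset.mem_insert.1 hP with rfl | hP
      · rw [add_mem_cancel_left (Ideal.pow_mem_of_mem _ hfP _ hc0)] at hmem
        exact huP₀ (hP₀p.mem_of_pow_mem _ hmem)
      · have := (hs P (Finset.mem_insert_of_mem hP)).1
        rw [add_mem_cancel_right (Ideal.pow_mem_of_mem _ (huP P hP) _ ha)] at hmem
        exact hf P hP (this.mem_of_pow_mem _ hmem)

theorem isHomogeneous_sup_span {Q : Ideal (MvPolynomial τ k)} (hQ : Q.IsHomogeneous 𝓗)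
    {s : Set (MvPolynomial τ k)} (hs : ∀ f ∈ s, ∃ e, f.IsHomogeneous e) :
    (Q ⊔ Ideal.span s).IsHomogeneous 𝓗 :=
  hQ.sup (Ideal.homogeneous_span _ _ fun f hf => hs f hf)

/-- The first `i` members of `θ` are homogeneous of positive degree and cut the dimension of
`V(Q)` down by `i`. -/
structure IsParameters (Q : Ideal (MvPolynomial τ k)) (i : ℕ) (θ : ℕ → MvPolynomial τ k) :
    Prop where
  homogeneous : ∀ j < i, ∃ e, 0 < e ∧ (θ j).IsHomogeneous e
  quotDim_add_le : ∀ P : Ideal (MvPolynomial τ k), P.IsPrime → Q ⊔ Ideal.span (θ '' Set.Iio i) ≤ P →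
    P.quotDim + i ≤ Q.quotDim

theorem isHomogeneous_idealOfVars : (idealOfVars τ k).IsHomogeneous 𝓗 :=
  Ideal.homogeneous_span _ _ (by rintro _ ⟨j, rfl⟩; exact ⟨1, isHomogeneous_X _ _⟩)

theorem IsParameters.exists_same_degree {Q : Ideal (MvPolynomial τ k)} {i : ℕ}
    {θ : ℕ → MvPolynomial τ k} (h : IsParameters Q i θ) :
    ∃ (θ' : ℕ → MvPolynomial τ k) (D : ℕ), 0 < D ∧ IsParameters Q i θ' ∧
      (∀ j < i, (θ' j).IsHomogeneous D) ∧ ∀ j < i, ∃ a, 0 < a ∧ θ' j = θ j ^ a := by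
  choose! e he hθ using h.homogeneous
  set D := ∏ j ∈ Finset.range i, e j with hD
  have hD0 : 0 < D := Finset.prod_pos fun j hj => he j (Finset.mem_range.1 hj)
  have hdvd : ∀ j < i, e j ∣ D := fun j hj => Finset.dvd_prod_of_mem e (Finset.mem_range.2 hj)
  have hpos : ∀ j < i, 0 < D / e j := fun j hj =>
    Nat.div_pos (Nat.le_of_dvd hD0 (hdvd j hj)) (he j hj)
  have hhom : ∀ j < i, (θ j ^ (D / e j)).IsHomogeneous D := fun j hj => by
    have := (hθ j hj).pow (D / e j)
    rwa [Nat.mul_div_cancel' (hdvd j hj)] at this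
  refine ⟨fun j => θ j ^ (D / e j), D, hD0, ⟨fun j hj => ⟨D, hD0, hhom j hj⟩, ?_⟩, hhom,
    fun j hj => ⟨_, hpos j hj, rfl⟩⟩
  intro P hP hle
  refine h.quotDim_add_le P hP (sup_le (le_sup_left.trans hle) (Ideal.span_le.2 ?_))
  rintro _ ⟨j, hj, rfl⟩
  exact hP.mem_of_pow_mem _ (hle (Ideal.mem_sup_right (Ideal.subset_span ⟨j, hj, rfl⟩)))

variable [Finite τ] [IsAlgClosed k]

theorem IsParameters.exists_update {Q : Ideal (MvPolynomial τ k)} [hQp : Q.IsPrime]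
    (hQ : Q.IsHomogeneous 𝓗) {i : ℕ} {θ : ℕ → MvPolynomial τ k} (h : IsParameters Q i θ)
    {J : Ideal (MvPolynomial τ k)} (hJ : J.IsHomogeneous 𝓗) (hJm : J ≤ idealOfVars τ k)
    (hJd : ∀ P : Ideal (MvPolynomial τ k), P.IsPrime → J ≤ P → P.quotDim + i < Q.quotDim) :
    ∃ g ∈ J, IsParameters Q (i + 1) (Function.update θ i g) := by
  classical
  set I := Q ⊔ Ideal.span (θ '' Set.Iio i) with hI
  have hIh : I.IsHomogeneous 𝓗 := isHomogeneous_sup_span hQ (by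
    rintro _ ⟨j, hj, rfl⟩
    obtain ⟨e, -, he⟩ := h.homogeneous j hj
    exact ⟨e, he⟩)
  have hfin := Ideal.finite_minimalPrimes_of_isNoetherianRing (MvPolynomial τ k) I
  have hmem : ∀ P, P ∈ hfin.toFinset ↔ P ∈ I.minimalPrimes := fun P => hfin.mem_toFinset
  obtain ⟨g, hgJ, hg, hgP⟩ := exists_isHomogeneous_avoid hfin.toFinset
    (fun P hP => ⟨((hmem P).1 hP).1.1, isHomogeneous_of_mem_minimalPrimes hIh ((hmem P).1 hP)⟩)
    (fun P hP P' hP' hle => le_antisymm hle (((hmem P').1 hP').2 ((hmem P).1 hP).1 hle))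
    J hJ hJm (fun P hP hJP => by
      have h1 := hJd P ((hmem P).1 hP).1.1 hJP
      have h2 := quotDim_le_add_card Q ((Finset.range i).image θ) P (by
        have := (hmem P).1 hP
        rwa [Finset.coe_image, Finset.coe_range])
      have h3 : ((Finset.range i).image θ).card ≤ i := by
        simpa using Finset.card_image_le (s := Finset.range i) (f := θ)
      omega)
  have hup : ∀ j < i, Function.update θ i g j = θ j := fun j hj =>
    Function.update_of_ne hj.ne _ _
  refine ⟨g, hgJ, fun j hj => ?_, fun P hP hle => ?_⟩
  · rcases Nat.lt_succ_iff_lt_or_eq.1 hj with hj | rfl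
    · rw [hup j hj]; exact h.homogeneous j hj
    · simpa using hg
  · have h1 : I ≤ P := by
      refine le_trans (sup_le_sup le_rfl (Ideal.span_mono ?_)) hle
      rintro _ ⟨j, hj, rfl⟩
      exact ⟨j, Nat.lt_succ_of_lt hj, hup j hj⟩
    have h2 : g ∈ P :=
      hle (Ideal.mem_sup_right (Ideal.subset_span ⟨i, Nat.lt_succ_self i, by simp⟩))
    obtain ⟨P', hP', hPP⟩ := Ideal.exists_minimalPrimes_le h1
    have := hP'.1.1
    have h3 : P' < P := lt_of_le_of_ne hPP fun h => hgP P' ((hmem P').2 hP') (h ▸ h2)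
    have h4 := Ideal.quotDim_succ_le_of_lt hP.ne_top h3
    have h5 := h.quotDim_add_le P' hP'.1.1 hP'.1.2
    omega

theorem isMaximal_idealOfVars : (idealOfVars τ k).IsMaximal := by
  rw [isMaximal_iff_eq_vanishingIdeal_singleton]
  refine ⟨0, ?_⟩
  ext f
  rw [← pow_one (idealOfVars τ k), mem_pow_idealOfVars_iff', mem_vanishingIdeal_iff]
  have h1 : aeval (0 : τ → k) f = coeff 0 f := by
    rw [aeval_zero, constantCoeff_eq]; rfl
  simp only [Nat.lt_one_iff, Finsupp.degree_eq_zero_iff, forall_eq, Set.mem_singleton_iff, h1]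

theorem quotDim_idealOfVars : (idealOfVars τ k).quotDim = 0 := by
  have hm := isMaximal_idealOfVars (k := k) (τ := τ)
  let _ := Ideal.Quotient.field (idealOfVars τ k)
  have h1 := Ideal.coe_quotDim _ hm.ne_top
  rw [ringKrullDim_eq_zero_of_field] at h1
  exact_mod_cast h1

theorem IsParameters.extend {Q : Ideal (MvPolynomial τ k)} [hQp : Q.IsPrime]
    (hQ : Q.IsHomogeneous 𝓗) {i : ℕ} {θ : ℕ → MvPolynomial τ k} (h : IsParameters Q i θ) (n : ℕ)
    (hn : i + n = Q.quotDim) :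
    ∃ θ' : ℕ → MvPolynomial τ k, IsParameters Q Q.quotDim θ' ∧ ∀ j < i, θ' j = θ j := by
  induction n generalizing i θ with
  | zero => exact ⟨θ, hn ▸ h, fun _ _ => rfl⟩
  | succ n ih =>
    obtain ⟨g, -, hg⟩ := h.exists_update hQ isHomogeneous_idealOfVars le_rfl (fun P hP hle => by
      have : P.quotDim ≤ 0 :=
        quotDim_idealOfVars (k := k) (τ := τ) ▸ Ideal.quotDim_anti hP.ne_top hle
      omega)
    obtain ⟨θ', h1, h2⟩ := ih hg (by omega)
    refine ⟨θ', h1, fun j hj => ?_⟩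
    rw [h2 j (by omega), Function.update_of_ne hj.ne]

theorem IsParameters.idealOfVars_le {Q : Ideal (MvPolynomial τ k)} [Q.IsPrime]
    (hQ : Q.IsHomogeneous 𝓗) {θ : ℕ → MvPolynomial τ k} (h : IsParameters Q Q.quotDim θ) :
    idealOfVars τ k ≤ (Q ⊔ Ideal.span (θ '' Set.Iio Q.quotDim)).radical := by
  have hIh : (Q ⊔ Ideal.span (θ '' Set.Iio Q.quotDim)).IsHomogeneous 𝓗 :=
    isHomogeneous_sup_span hQ (by
      rintro _ ⟨j, hj, rfl⟩
      obtain ⟨e, -, he⟩ := h.homogeneous j hj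
      exact ⟨e, he⟩)
  rw [← Ideal.sInf_minimalPrimes, le_sInf_iff]
  intro P hP
  have hPp := hP.1.1
  have h1 := h.quotDim_add_le P hP.1.1 hP.1.2
  by_contra h2
  have h3 : P < idealOfVars τ k := lt_of_le_not_ge
    (le_idealOfVars (isHomogeneous_of_mem_minimalPrimes hIh hP) hPp.ne_top) h2
  have := Ideal.quotDim_succ_le_of_lt isMaximal_idealOfVars.ne_top h3
  omega

end

section
variable {k : Type*} [Field k] {τ : Type*}

local notation "𝓗" => homogeneousSubmodule τ k

theorem exists_finset_homogeneous_generators [Finite τ] {Q : Ideal (MvPolynomial τ k)}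
    (hQ : Q.IsHomogeneous 𝓗) {d D : ℕ} (hD : 0 < D) {θ : Fin d → MvPolynomial τ k}
    (hθ : ∀ j, (θ j).IsHomogeneous D)
    (hm : idealOfVars τ k ≤ (Q ⊔ Ideal.span (Set.range θ)).radical) :
    ∃ G : Finset (τ →₀ ℕ), ∀ e u, u.IsHomogeneous e → ∃ p : (τ →₀ ℕ) → MvPolynomial (Fin d) k,
      (∀ s ∈ G, (p s).totalDegree * D ≤ e) ∧
      u - ∑ s ∈ G, aeval θ (p s) * monomial s 1 ∈ Q := by
  classical
  obtain ⟨n, hn⟩ := Ideal.exists_pow_le_of_le_radical_of_fg hm (idealOfVars_fg τ k)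
  have hfin : {s : τ →₀ ℕ | s.degree ≤ n}.Finite := Finsupp.finite_of_degree_le n
  refine ⟨hfin.toFinset, fun e => ?_⟩
  induction e using Nat.strong_induction_on with
  | _ e ih =>
  intro u hu
  rcases lt_or_ge e n with hen | hen
  · refine ⟨fun s => C (coeff s u), by simp, ?_⟩
    have : u = ∑ s ∈ hfin.toFinset, aeval θ (C (σ := Fin d) (coeff s u)) * monomial s 1 := by
      have h1 : ∑ s ∈ u.support, monomial s (coeff s u) =
          ∑ s ∈ hfin.toFinset, monomial s (coeff s u) := by
        refine Finset.sum_subset (fun s hs => ?_) fun s _ hs => ?_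
        · have := hu (mem_support_iff.1 hs)
          rw [hfin.mem_toFinset, Set.mem_ofPred_eq, Finsupp.degree_eq_weight_one]
          exact (this.trans_lt hen).le
        · rw [notMem_support_iff.1 hs, map_zero]
      rw [← u.as_sum] at h1
      refine h1.trans (Finset.sum_congr rfl fun s _ => ?_)
      rw [algHom_C, algebraMap_eq, C_mul_monomial, mul_one]
    rw [← this, sub_self]; exact zero_mem _
  · obtain ⟨q, hq, v, hv, hqv⟩ := Submodule.mem_sup.1
      (hn (mem_idealOfVars_of_isHomogeneous hu hen))
    obtain ⟨c, rfl⟩ := Ideal.mem_span_range_iff_exists_fun.1 hv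
    have hu' : u = DirectSum.decompose 𝓗 q e +
        ∑ j, (DirectSum.decompose 𝓗 (θ j * c j) e : MvPolynomial τ k) := by
      have := congrArg (GradedRing.proj 𝓗 e) hqv
      simp only [map_add, map_sum, GradedRing.proj_apply] at this
      rw [DirectSum.decompose_of_mem_same 𝓗 hu] at this
      simp only [mul_comm (θ _)]
      exact this.symm
    rcases lt_or_ge e D with heD | heD
    · refine ⟨0, by simp, ?_⟩
      have h1 : u = DirectSum.decompose 𝓗 q e := by
        rw [Finset.sum_eq_zero, add_zero] at hu'
        · exact hu'
        intro j _
        exact DirectSum.coe_decompose_mul_of_left_mem_of_not_le 𝓗 (hθ j) (by omega)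
      simp only [Pi.zero_apply, map_zero, zero_mul, Finset.sum_const_zero, sub_zero]
      rw [h1]; exact hQ e hq
    · have h1 : u = DirectSum.decompose 𝓗 q e +
          ∑ j, θ j * DirectSum.decompose 𝓗 (c j) (e - D) := by
        simp only [DirectSum.coe_decompose_mul_of_left_mem_of_le 𝓗 (hθ _) heD] at hu'
        exact hu'
      have h2 : ∀ j, _ := fun j => ih (e - D) (by omega)
        (DirectSum.decompose 𝓗 (c j) (e - D)) (DirectSum.decompose 𝓗 (c j) (e - D)).2
      choose p hp hpQ using h2
      refine ⟨fun s => ∑ j, X j * p j s, fun s hs => ?_, ?_⟩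
      · have h3 : (∑ j, X j * p j s).totalDegree ≤ 1 + (e - D) / D := by
          refine totalDegree_finsetSum_le fun j _ => (totalDegree_mul _ _).trans ?_
          rw [totalDegree_X]
          exact Nat.add_le_add_left ((Nat.le_div_iff_mul_le hD).2 (hp j s hs)) 1
        calc _ ≤ (1 + (e - D) / D) * D := Nat.mul_le_mul_right _ h3
          _ = D + (e - D) / D * D := by ring
          _ ≤ D + (e - D) := Nat.add_le_add_left (Nat.div_mul_le_self _ _) _
          _ = e := by omega
      · have h3 : u - ∑ s ∈ hfin.toFinset, aeval θ (∑ j, X j * p j s) * monomial s 1 =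
            DirectSum.decompose 𝓗 q e + ∑ j, θ j * (DirectSum.decompose 𝓗 (c j) (e - D) -
              ∑ s ∈ hfin.toFinset, aeval θ (p j s) * monomial s 1) := by
          conv_lhs => rw [h1]
          simp only [map_sum, map_mul, aeval_X, Finset.sum_mul, mul_sub, Finset.mul_sum,
            Finset.sum_sub_distrib]
          rw [Finset.sum_comm]
          simp only [mul_assoc, add_sub_assoc]
        rw [h3]
        exact add_mem (hQ e hq) (sum_mem fun j _ => Ideal.mul_mem_left _ _ (hpQ j))
end

theorem exists_retraction_of_span_eq_top {A B : Type*} [CommRing A] [IsDomain A] [CommRing B]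
    [IsDomain B] [Algebra A B] [FaithfulSMul A B] {G : Type*} [Finite G] (v : G → B)
    (hv : Submodule.span A (Set.range v) = ⊤) :
    ∃ (t : Set G) (φ : B →ₗ[A] t →₀ A) (ψ : (t →₀ A) →ₗ[A] B) (s : A), s ≠ 0 ∧
      ∀ u, ψ (φ u) = s • u := by
  classical
  have := Fintype.ofFinite G
  obtain ⟨t, ht, h⟩ := exists_maximal_linearIndepOn A v
  choose! a ha0 ha using h
  let b : G → A := fun g => if g ∈ t then 1 else a g
  have hb0 : ∀ g, b g ≠ 0 := fun g => by
    by_cases hg : g ∈ t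
    · simp [b, hg]
    · simp [b, hg, ha0 g hg]
  have hb : ∀ g, b g • v g ∈ Submodule.span A (v '' t) := fun g => by
    by_cases hg : g ∈ t
    · simpa [b, hg] using Submodule.subset_span (Set.mem_image_of_mem v hg)
    · simpa [b, hg] using ha g hg
  have hs : ∀ u, (∏ g, b g) • u ∈ Submodule.span A (Set.range fun i : t => v i) := fun u => by
    have hu : u ∈ Submodule.span A (Set.range v) := hv ▸ Submodule.mem_top
    rw [← Set.image_eq_range]
    induction hu using Submodule.span_induction with
    | mem x hx =>
      obtain ⟨g, rfl⟩ := hx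
      rw [← Finset.prod_erase_mul _ _ (Finset.mem_univ g), mul_smul]
      exact Submodule.smul_mem _ _ (hb g)
    | zero => rw [smul_zero]; exact zero_mem _
    | add x y _ _ hx hy => rw [smul_add]; exact add_mem hx hy
    | smul c x _ hx => rw [smul_comm]; exact Submodule.smul_mem _ _ hx
  have ht' : LinearIndependent A fun i : t => v i := ht
  refine ⟨t, ht'.repr ∘ₗ ((LinearMap.lsmul A B (∏ g, b g)).codRestrict _ hs),
    Finsupp.linearCombination A fun i : t => v i, ∏ g, b g,
    Finset.prod_ne_zero_iff.2 fun g _ => hb0 g, fun u => ?_⟩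
  exact ht'.linearCombination_repr _

section
variable {k : Type*} [Field k] {τ : Type*}

local notation "𝓗" => homogeneousSubmodule τ k

theorem exists_retraction_of_isParameters [Finite τ] [IsAlgClosed k]
    {Q : Ideal (MvPolynomial τ k)} [Q.IsPrime]
    (hQ : Q.IsHomogeneous 𝓗) {D : ℕ} (hD : 0 < D) {θ : ℕ → MvPolynomial τ k} {d : ℕ}
    (hd : Q.quotDim = d)
    (h : IsParameters Q d θ) (hθ : ∀ j < d, (θ j).IsHomogeneous D)
    {B : Type*} [CommRing B] [IsDomain B] [Algebra (MvPolynomial (Fin d) k) B]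
    (π : MvPolynomial τ k →+* B) (hπ : Function.Surjective π) (hker : RingHom.ker π = Q)
    (hF : ∀ p, algebraMap (MvPolynomial (Fin d) k) B p =
      π (aeval (fun j : Fin d => θ j) p)) :
    FaithfulSMul (MvPolynomial (Fin d) k) B ∧
      ∃ (t : Set (τ →₀ ℕ)) (φ : B →ₗ[MvPolynomial (Fin d) k] t →₀ MvPolynomial (Fin d) k)
        (ψ : (t →₀ MvPolynomial (Fin d) k) →ₗ[MvPolynomial (Fin d) k] B)
        (s : MvPolynomial (Fin d) k) (C : ℕ), s ≠ 0 ∧ (∀ u, ψ (φ u) = s • u) ∧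
        ∀ n u, u.IsHomogeneous (n * D) → ∀ i, (φ (π u) i).totalDegree ≤ n + C := by
  classical
  have hm := (hd ▸ h : IsParameters Q Q.quotDim θ).idealOfVars_le hQ
  rw [hd] at hm
  have hr : θ '' Set.Iio d = Set.range fun j : Fin d => θ j := by
    ext; simp [Fin.exists_iff]
  rw [hr] at hm
  obtain ⟨G, hG⟩ := exists_finset_homogeneous_generators hQ hD (fun j => hθ j j.2) hm
  let v : G → B := fun s => π (monomial s.1 1)
  have hG' : ∀ e u, u.IsHomogeneous e → ∃ p : (τ →₀ ℕ) → MvPolynomial (Fin d) k,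
      (∀ s ∈ G, (p s).totalDegree * D ≤ e) ∧
      π u = ∑ s : G, p s • v s := fun e u hu => by
    obtain ⟨p, hp, hp'⟩ := hG e u hu
    refine ⟨p, hp, ?_⟩
    rw [← hker, RingHom.sub_mem_ker_iff] at hp'
    rw [hp', map_sum, ← Finset.sum_coe_sort]
    simp only [Algebra.smul_def, hF, map_mul, v]
  have hv : Submodule.span (MvPolynomial (Fin d) k) (Set.range v) = ⊤ := by
    rw [eq_top_iff]
    rintro u -
    obtain ⟨u, rfl⟩ := hπ u
    rw [← DirectSum.sum_support_decompose 𝓗 u, map_sum]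
    refine sum_mem fun e _ => ?_
    obtain ⟨p, -, hp⟩ := hG' e (DirectSum.decompose 𝓗 u e) (DirectSum.decompose 𝓗 u e).2
    rw [hp]
    exact sum_mem fun s _ => Submodule.smul_mem _ _ (Submodule.subset_span ⟨s, rfl⟩)
  have hfin : Module.Finite (MvPolynomial (Fin d) k) B :=
    ⟨Submodule.fg_def.2 ⟨_, Set.finite_range v, hv⟩⟩
  have hint : (algebraMap (MvPolynomial (Fin d) k) B).IsIntegral :=
    algebraMap_isIntegral_iff.2 inferInstance
  have hinj : Function.Injective
      (algebraMap (MvPolynomial (Fin d) k) B) := by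
    rw [RingHom.injective_iff_ker_eq_bot]
    set K := RingHom.ker (algebraMap (MvPolynomial (Fin d) k) B)
    have hKp : K.IsPrime := RingHom.ker_isPrime _
    by_contra hK
    have h1 := Ideal.quotDim_succ_le_of_lt hKp.ne_top (bot_lt_iff_ne_bot.2 hK)
    have h2 : (⊥ : Ideal (MvPolynomial (Fin d) k)).quotDim = d := by
      have := Ideal.coe_quotDim (⊥ : Ideal (MvPolynomial (Fin d) k)) bot_ne_top
      rw [ringKrullDim_eq_of_ringEquiv (RingEquiv.quotientBot _),
        MvPolynomial.ringKrullDim_field, Nat.card_fin] at this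
      exact_mod_cast this
    have h3 : K.quotDim = d := by
      have e1 := Ideal.coe_quotDim K hKp.ne_top
      have e2 := Ideal.coe_quotDim Q (Ideal.IsPrime.ne_top inferInstance)
      let g := RingHom.kerLift (algebraMap (MvPolynomial (Fin d) k) B)
      let _ := g.toAlgebra
      have : FaithfulSMul (MvPolynomial (Fin d) k ⧸ K) B :=
        (faithfulSMul_iff_algebraMap_injective _ _).2 (RingHom.kerLift_injective _)
      have hgi : g.IsIntegral := RingHom.IsIntegral.tower_top (Ideal.Quotient.mk K) g hint
      have : Algebra.IsIntegral (MvPolynomial (Fin d) k ⧸ K) B :=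
        algebraMap_isIntegral_iff.1 hgi
      rw [ringKrullDim_eq_of_isIntegral _ B, ← ringKrullDim_eq_of_ringEquiv
        ((Ideal.quotEquivOfEq hker.symm).trans (RingHom.quotientKerEquivOfSurjective hπ)),
        ← e2, hd] at e1
      exact_mod_cast e1
    omega
  have hfaith : FaithfulSMul (MvPolynomial (Fin d) k) B :=
    (faithfulSMul_iff_algebraMap_injective _ _).2 hinj
  refine ⟨hfaith, ?_⟩
  obtain ⟨t, φ, ψ, s, hs, hψφ⟩ := exists_retraction_of_span_eq_top v hv
  let e : t ≃ (Subtype.val '' t : Set (τ →₀ ℕ)) := Equiv.Set.image _ t Subtype.val_injective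
  let E := Finsupp.domLCongr (M := MvPolynomial (Fin d) k)
    (R := MvPolynomial (Fin d) k) e
  obtain ⟨C, hC⟩ := (Set.finite_range fun g : G × t => (φ (v g.1) g.2).totalDegree).bddAbove
  refine ⟨_, E.toLinearMap ∘ₗ φ, ψ ∘ₗ E.symm.toLinearMap, s,
    C, hs, fun u => by
      simp [hψφ], fun n u hu i => ?_⟩
  obtain ⟨i, rfl⟩ := e.surjective i
  obtain ⟨p, hp, hpu⟩ := hG' _ _ hu
  have h1 : (E.toLinearMap ∘ₗ φ) (π u) (e i) = ∑ g : G, p g * φ (v g) i := by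
    simp [E, hpu]
  rw [h1]
  refine totalDegree_finsetSum_le fun g _ => (totalDegree_mul _ _).trans (Nat.add_le_add ?_ ?_)
  · exact Nat.le_of_mul_le_mul_right (hp g g.2) hD
  · exact hC ⟨(g, i), rfl⟩

end

section
universe u v
variable {k : Type u} [Field k] {τ : Type v}

local notation "𝓗" => homogeneousSubmodule τ k

theorem isHomogeneous_pow {I : Ideal (MvPolynomial τ k)} (hI : I.IsHomogeneous 𝓗) (n : ℕ) :
    (I ^ n).IsHomogeneous 𝓗 := by
  induction n with
  | zero => rw [pow_zero, Ideal.one_eq_top]; exact Ideal.IsHomogeneous.top _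
  | succ n ih => rw [pow_succ]; exact ih.mul hI

theorem exists_isHomogeneous_add {I J : Ideal (MvPolynomial τ k)} (hI : I.IsHomogeneous 𝓗)
    (hJ : J.IsHomogeneous 𝓗) {u : MvPolynomial τ k} {e : ℕ} (hu : u.IsHomogeneous e)
    (h : u ∈ I ⊔ J) : ∃ a ∈ I, ∃ b ∈ J, a.IsHomogeneous e ∧ u = a + b := by
  obtain ⟨a, ha, b, hb, hab⟩ := Submodule.mem_sup.1 h
  refine ⟨DirectSum.decompose 𝓗 a e, hI e ha, DirectSum.decompose 𝓗 b e, hJ e hb,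
    (DirectSum.decompose 𝓗 a e).2, ?_⟩
  have := congrArg (GradedRing.proj 𝓗 e) hab
  simp only [map_add, GradedRing.proj_apply] at this
  rw [DirectSum.decompose_of_mem_same 𝓗 hu] at this
  exact this.symm

theorem exists_quotient_algebra (Q : Ideal (MvPolynomial τ k)) [Q.IsPrime] {d : ℕ}
    (θ : Fin d → MvPolynomial τ k) :
    ∃ (B : Type (max u v)) (_ : CommRing B) (_ : IsDomain B) (_ : Algebra (MvPolynomial (Fin d) k) B)
      (π : MvPolynomial τ k →+* B), Function.Surjective π ∧ RingHom.ker π = Q ∧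
      ∀ p, algebraMap (MvPolynomial (Fin d) k) B p = π (aeval θ p) :=
  ⟨MvPolynomial τ k ⧸ Q, inferInstance, inferInstance,
    ((Ideal.Quotient.mk Q).comp (aeval θ : MvPolynomial (Fin d) k →ₐ[k] _).toRingHom).toAlgebra,
    Ideal.Quotient.mk Q, Ideal.Quotient.mk_surjective, Ideal.mk_ker, fun _ => rfl⟩

theorem exists_isPrime_quotDim_le_add_two [Finite τ] [IsAlgClosed k]
    {Q : Ideal (MvPolynomial τ k)} [hQp : Q.IsPrime]
    (hQ : Q.IsHomogeneous 𝓗) {f : MvPolynomial τ k} {e : ℕ} (he : 0 < e) (hf : f.IsHomogeneous e)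
    {I₁ I₂ : Ideal (MvPolynomial τ k)} (hI₁ : I₁.IsHomogeneous 𝓗) (hI₂ : I₂.IsHomogeneous 𝓗)
    (h : ∀ p : Ideal (MvPolynomial τ k), p.IsPrime →
      (Q ⊔ Ideal.span {f} ≤ p ↔ I₁ ≤ p ∨ I₂ ≤ p))
    (h₁ : ∃ p : Ideal (MvPolynomial τ k), p.IsPrime ∧ I₁ ≤ p ∧ ¬ I₂ ≤ p)
    (h₂ : ∃ p : Ideal (MvPolynomial τ k), p.IsPrime ∧ I₂ ≤ p ∧ ¬ I₁ ≤ p) :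
    ∃ P : Ideal (MvPolynomial τ k), P.IsPrime ∧ I₁ ⊔ I₂ ≤ P ∧ Q.quotDim ≤ P.quotDim + 2 := by
  by_contra! hcon
  obtain ⟨p₁', hp₁', hp₁I₁', hp₁I₂'⟩ := h₁
  obtain ⟨p₂', hp₂', hp₂I₂', hp₂I₁'⟩ := h₂
  have hp₁Q := (h p₁' hp₁').2 (Or.inl hp₁I₁')
  have hp₂Q := (h p₂' hp₂').2 (Or.inr hp₂I₂')
  have hfQ : f ∉ Q := fun hfQ => by
    rcases (h Q hQp).1 (sup_le le_rfl ((Ideal.span_singleton_le_iff_mem _).2 hfQ)) with h' | h'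
    · exact hp₂I₁' (h'.trans (le_sup_left.trans hp₂Q))
    · exact hp₁I₂' (h'.trans (le_sup_left.trans hp₁Q))
  have hJ : (I₁ ⊔ I₂).IsHomogeneous 𝓗 := hI₁.sup hI₂
  have hJm : I₁ ⊔ I₂ ≤ idealOfVars τ k := sup_le
    (le_idealOfVars hI₁ fun h' => hp₁'.ne_top (top_le_iff.1 (h' ▸ hp₁I₁')))
    (le_idealOfVars hI₂ fun h' => hp₂'.ne_top (top_le_iff.1 (h' ▸ hp₂I₂')))
  have hpar : IsParameters Q 1 fun _ => f := by
    refine ⟨fun _ _ => ⟨e, he, hf⟩, fun P hP hle => ?_⟩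
    refine Ideal.quotDim_succ_le_of_lt hP.ne_top (lt_of_le_of_ne (le_sup_left.trans hle) ?_)
    rintro rfl
    exact hfQ (hle (Ideal.mem_sup_right (Ideal.subset_span ⟨0, by simp, rfl⟩)))
  obtain ⟨g₁, hg₁, hpar₂⟩ := hpar.exists_update hQ hJ hJm
    (fun P hP hle => by have := hcon P hP hle; omega)
  obtain ⟨g₂, hg₂, hpar₃⟩ := hpar₂.exists_update hQ hJ hJm
    (fun P hP hle => by have := hcon P hP hle; omega)
  have hd3 : 3 ≤ Q.quotDim := by
    have := hcon (idealOfVars τ k) isMaximal_idealOfVars.isPrime hJm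
    omega
  obtain ⟨θ₁, hpar', hθ₁⟩ := hpar₃.extend hQ (Q.quotDim - 3) (by omega)
  obtain ⟨θ, D, hD, hparθ, hθD, hθ⟩ := hpar'.exists_same_degree
  have hθ₁0 : θ₁ 0 = f := by rw [hθ₁ 0 (by omega)]; simp [Function.update]
  have hθ₁1 : θ₁ 1 = g₁ := by rw [hθ₁ 1 (by omega)]; simp [Function.update]
  have hθ₁2 : θ₁ 2 = g₂ := by rw [hθ₁ 2 (by omega)]; simp [Function.update]
  obtain ⟨a₀, ha₀, hθ0⟩ := hθ 0 (by omega)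
  obtain ⟨a₁, ha₁, hθ1⟩ := hθ 1 (by omega)
  obtain ⟨a₂, ha₂, hθ2⟩ := hθ 2 (by omega)
  rw [hθ₁0] at hθ0
  rw [hθ₁1] at hθ1
  rw [hθ₁2] at hθ2
  have hθ1J : θ 1 ∈ I₁ ⊔ I₂ := hθ1 ▸ Ideal.pow_mem_of_mem _ hg₁ _ ha₁
  have hθ2J : θ 2 ∈ I₁ ⊔ I₂ := hθ2 ▸ Ideal.pow_mem_of_mem _ hg₂ _ ha₂
  have hθ1p : ∀ p ∈ (Q ⊔ Ideal.span {f}).minimalPrimes, θ 1 ∉ p := fun p hp hmem => by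
    have hpp := hp.1.1
    have h1 := quotDim_le_succ Q f p hp
    have h2 := hpar₂.quotDim_add_le p hpp (sup_le (le_sup_left.trans hp.1.2) (Ideal.span_le.2 (by
      rintro _ ⟨j, hj, rfl⟩
      have hj : j < 2 := hj
      interval_cases j
      · simpa [Function.update] using hp.1.2 (Ideal.mem_sup_right (Ideal.mem_span_singleton_self f))
      · simpa [Function.update] using hpp.mem_of_pow_mem _ (hθ1 ▸ hmem))))
    omega
  obtain ⟨p₁, hp₁, hp₁le⟩ := Ideal.exists_minimalPrimes_le hp₁Q
  obtain ⟨p₂, hp₂, hp₂le⟩ := Ideal.exists_minimalPrimes_le hp₂Q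
  have hp₁I : I₁ ≤ p₁ := ((h p₁ hp₁.1.1).1 hp₁.1.2).resolve_right fun h' =>
    hp₁I₂' (h'.trans hp₁le)
  have hp₂I : I₂ ≤ p₂ := ((h p₂ hp₂.1.1).1 hp₂.1.2).resolve_left fun h' =>
    hp₂I₁' (h'.trans hp₂le)
  have hrad : I₁ * I₂ ≤ (Q ⊔ Ideal.span {θ 0}).radical := by
    rw [Ideal.radical_eq_sInf, le_sInf_iff]
    rintro p ⟨hp, hpp⟩
    have hfp : f ∈ p := hpp.mem_of_pow_mem a₀
      (hθ0 ▸ hp (Ideal.mem_sup_right (Ideal.mem_span_singleton_self _)))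
    rcases (h p hpp).1 (sup_le (le_sup_left.trans hp)
      ((Ideal.span_singleton_le_iff_mem _).2 hfp)) with h' | h'
    · exact Ideal.mul_le_left.trans h'
    · exact Ideal.mul_le_right.trans h'
  obtain ⟨M, hM⟩ := Ideal.exists_pow_le_of_le_radical_of_fg hrad (IsNoetherian.noetherian _)
  obtain ⟨B, _, _, _, π, hπ, hker, hF⟩ := exists_quotient_algebra Q
    fun j : Fin Q.quotDim => θ j
  obtain ⟨hfaith, t, φ, ψ, s, C, hs, hψφ, hdeg⟩ :=
    exists_retraction_of_isParameters hQ hD rfl hparθ hθD π hπ hker hF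
  have hnoeth : IsNoetherianRing B := isNoetherianRing_of_surjective _ _ π hπ
  have hdvd : ∀ N, ∀ u ∈ (I₁ * I₂) ^ (N * (M + 1)), π (θ 0) ^ N ∣ π u := fun N u hu => by
    rw [mul_comm N, pow_mul] at hu
    have h1 := Ideal.mem_map_of_mem π
      (Ideal.pow_right_mono ((Ideal.pow_le_pow_right (Nat.le_succ M)).trans hM) N hu)
    rwa [Ideal.map_pow, Ideal.map_sup, (Ideal.map_eq_bot_iff_le_ker π).2 hker.ge, bot_sup_eq,
      Ideal.map_span, Set.image_singleton, Ideal.span_singleton_pow,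
      Ideal.mem_span_singleton] at h1
  have hsplit : ∀ j < Q.quotDim, θ j ∈ I₁ ⊔ I₂ → ∀ N, ∃ a ∈ I₁ ^ (N * (M + 1)),
      ∃ b ∈ I₂ ^ (N * (M + 1)), a.IsHomogeneous (2 * (N * (M + 1)) * D) ∧
        θ j ^ (2 * (N * (M + 1))) = a + b := fun j hj hjJ N => by
    refine exists_isHomogeneous_add (isHomogeneous_pow hI₁ _) (isHomogeneous_pow hI₂ _)
      (mul_comm D _ ▸ (hθD j hj).pow _) ?_
    refine Ideal.sup_pow_add_le_pow_sup_pow ?_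
    rw [← two_mul]
    exact Ideal.pow_mem_pow hjJ _
  choose a ha b hb hah hab using hsplit 1 (by omega) hθ1J
  choose a' ha' b' hb' hah' hab' using hsplit 2 (by omega) hθ2J
  have hmul : ∀ N N', N ≤ N' → ∀ u ∈ I₁ ^ (N * (M + 1)), ∀ v ∈ I₂ ^ (N' * (M + 1)),
      π (θ 0) ^ N ∣ π u * π v := fun N N' hN u hu v hv => by
    rw [← map_mul]
    refine hdvd N _ ?_
    rw [mul_pow]
    exact Ideal.mul_mem_mul hu (Ideal.pow_le_pow_right (Nat.mul_le_mul_right _ hN) hv)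
  have hmul' : ∀ N N', N ≤ N' → ∀ u ∈ I₁ ^ (N' * (M + 1)), ∀ v ∈ I₂ ^ (N * (M + 1)),
      π (θ 0) ^ N ∣ π v * π u := fun N N' hN u hu v hv => by
    rw [← map_mul]
    refine hdvd N _ ?_
    rw [mul_pow, mul_comm v]
    exact Ideal.mul_mem_mul (Ideal.pow_le_pow_right (Nat.mul_le_mul_right _ hN) hu) hv
  have hker₁ : RingHom.ker π ≤ p₁ := hker.le.trans (le_sup_left.trans hp₁.1.2)
  have hker₂ : RingHom.ker π ≤ p₂ := hker.le.trans (le_sup_left.trans hp₂.1.2)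
  have hp₁p := hp₁.1.1
  have hp₂p := hp₂.1.1
  have hp₁m := Ideal.map_isPrime_of_surjective hπ hker₁
  have hp₂m := Ideal.map_isPrime_of_surjective hπ hker₂
  have hmem : ∀ p : Ideal (MvPolynomial τ k), RingHom.ker π ≤ p → ∀ u, π u ∈ p.map π → u ∈ p :=
    fun p hp u hu => by
      rw [← Ideal.mem_comap, Ideal.comap_map_of_surjective' π hπ, sup_eq_left.2 hp] at hu
      exact hu
  have hf0 : ∀ p ∈ (Q ⊔ Ideal.span {f}).minimalPrimes, θ 0 ∈ p := fun p hp => by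
    rw [hθ0]
    exact Ideal.pow_mem_of_mem _
      (hp.1.2 (Ideal.mem_sup_right (Ideal.mem_span_singleton_self f))) _ ha₀
  have hX : ∀ j : Fin Q.quotDim, algebraMap (MvPolynomial (Fin Q.quotDim) k) B (X j) =
    π (θ j) := fun j => by rw [hF, aeval_X]
  have hpow : ∀ (I : Ideal (MvPolynomial τ k)) N, 0 < N → I ^ (N * (M + 1)) ≤ I :=
    fun I N hN => Ideal.pow_le_self (Nat.mul_pos hN M.succ_pos).ne'
  refine false_of_algebraMap_retraction φ ψ hs hψφ
    (i := (⟨0, by omega⟩ : Fin Q.quotDim)) (j := ⟨1, by omega⟩) (l := ⟨2, by omega⟩)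
    (by simp) (by simp) (by simp) (hX _) (hX _) (hX _) (p₁.map π) (p₂.map π)
    (Ideal.mem_map_of_mem _ (hf0 p₁ hp₁)) (Ideal.mem_map_of_mem _ (hf0 p₂ hp₂))
    (fun h' => hθ1p p₁ hp₁ (hmem p₁ hker₁ _ h')) (fun h' => hθ1p p₂ hp₂ (hmem p₂ hker₂ _ h'))
    C (fun N => 2 * (N * (M + 1))) (fun N => π (a N)) (fun N => π (b N)) (fun N => π (a' N))
    (fun N => π (b' N)) (fun N => by rw [← map_pow, hab, map_add])
    (fun N => by rw [← map_pow, hab', map_add])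
    (fun N N' hN => hmul N N' hN _ (ha N) _ (hb N'))
    (fun N N' hN => hmul' N N' hN _ (ha N') _ (hb N))
    (fun N => hmul' N N le_rfl _ (ha N) _ (hb' N))
    (fun N => hmul' N N le_rfl _ (ha' N) _ (hb N))
    (fun N hN => Ideal.mem_map_of_mem _ (hp₁I (hpow I₁ N hN (ha N))))
    (fun N hN => Ideal.mem_map_of_mem _ (hp₂I (hpow I₂ N hN (hb N))))
    (fun N i => hdeg _ _ (hah N) i)

end

theorem Ideal.IsPrime.sInf_le_iff {R : Type*} [CommRing R] {p : Ideal R} (hp : p.IsPrime)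
    {S : Set (Ideal R)} (hS : S.Finite) : sInf S ≤ p ↔ ∃ q ∈ S, q ≤ p := by
  have := hp.inf_le' (s := hS.toFinset) (f := id)
  simpa [Finset.inf_id_eq_sInf] using this

section
universe u v
variable {k : Type u} [Field k] {τ : Type v}

local notation "𝓗" => homogeneousSubmodule τ k

theorem isHomogeneous_sInf {S : Set (Ideal (MvPolynomial τ k))}
    (hS : ∀ I ∈ S, I.IsHomogeneous 𝓗) : (sInf S).IsHomogeneous 𝓗 := by
  intro i u hu
  rw [Ideal.mem_sInf] at hu ⊢
  exact fun {I} hI => hS I hI i (hu hI)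

theorem exists_isPrime_quotDim_le_add_card [Finite τ] [IsAlgClosed k]
    {Q : Ideal (MvPolynomial τ k)} [hQp : Q.IsPrime]
    (hQ : Q.IsHomogeneous 𝓗) (s : Finset (MvPolynomial τ k))
    (hs : ∀ f ∈ s, ∃ e, 0 < e ∧ f.IsHomogeneous e)
    {I₁ I₂ : Ideal (MvPolynomial τ k)} (hI₁ : I₁.IsHomogeneous 𝓗) (hI₂ : I₂.IsHomogeneous 𝓗)
    (h : ∀ p : Ideal (MvPolynomial τ k), p.IsPrime →
      (Q ⊔ Ideal.span s ≤ p ↔ I₁ ≤ p ∨ I₂ ≤ p))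
    (h₁ : ∃ p : Ideal (MvPolynomial τ k), p.IsPrime ∧ I₁ ≤ p ∧ ¬ I₂ ≤ p)
    (h₂ : ∃ p : Ideal (MvPolynomial τ k), p.IsPrime ∧ I₂ ≤ p ∧ ¬ I₁ ≤ p) :
    ∃ P : Ideal (MvPolynomial τ k), P.IsPrime ∧ I₁ ⊔ I₂ ≤ P ∧
      Q.quotDim ≤ P.quotDim + s.card + 1 := by
  classical
  induction s using Finset.induction_on generalizing I₁ I₂ with
  | empty =>
    obtain ⟨p₁, hp₁, hp₁I₁, hp₁I₂⟩ := h₁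
    obtain ⟨p₂, hp₂, hp₂I₂, hp₂I₁⟩ := h₂
    rcases (h Q hQp).1 (by simp) with h' | h'
    · exact absurd (h'.trans (le_sup_left.trans ((h p₂ hp₂).2 (Or.inr hp₂I₂)))) hp₂I₁
    · exact absurd (h'.trans (le_sup_left.trans ((h p₁ hp₁).2 (Or.inl hp₁I₁)))) hp₁I₂
  | insert f s hfs ih =>
    rw [Finset.card_insert_of_notMem hfs]
    obtain ⟨e, he, hfe⟩ := hs f (Finset.mem_insert_self f s)
    have hs' : ∀ g ∈ s, ∃ e, 0 < e ∧ g.IsHomogeneous e := fun g hg =>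
      hs g (Finset.mem_insert_of_mem hg)
    have hQs : (Q ⊔ Ideal.span (s : Set (MvPolynomial τ k))).IsHomogeneous 𝓗 :=
      isHomogeneous_sup_span hQ fun g hg => (hs' g hg).imp fun _ => And.right
    have hfin := Ideal.finite_minimalPrimes_of_isNoetherianRing _
      (Q ⊔ Ideal.span (s : Set (MvPolynomial τ k)))
    have hins : ∀ p : Ideal (MvPolynomial τ k), Q ⊔ Ideal.span (insert f s : Finset _) ≤ p ↔
        Q ⊔ Ideal.span (s : Set (MvPolynomial τ k)) ≤ p ∧ f ∈ p := fun p => by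
      rw [Finset.coe_insert, Ideal.span_insert, sup_le_iff, sup_le_iff, sup_le_iff,
        Ideal.span_singleton_le_iff_mem]
      tauto
    have hexists : ∀ p : Ideal (MvPolynomial τ k), p.IsPrime →
        Q ⊔ Ideal.span (s : Set (MvPolynomial τ k)) ≤ p →
        ∃ q ∈ (Q ⊔ Ideal.span (s : Set (MvPolynomial τ k))).minimalPrimes, q ≤ p :=
      fun p hp hle => Ideal.exists_minimalPrimes_le hle
    have hle : ∀ q ∈ (Q ⊔ Ideal.span (s : Set (MvPolynomial τ k))).minimalPrimes,
        ∀ p : Ideal (MvPolynomial τ k), p.IsPrime → q ≤ p → f ∈ p → I₁ ≤ p ∨ I₂ ≤ p :=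
      fun q hq p hp hqp hf => (h p hp).1 ((hins p).2 ⟨hq.1.2.trans hqp, hf⟩)
    by_cases hsplit : ∃ q ∈ (Q ⊔ Ideal.span (s : Set (MvPolynomial τ k))).minimalPrimes,
        (∃ p : Ideal (MvPolynomial τ k), p.IsPrime ∧ q ≤ p ∧ I₁ ≤ p ∧ ¬ I₂ ≤ p) ∧
        ∃ p : Ideal (MvPolynomial τ k), p.IsPrime ∧ q ≤ p ∧ I₂ ≤ p ∧ ¬ I₁ ≤ p
    · obtain ⟨q, hq, ⟨p₁, hp₁, hqp₁, hp₁I₁, hp₁I₂⟩, p₂, hp₂, hqp₂, hp₂I₂, hp₂I₁⟩ := hsplit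
      have hqp := hq.1.1
      have hqh := isHomogeneous_of_mem_minimalPrimes hQs hq
      obtain ⟨P, hP, hPI, hPd⟩ := exists_isPrime_quotDim_le_add_two hqh he hfe
        (I₁ := I₁ ⊔ q) (I₂ := I₂ ⊔ q) (hI₁.sup hqh) (hI₂.sup hqh) (fun p hp => by
          rw [sup_le_iff, sup_le_iff, sup_le_iff, Ideal.span_singleton_le_iff_mem]
          refine ⟨fun hqf => ?_, fun hI => ?_⟩
          · exact (hle q hq p hp hqf.1 hqf.2).imp (⟨·, hqf.1⟩) (⟨·, hqf.1⟩)
          · refine ⟨hI.elim And.right And.right, ?_⟩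
            exact ((hins p).1 ((h p hp).2 (hI.imp And.left And.left))).2)
        ⟨p₁, hp₁, sup_le hp₁I₁ hqp₁, fun h' => hp₁I₂ (le_sup_left.trans h')⟩
        ⟨p₂, hp₂, sup_le hp₂I₂ hqp₂, fun h' => hp₂I₁ (le_sup_left.trans h')⟩
      have := quotDim_le_add_card Q s q hq
      exact ⟨P, hP, (sup_le_sup le_sup_left le_sup_left).trans hPI, by omega⟩
    · set 𝒬 := (Q ⊔ Ideal.span (s : Set (MvPolynomial τ k))).minimalPrimes with h𝒬
      set G₁ := {q ∈ 𝒬 | ∀ p : Ideal (MvPolynomial τ k), p.IsPrime → q ≤ p → f ∈ p → I₁ ≤ p}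
        with hG₁
      have hG₁𝒬 : G₁ ⊆ 𝒬 := fun q hq => hq.1
      have hG₂ : ∀ q ∈ 𝒬 \ G₁, ∀ p : Ideal (MvPolynomial τ k), p.IsPrime → q ≤ p → f ∈ p →
          I₂ ≤ p := by
        rintro q ⟨hq, hqG⟩ p hp hqp hf
        by_contra hcon
        have hp₁ := (hle q hq p hp hqp hf).resolve_right hcon
        have : ∃ p' : Ideal (MvPolynomial τ k), p'.IsPrime ∧ q ≤ p' ∧ f ∈ p' ∧ ¬ I₁ ≤ p' := by
          by_contra! h'
          exact hqG ⟨hq, h'⟩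
        obtain ⟨p', hp', hqp', hfp', hp'I⟩ := this
        exact hsplit ⟨q, hq, ⟨p, hp, hqp, hp₁, hcon⟩, p', hp', hqp',
          (hle q hq p' hp' hqp' hfp').resolve_left hp'I, hp'I⟩
      have hhom : ∀ G ⊆ 𝒬, (sInf G).IsHomogeneous 𝓗 := fun G hG =>
        isHomogeneous_sInf fun q hq => isHomogeneous_of_mem_minimalPrimes hQs (hG hq)
      have hf1 : G₁.Finite := hfin.subset hG₁𝒬
      have hf2 : (𝒬 \ G₁).Finite := hfin.subset Set.sdiff_subset
      have hmin : ∀ q ∈ 𝒬, ∀ q' ∈ 𝒬, q' ≤ q → q' = q := fun q hq q' hq' hle' =>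
        le_antisymm hle' (hq.2 hq'.1 hle')
      obtain ⟨P', hP', hPU, hPd⟩ := ih hs' (hhom G₁ hG₁𝒬) (hhom (𝒬 \ G₁) Set.sdiff_subset)
        (fun p hp => by
          rw [hp.sInf_le_iff hf1, hp.sInf_le_iff hf2]
          refine ⟨fun hp' => ?_, ?_⟩
          · obtain ⟨q, hq, hqp⟩ := hexists p hp hp'
            by_cases hqG : q ∈ G₁
            · exact Or.inl ⟨q, hqG, hqp⟩
            · exact Or.inr ⟨q, ⟨hq, hqG⟩, hqp⟩
          · rintro (⟨q, hq, hqp⟩ | ⟨q, hq, hqp⟩) <;> exact hq.1.1.2.trans hqp)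
        (by
          obtain ⟨p, hp, hpI₁, hpI₂⟩ := h₁
          obtain ⟨hp', hfp⟩ := (hins p).1 ((h p hp).2 (Or.inl hpI₁))
          obtain ⟨q, hq, hqp⟩ := hexists p hp hp'
          have hqG : q ∈ G₁ := by
            by_contra hqG
            exact hpI₂ (hG₂ q ⟨hq, hqG⟩ p hp hqp hfp)
          refine ⟨q, hq.1.1, sInf_le hqG, fun hle' => ?_⟩
          obtain ⟨q', hq', hq'q⟩ := (hq.1.1.sInf_le_iff hf2).1 hle'
          exact hq'.2 (hmin q hq q' hq'.1 hq'q ▸ hqG))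
        (by
          obtain ⟨p, hp, hpI₂, hpI₁⟩ := h₂
          obtain ⟨hp', hfp⟩ := (hins p).1 ((h p hp).2 (Or.inr hpI₂))
          obtain ⟨q, hq, hqp⟩ := hexists p hp hp'
          have hqG : q ∉ G₁ := fun hqG => hpI₁ (hqG.2 p hp hqp hfp)
          refine ⟨q, hq.1.1, sInf_le ⟨hq, hqG⟩, fun hle' => ?_⟩
          obtain ⟨q', hq', hq'q⟩ := (hq.1.1.sInf_le_iff hf1).1 hle'
          exact hqG (hmin q hq q' hq'.1 hq'q ▸ hq'))
      obtain ⟨P₀, hP₀, hP₀P'⟩ := Ideal.exists_minimalPrimes_le hPU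
      have hP₀p := hP₀.1.1
      have hP₀h := isHomogeneous_of_mem_minimalPrimes
        ((hhom G₁ hG₁𝒬).sup (hhom (𝒬 \ G₁) Set.sdiff_subset)) hP₀
      have hd := Ideal.quotDim_anti hP'.ne_top hP₀P'
      have hm : P₀ ⊔ Ideal.span {f} ≤ idealOfVars τ k := by
        refine sup_le (le_idealOfVars hP₀h hP₀p.ne_top) ?_
        rw [Ideal.span_singleton_le_iff_mem]
        simpa using mem_idealOfVars_of_isHomogeneous hfe (n := 1) he
      have hmp : (idealOfVars τ k).IsPrime := isMaximal_idealOfVars.isPrime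
      obtain ⟨P, hP, -⟩ := Ideal.exists_minimalPrimes_le hm
      have hPp := hP.1.1
      have hPP₀ : P₀ ≤ P := le_sup_left.trans hP.1.2
      have hfP : f ∈ P := hP.1.2 (Ideal.mem_sup_right (Ideal.mem_span_singleton_self f))
      have := quotDim_le_succ P₀ f P hP
      refine ⟨P, hPp, sup_le ?_ ?_, by omega⟩
      · obtain ⟨q, hq, hqP⟩ := (hPp.sInf_le_iff hf1).1 (le_sup_left.trans (hP₀.1.2.trans hPP₀))
        exact hq.2 P hPp hqP hfP
      · obtain ⟨q, hq, hqP⟩ := (hPp.sInf_le_iff hf2).1 (le_sup_right.trans (hP₀.1.2.trans hPP₀))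
        exact hG₂ q hq P hPp hqP hfP

end

section
universe u v
variable {k : Type u} [Field k]

theorem isHomogeneous_map_rename {σ τ : Type*} (w : σ → τ) {I : Ideal (MvPolynomial σ k)}
    (hI : I.IsHomogeneous (homogeneousSubmodule σ k)) :
    (I.map (rename (R := k) w)).IsHomogeneous (homogeneousSubmodule τ k) := by
  classical
  have h : I.map (rename (R := k) w) =
      Ideal.span (rename w '' {f | f ∈ I ∧ ∃ e, f.IsHomogeneous e}) := by
    apply le_antisymm
    · rw [Ideal.map_le_iff_le_comap]
      intro u hu
      rw [Ideal.mem_comap, ← DirectSum.sum_support_decompose (homogeneousSubmodule σ k) u, map_sum]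
      exact sum_mem fun i _ => Ideal.subset_span
        ⟨_, ⟨hI i hu, i, (DirectSum.decompose (homogeneousSubmodule σ k) u i).2⟩, rfl⟩
    · rw [Ideal.span_le]
      rintro _ ⟨f, hf, rfl⟩
      exact Ideal.mem_map_of_mem _ hf.1
  rw [h]
  refine Ideal.homogeneous_span _ _ ?_
  rintro _ ⟨f, ⟨-, e, he⟩, rfl⟩
  exact ⟨e, he.rename_isHomogeneous⟩

theorem quotDim_le_card {τ β : Type*} [Finite τ] [Finite β] {P : Ideal (MvPolynomial τ k)}
    (hP : P ≠ ⊤) (w : β → τ) (h : ∀ t, X t ∈ P ∨ ∃ j, X t - X (w j) ∈ P) :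
    P.quotDim ≤ Nat.card β := by
  let g : MvPolynomial β k →ₐ[k] MvPolynomial τ k ⧸ P :=
    (Ideal.Quotient.mkₐ k P).comp (rename w)
  have hg : Function.Surjective g := by
    rw [← AlgHom.range_eq_top, eq_top_iff]
    have h1 : (⊤ : Subalgebra k (MvPolynomial τ k ⧸ P)) =
        (⊤ : Subalgebra k (MvPolynomial τ k)).map (Ideal.Quotient.mkₐ k P) := by
      rw [Algebra.map_top]
      exact ((AlgHom.range_eq_top _).2 (Ideal.Quotient.mkₐ_surjective k P)).symm
    rw [h1, ← MvPolynomial.adjoin_range_X, AlgHom.map_adjoin, Algebra.adjoin_le_iff]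
    rintro _ ⟨_, ⟨t, rfl⟩, rfl⟩
    rcases h t with h | ⟨j, h⟩
    · have : Ideal.Quotient.mkₐ k P (X t) = 0 := Ideal.Quotient.eq_zero_iff_mem.2 h
      rw [this]; exact zero_mem _
    · refine ⟨X j, ?_⟩
      have : Ideal.Quotient.mk P (X t) = Ideal.Quotient.mk P (X (w j)) := Ideal.Quotient.eq.2 h
      simpa [g] using this.symm
  have h2 := ringKrullDim_le_of_surjective g.toRingHom hg
  rw [← Ideal.coe_quotDim _ hP, ringKrullDim_field] at h2
  exact_mod_cast h2

variable {σ : Type v}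

/-- The equations of the diagonal in the product of two copies of affine space. -/
def diagonalEquations (k : Type u) [Field k] (σ : Type v) [Fintype σ] :
    Finset (MvPolynomial (σ ⊕ σ) k) :=
  by classical exact Finset.univ.image fun l => X (Sum.inl l) - X (Sum.inr l)

theorem mem_diagonalEquations [Fintype σ] (l : σ) :
    X (Sum.inl l) - X (Sum.inr l) ∈ diagonalEquations k σ := by
  classical
  exact Finset.mem_image_of_mem _ (Finset.mem_univ l)

theorem card_diagonalEquations_le [Fintype σ] :
    (diagonalEquations k σ).card ≤ Fintype.card σ := by
  classical
  exact Finset.card_image_le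

theorem isHomogeneous_of_mem_diagonalEquations [Fintype σ] {f : MvPolynomial (σ ⊕ σ) k}
    (hf : f ∈ diagonalEquations k σ) : f.IsHomogeneous 1 := by
  classical
  obtain ⟨l, -, rfl⟩ := Finset.mem_image.1 hf
  exact (isHomogeneous_X _ _).sub (isHomogeneous_X _ _)

theorem comap_inr_eq_comap_inl [Fintype σ] {p : Ideal (MvPolynomial (σ ⊕ σ) k)}
    (hp : Ideal.span (diagonalEquations k σ : Set (MvPolynomial (σ ⊕ σ) k)) ≤ p) :
    p.comap (rename (R := k) Sum.inr) = p.comap (rename (R := k) Sum.inl) := by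
  classical
  have h : (Ideal.Quotient.mkₐ k p).comp (rename Sum.inr) =
      (Ideal.Quotient.mkₐ k p).comp (rename Sum.inl) := by
    ext l
    simp only [AlgHom.comp_apply, rename_X, Ideal.Quotient.mkₐ_eq_mk]
    refine (Ideal.Quotient.eq.2 (hp (Ideal.subset_span (mem_diagonalEquations l)))).symm
  ext u
  have hu := DFunLike.congr_fun h u
  simp only [AlgHom.comp_apply, Ideal.Quotient.mkₐ_eq_mk] at hu
  rw [Ideal.mem_comap, Ideal.mem_comap, ← Ideal.Quotient.eq_zero_iff_mem, hu,
    Ideal.Quotient.eq_zero_iff_mem]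

theorem span_diagonalEquations_le_comap [Fintype σ] (p : Ideal (MvPolynomial σ k)) :
    Ideal.span (diagonalEquations k σ : Set (MvPolynomial (σ ⊕ σ) k)) ≤
      p.comap (rename (R := k) (Sum.elim id id)) := by
  classical
  rw [Ideal.span_le]
  intro f hf
  obtain ⟨l, -, rfl⟩ := Finset.mem_image.1 (Finset.mem_coe.1 hf)
  simp

theorem comap_inl_comap_elim (p : Ideal (MvPolynomial σ k)) :
    (p.comap (rename (R := k) (Sum.elim id id))).comap (rename (R := k) (Sum.inl : σ → σ ⊕ σ)) =
      p := by
  ext u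
  simp [Ideal.mem_comap, rename_rename]

theorem external_sup_span_diagonalEquations_le_iff [Fintype σ] {P P' : Ideal (MvPolynomial σ k)}
    {p : Ideal (MvPolynomial (σ ⊕ σ) k)} :
    P.external P' ⊔ Ideal.span (diagonalEquations k σ : Set (MvPolynomial (σ ⊕ σ) k)) ≤ p ↔
      Ideal.span (diagonalEquations k σ : Set (MvPolynomial (σ ⊕ σ) k)) ≤ p ∧
        P ⊔ P' ≤ p.comap (rename (R := k) Sum.inl) := by
  rw [sup_le_iff, Ideal.external, sup_le_iff, and_comm, and_congr_right_iff]
  intro h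
  rw [Ideal.map_le_iff_le_comap, Ideal.map_le_iff_le_comap, comap_inr_eq_comap_inl h, sup_le_iff]

theorem isHomogeneous_external {P P' : Ideal (MvPolynomial σ k)}
    (hP : P.IsHomogeneous (homogeneousSubmodule σ k))
    (hP' : P'.IsHomogeneous (homogeneousSubmodule σ k)) :
    (P.external P').IsHomogeneous (homogeneousSubmodule (σ ⊕ σ) k) :=
  (isHomogeneous_map_rename _ hP).sup (isHomogeneous_map_rename _ hP')

variable {α β : Type v} [Fintype α] [Fintype β]

theorem not_mem_of_card_lt_quotDim {P : Ideal (MvPolynomial ((α ⊕ β) ⊕ (α ⊕ β)) k)} (hP : P ≠ ⊤)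
    (hdiag : Ideal.span (diagonalEquations k (α ⊕ β) :
      Set (MvPolynomial ((α ⊕ β) ⊕ (α ⊕ β)) k)) ≤ P)
    (h : Fintype.card β ≤ Fintype.card α) (hPd : Fintype.card α < P.quotDim) :
    (¬ ∀ i : α, X (Sum.inl i) ∈ P.comap (rename (R := k) Sum.inl)) ∧
      ¬ ∀ j : β, X (Sum.inr j) ∈ P.comap (rename (R := k) Sum.inl) := by
  classical
  have hd : ∀ l, (X (Sum.inl l) - X (Sum.inr l) : MvPolynomial ((α ⊕ β) ⊕ (α ⊕ β)) k) ∈ P :=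
    fun l => hdiag (Ideal.subset_span (mem_diagonalEquations l))
  have hd' : ∀ l, (X (Sum.inr l) - X (Sum.inl l) : MvPolynomial ((α ⊕ β) ⊕ (α ⊕ β)) k) ∈ P :=
    fun l => by rw [← neg_sub]; exact neg_mem (hd l)
  constructor <;> intro hall <;> simp only [Ideal.mem_comap, rename_X] at hall
  · have := quotDim_le_card hP (fun j : β => Sum.inl (Sum.inr j)) (by
      rintro ((i | j) | (i | j))
      · exact Or.inl (hall i)
      · exact Or.inr ⟨j, by simp⟩
      · refine Or.inl ?_
        have := sub_mem (hall i) (hd (Sum.inl i))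
        simpa using this
      · exact Or.inr ⟨j, hd' _⟩)
    rw [Nat.card_eq_fintype_card] at this
    omega
  · have := quotDim_le_card hP (fun j : α => Sum.inl (Sum.inl j)) (by
      rintro ((i | j) | (i | j))
      · exact Or.inr ⟨i, by simp⟩
      · exact Or.inl (hall j)
      · exact Or.inr ⟨i, hd' _⟩
      · refine Or.inl ?_
        have := sub_mem (hall j) (hd (Sum.inr j))
        simpa using this)
    rw [Nat.card_eq_fintype_card] at this
    omega

variable [IsAlgClosed k]

theorem exists_isPrime_of_card_le {P P' : Ideal (MvPolynomial (α ⊕ β) k)} [P.IsPrime] [P'.IsPrime]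
    (hP : P.IsHomogeneous (homogeneousSubmodule (α ⊕ β) k))
    (hP' : P'.IsHomogeneous (homogeneousSubmodule (α ⊕ β) k))
    (h : Fintype.card β ≤ Fintype.card α)
    (hd : 2 * Fintype.card α + Fintype.card β + 2 ≤ P.quotDim + P'.quotDim) :
    ∃ p : Ideal (MvPolynomial (α ⊕ β) k), p.IsPrime ∧ P ⊔ P' ≤ p ∧
      (¬ ∀ i : α, X (Sum.inl i) ∈ p) ∧ ¬ ∀ j : β, X (Sum.inr j) ∈ p := by
  have hm : P.external P' ⊔ Ideal.span (diagonalEquations k (α ⊕ β) :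
      Set (MvPolynomial ((α ⊕ β) ⊕ (α ⊕ β)) k)) ≤ idealOfVars _ k := by
    refine sup_le (le_idealOfVars (isHomogeneous_external hP hP')
      (Ideal.IsPrime.ne_top inferInstance)) (Ideal.span_le.2 fun f hf => ?_)
    simpa using mem_idealOfVars_of_isHomogeneous (isHomogeneous_of_mem_diagonalEquations hf)
      (n := 1) le_rfl
  have hmp : (idealOfVars ((α ⊕ β) ⊕ (α ⊕ β)) k).IsPrime := isMaximal_idealOfVars.isPrime
  obtain ⟨p, hp, -⟩ := Ideal.exists_minimalPrimes_le hm
  have hpp := hp.1.1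
  have h1 := quotDim_le_add_card _ _ p hp
  have h2 := quotDim_external_le P P'
  have h3 := card_diagonalEquations_le (k := k) (σ := α ⊕ β)
  rw [Fintype.card_sum] at h3
  obtain ⟨hp1, hp2⟩ := external_sup_span_diagonalEquations_le_iff.1 hp.1.2
  exact ⟨_, Ideal.comap_isPrime _ p, hp2, not_mem_of_card_lt_quotDim hpp.ne_top hp1 h (by omega)⟩

theorem exists_isPrime_sup_le_of_card_le {P P' : Ideal (MvPolynomial (α ⊕ β) k)}
    [hPp : P.IsPrime] [hPp' : P'.IsPrime]
    (hP : P.IsHomogeneous (homogeneousSubmodule (α ⊕ β) k))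
    (hP' : P'.IsHomogeneous (homogeneousSubmodule (α ⊕ β) k))
    (h : Fintype.card β ≤ Fintype.card α)
    (hd : 2 * Fintype.card α + Fintype.card β + 2 ≤ P.quotDim + P'.quotDim)
    {I₁ I₂ : Ideal (MvPolynomial (α ⊕ β) k)}
    (hI₁ : I₁.IsHomogeneous (homogeneousSubmodule (α ⊕ β) k))
    (hI₂ : I₂.IsHomogeneous (homogeneousSubmodule (α ⊕ β) k))
    (hI : ∀ p : Ideal (MvPolynomial (α ⊕ β) k), p.IsPrime → (¬ ∀ i : α, X (Sum.inl i) ∈ p) →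
      (¬ ∀ j : β, X (Sum.inr j) ∈ p) → (P ⊔ P' ≤ p ↔ I₁ ≤ p ∨ I₂ ≤ p))
    (h₁ : ∃ p : Ideal (MvPolynomial (α ⊕ β) k), p.IsPrime ∧ (¬ ∀ i : α, X (Sum.inl i) ∈ p) ∧
      (¬ ∀ j : β, X (Sum.inr j) ∈ p) ∧ I₁ ≤ p)
    (h₂ : ∃ p : Ideal (MvPolynomial (α ⊕ β) k), p.IsPrime ∧ (¬ ∀ i : α, X (Sum.inl i) ∈ p) ∧
      (¬ ∀ j : β, X (Sum.inr j) ∈ p) ∧ I₂ ≤ p) :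
    ∃ p : Ideal (MvPolynomial (α ⊕ β) k), p.IsPrime ∧ (¬ ∀ i : α, X (Sum.inl i) ∈ p) ∧
      (¬ ∀ j : β, X (Sum.inr j) ∈ p) ∧ I₁ ≤ p ∧ I₂ ≤ p := by
  classical
  by_contra hcon'
  have hcon : ∀ p : Ideal (MvPolynomial (α ⊕ β) k), p.IsPrime →
      (¬ ∀ i : α, X (Sum.inl i) ∈ p) → (¬ ∀ j : β, X (Sum.inr j) ∈ p) → I₁ ≤ p → ¬ I₂ ≤ p :=
    fun p hp hpx hpy hp₁ hp₂ => hcon' ⟨p, hp, hpx, hpy, hp₁, hp₂⟩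
  let 𝒜 := homogeneousSubmodule (α ⊕ β) k
  let Wx : Ideal (MvPolynomial (α ⊕ β) k) := Ideal.span (Set.range fun i : α => X (Sum.inl i))
  let Wy : Ideal (MvPolynomial (α ⊕ β) k) := Ideal.span (Set.range fun j : β => X (Sum.inr j))
  have hWx : Wx.IsHomogeneous 𝒜 := Ideal.homogeneous_span _ _ (by
    rintro _ ⟨i, rfl⟩; exact ⟨1, isHomogeneous_X _ _⟩)
  have hWy : Wy.IsHomogeneous 𝒜 := Ideal.homogeneous_span _ _ (by
    rintro _ ⟨i, rfl⟩; exact ⟨1, isHomogeneous_X _ _⟩)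
  have hWx' : ∀ p, Wx ≤ p ↔ ∀ i : α, X (Sum.inl i) ∈ p := fun p => by
    rw [Ideal.span_le, Set.range_subset_iff]; rfl
  have hWy' : ∀ p, Wy ≤ p ↔ ∀ i : β, X (Sum.inr i) ∈ p := fun p => by
    rw [Ideal.span_le, Set.range_subset_iff]; rfl
  let F : Ideal (MvPolynomial (α ⊕ β) k) → Ideal (MvPolynomial (α ⊕ β) k) := fun I =>
    (I ⊓ (Wx ⊓ Wy)) ⊔ (P ⊔ P')
  have hF : ∀ I, I.IsHomogeneous 𝒜 → (F I).IsHomogeneous 𝒜 := fun I hI =>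
    (hI.inf (hWx.inf hWy)).sup (hP.sup hP')
  have hFle : ∀ I p, p.IsPrime → (F I ≤ p ↔ (I ≤ p ∨ (∀ i : α, X (Sum.inl i) ∈ p) ∨
      ∀ j : β, X (Sum.inr j) ∈ p) ∧ P ⊔ P' ≤ p) := fun I p hp => by
    rw [← hWx', ← hWy', sup_le_iff, hp.inf_le, hp.inf_le]
  let E : Ideal (MvPolynomial (α ⊕ β) k) → Ideal (MvPolynomial ((α ⊕ β) ⊕ (α ⊕ β)) k) := fun I =>
    I.map (rename (R := k) Sum.inl) ⊔ Ideal.span (diagonalEquations k (α ⊕ β) :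
      Set (MvPolynomial ((α ⊕ β) ⊕ (α ⊕ β)) k))
  have hE : ∀ I, I.IsHomogeneous 𝒜 → (E I).IsHomogeneous _ := fun I hI =>
    isHomogeneous_sup_span (isHomogeneous_map_rename _ hI) fun f hf =>
      ⟨1, isHomogeneous_of_mem_diagonalEquations hf⟩
  have hEle : ∀ I p, E I ≤ p ↔ I ≤ p.comap (rename (R := k) Sum.inl) ∧
      Ideal.span (diagonalEquations k (α ⊕ β) :
        Set (MvPolynomial ((α ⊕ β) ⊕ (α ⊕ β)) k)) ≤ p := fun I p => by
    rw [sup_le_iff, Ideal.map_le_iff_le_comap]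
  have hlift : ∀ p : Ideal (MvPolynomial (α ⊕ β) k), p.IsPrime → (¬ ∀ i : α, X (Sum.inl i) ∈ p) →
      (¬ ∀ j : β, X (Sum.inr j) ∈ p) → ∀ I J : Ideal (MvPolynomial (α ⊕ β) k),
      P ⊔ P' ≤ p → I ≤ p → ¬ J ≤ p →
      ∃ p' : Ideal (MvPolynomial ((α ⊕ β) ⊕ (α ⊕ β)) k), p'.IsPrime ∧ E (F I) ≤ p' ∧
        ¬ E (F J) ≤ p' := fun p hp hpx hpy I J hPp hIp hJp => by
    refine ⟨p.comap (rename (R := k) (Sum.elim id id)), Ideal.comap_isPrime _ _, ?_, ?_⟩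
    · rw [hEle, comap_inl_comap_elim, hFle _ _ hp]
      exact ⟨⟨Or.inl hIp, hPp⟩, span_diagonalEquations_le_comap p⟩
    · rw [hEle, comap_inl_comap_elim, hFle _ _ hp]
      tauto
  obtain ⟨p₁, hp₁, hp₁x, hp₁y, hp₁I⟩ := h₁
  obtain ⟨p₂, hp₂, hp₂x, hp₂y, hp₂I⟩ := h₂
  obtain ⟨p, hp, hpI, hpd⟩ := exists_isPrime_quotDim_le_add_card (isHomogeneous_external hP hP')
    (diagonalEquations k (α ⊕ β))
    (fun f hf => ⟨1, one_pos, isHomogeneous_of_mem_diagonalEquations hf⟩)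
    (hE _ (hF _ hI₁)) (hE _ (hF _ hI₂)) (fun p hp => by
      rw [external_sup_span_diagonalEquations_le_iff, hEle, hEle, hFle _ _ (Ideal.comap_isPrime _ p),
        hFle _ _ (Ideal.comap_isPrime _ p)]
      have := hI _ (Ideal.comap_isPrime (rename (R := k) Sum.inl) p)
      tauto)
    (hlift p₁ hp₁ hp₁x hp₁y I₁ I₂ ((hI p₁ hp₁ hp₁x hp₁y).2 (Or.inl hp₁I)) hp₁I
      (hcon p₁ hp₁ hp₁x hp₁y hp₁I))
    (hlift p₂ hp₂ hp₂x hp₂y I₂ I₁ ((hI p₂ hp₂ hp₂x hp₂y).2 (Or.inr hp₂I)) hp₂I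
      fun h' => hcon p₂ hp₂ hp₂x hp₂y h' hp₂I)
  have h2 := quotDim_external_le P P'
  have h3 := card_diagonalEquations_le (k := k) (σ := α ⊕ β)
  rw [Fintype.card_sum] at h3
  obtain ⟨h4, h5⟩ := sup_le_iff.1 hpI
  rw [hEle, hFle _ _ (Ideal.comap_isPrime _ p)] at h4 h5
  obtain ⟨hx, hy⟩ := not_mem_of_card_lt_quotDim hp.ne_top h4.2 h (by omega)
  have h6 := h4.1.1.resolve_right (by tauto)
  have h7 := h5.1.1.resolve_right (by tauto)
  exact hcon _ (Ideal.comap_isPrime (rename (R := k) Sum.inl) p) hx hy h6 h7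

end

namespace HomogeneousLocalization

variable {A σ R R' : Type*} [CommRing A] [SetLike σ A] [AddSubgroupClass σ A] {𝒜 : ℕ → σ}
  [GradedRing 𝒜] [CommRing R] [CommRing R'] {f : A} {m : ℕ}

/-- The ring map from the degree zero part of `A_f` induced by a ring map inverting `f`. -/
def Away.lift (𝒜 : ℕ → σ) [GradedRing 𝒜] (φ : A →+* R) (hu : IsUnit (φ f)) : Away 𝒜 f →+* R :=
  (Localization.awayLift φ f hu).comp (algebraMap (Away 𝒜 f) (Localization.Away f))

lemma Away.lift_mk_mul_pow (φ : A →+* R) (hu : IsUnit (φ f)) (hf : f ∈ 𝒜 m) (n : ℕ) (x : A)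
    (hx : x ∈ 𝒜 (n • m)) : Away.lift 𝒜 φ hu (Away.mk 𝒜 hf n x hx) * φ f ^ n = φ x := by
  have h : Localization.awayLift φ f hu (Localization.mk x ⟨f ^ n, n, rfl⟩) * φ f ^ n = φ x := by
    rw [← map_pow, ← IsLocalization.Away.lift_eq (S := Localization.Away f) f hu (f ^ n)]
    rw [Localization.mk_eq_mk', ← map_mul, IsLocalization.mk'_spec]
    exact IsLocalization.Away.lift_eq f hu x
  exact h

lemma Away.lift_comp (φ : A →+* R) (hu : IsUnit (φ f)) (g : R →+* R')
    (hu' : IsUnit ((g.comp φ) f)) : Away.lift 𝒜 (g.comp φ) hu' = g.comp (Away.lift 𝒜 φ hu) := by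
  have : Localization.awayLift (g.comp φ) f hu' = g.comp (Localization.awayLift φ f hu) := by
    refine IsLocalization.ringHom_ext (Submonoid.powers f) ?_
    ext x
    simp [Localization.awayLift]
  rw [Away.lift, this]
  rfl

lemma Away.lift_eq_iff {φ φ' : A →+* R} (hu : IsUnit (φ f)) (hu' : IsUnit (φ' f)) (hf : f ∈ 𝒜 m) :
    Away.lift 𝒜 φ hu = Away.lift 𝒜 φ' hu' ↔
      ∀ n, ∀ x ∈ 𝒜 (n • m), φ x * φ' f ^ n = φ' x * φ f ^ n := by
  constructor
  · intro h n x hx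
    rw [← Away.lift_mk_mul_pow φ hu hf n x hx, ← Away.lift_mk_mul_pow φ' hu' hf n x hx, h]
    ring
  · intro h
    ext a
    obtain ⟨n, x, hx, rfl⟩ := Away.mk_surjective 𝒜 hf a
    have h1 := h n x hx
    rw [← Away.lift_mk_mul_pow φ hu hf n x hx, ← Away.lift_mk_mul_pow φ' hu' hf n x hx] at h1
    refine ((hu.pow n).mul (hu'.pow n)).mul_right_cancel ?_
    rw [← mul_assoc, h1]
    ring

lemma Away.lift_comp_awayMap {g : A} {d : ℕ} (φ : A →+* R) (hg : g ∈ 𝒜 d) (hf : f ∈ 𝒜 m)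
    (hu : IsUnit (φ f)) (hu' : IsUnit (φ (f * g))) :
    (Away.lift 𝒜 φ hu').comp (awayMap 𝒜 hg rfl) = Away.lift 𝒜 φ hu := by
  ext a
  obtain ⟨n, x, hx, rfl⟩ := Away.mk_surjective 𝒜 hf a
  refine (hu'.pow n).mul_right_cancel ?_
  rw [RingHom.comp_apply, awayMap_mk, Away.lift_mk_mul_pow, map_mul φ x, map_pow, map_mul φ f g,
    mul_pow, ← mul_assoc, Away.lift_mk_mul_pow]

lemma Away.lift_fromZeroRingHom (φ : A →+* R) (hu : IsUnit (φ f)) (hf : f ∈ 𝒜 m) :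
    (Away.lift 𝒜 φ hu).comp (fromZeroRingHom 𝒜 _) = φ.comp (algebraMap (𝒜 0) A) := by
  ext a
  have := Away.lift_mk_mul_pow φ hu hf 0 a (by simp)
  rw [pow_zero, mul_one] at this
  rw [RingHom.comp_apply]
  refine Eq.trans (congrArg _ ?_) this
  rw [HomogeneousLocalization.ext_iff_val, Away.val_mk]
  refine (HomogeneousLocalization.val_mk _).trans ?_
  simp only [pow_zero]
  rfl

end HomogeneousLocalization

namespace AlgebraicGeometry.Proj
open HomogeneousLocalization
universe u
variable {A R R' : Type u} {σ : Type*} [CommRing A] [SetLike σ A] [AddSubgroupClass σ A] {𝒜 : ℕ → σ}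
  [GradedRing 𝒜] [CommRing R] [CommRing R'] {f g : A} {m m' : ℕ}

/-- The `R`-point of `Proj 𝒜` given by a ring map `φ : A → R` making `f` invertible. -/
def ofUnit (φ : A →+* R) (hf : f ∈ 𝒜 m) (hm : 0 < m) (hu : IsUnit (φ f)) :
    Spec (.of R) ⟶ Proj 𝒜 :=
  Spec.map (CommRingCat.ofHom (Away.lift 𝒜 φ hu)) ≫ awayι 𝒜 f hf hm

lemma SpecMap_ofUnit (φ : A →+* R) (hf : f ∈ 𝒜 m) (hm : 0 < m) (hu : IsUnit (φ f)) (g : R →+* R')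
    (hu' : IsUnit (g.comp φ f)) :
    Spec.map (CommRingCat.ofHom g) ≫ ofUnit φ hf hm hu = ofUnit (g.comp φ) hf hm hu' := by
  rw [ofUnit, ofUnit, Away.lift_comp φ hu g hu', CommRingCat.ofHom_comp, Spec.map_comp,
    Category.assoc]

lemma ofUnit_eq_mul (φ : A →+* R) (hf : f ∈ 𝒜 m) (hm : 0 < m) (hu : IsUnit (φ f))
    (hg : g ∈ 𝒜 m') (hu' : IsUnit (φ (f * g))) :
    ofUnit φ hf hm hu =
      ofUnit φ (f := f * g) (SetLike.mul_mem_graded hf hg) (by omega) hu' := by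
  rw [ofUnit, ofUnit, ← SpecMap_awayMap_awayι 𝒜 hf hm hg rfl, ← Category.assoc, ← Spec.map_comp,
    ← CommRingCat.ofHom_comp, Away.lift_comp_awayMap φ hg hf hu]

lemma ofUnit_eq_of_isUnit (φ : A →+* R) (hf : f ∈ 𝒜 m) (hm : 0 < m) (hu : IsUnit (φ f))
    (hg : g ∈ 𝒜 m') (hm' : 0 < m') (hu' : IsUnit (φ g)) :
    ofUnit φ hf hm hu = ofUnit φ hg hm' hu' := by
  rw [ofUnit_eq_mul φ hf hm hu hg (by rw [map_mul]; exact hu.mul hu'),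
    ofUnit_eq_mul φ hg hm' hu' hf (by rw [map_mul]; exact hu'.mul hu)]
  congr 1
  · exact mul_comm f g
  · exact add_comm m m'

lemma ofUnit_eq_iff {φ φ' : A →+* R} (hf : f ∈ 𝒜 m) (hm : 0 < m) (hu : IsUnit (φ f))
    (hu' : IsUnit (φ' f)) : ofUnit φ hf hm hu = ofUnit φ' hf hm hu' ↔
      ∀ n, ∀ x ∈ 𝒜 (n • m), φ x * φ' f ^ n = φ' x * φ f ^ n := by
  rw [← Away.lift_eq_iff hu hu' hf, ofUnit, ofUnit, cancel_mono, Spec.map_inj]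
  exact ⟨fun h ↦ congrArg CommRingCat.Hom.hom h, fun h ↦ by rw [h]⟩

lemma ofUnit_toSpecZero (φ : A →+* R) (hf : f ∈ 𝒜 m) (hm : 0 < m) (hu : IsUnit (φ f)) :
    ofUnit φ hf hm hu ≫ toSpecZero 𝒜 =
      Spec.map (CommRingCat.ofHom (φ.comp (algebraMap (𝒜 0) A))) := by
  rw [ofUnit, Category.assoc, awayι_toSpecZero, ← Spec.map_comp, ← CommRingCat.ofHom_comp,
    Away.lift_fromZeroRingHom φ hu hf]

lemma ofUnit_mem_basicOpen_iff (φ : A →+* R) (hf : f ∈ 𝒜 m) (hm : 0 < m) (hu : IsUnit (φ f))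
    (hg : g ∈ 𝒜 m') (hm' : 0 < m') (p : Spec (.of R)) :
    ofUnit φ hf hm hu p ∈ basicOpen 𝒜 g ↔ φ g ∉ p.asIdeal := by
  change Spec.map (CommRingCat.ofHom (Away.lift 𝒜 φ hu)) p ∈
    awayι 𝒜 f hf hm ⁻¹ᵁ basicOpen 𝒜 g ↔ _
  rw [awayι_preimage_basicOpen 𝒜 hf hm hg hm']
  change Away.lift 𝒜 φ hu (Away.isLocalizationElem hf hg) ∉ p.asIdeal ↔ _
  have h := Away.lift_mk_mul_pow φ hu hf m' (g ^ m)
    (by rw [smul_eq_mul, mul_comm]; exact SetLike.pow_mem_graded m hg)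
  have h2 : Away.lift 𝒜 φ hu (Away.isLocalizationElem hf hg) * φ f ^ m' = φ g ^ m := by
    rw [← map_pow φ g, ← h]
  refine not_congr ((Ideal.mul_unit_mem_iff_mem (y := φ f ^ m') p.asIdeal (hu.pow m')).symm.trans ?_)
  rw [h2]
  exact p.isPrime.pow_mem_iff_mem m hm

lemma exists_eq_ofUnit (hf : f ∈ 𝒜 m) (hm : 0 < m) (p : Spec (.of R) ⟶ Proj 𝒜)
    (h : ∀ x, p x ∈ basicOpen 𝒜 f) :
    ∃ γ : Away 𝒜 f →+* R, p = Spec.map (CommRingCat.ofHom γ) ≫ awayι 𝒜 f hf hm := by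
  have hr : Set.range p ⊆ Set.range (awayι 𝒜 f hf hm) := by
    rintro _ ⟨x, rfl⟩
    have := h x
    rw [← opensRange_awayι 𝒜 f hf hm] at this
    exact this
  refine ⟨(Spec.preimage (IsOpenImmersion.lift (awayι 𝒜 f hf hm) p hr)).hom, ?_⟩
  rw [CommRingCat.ofHom_hom, Spec.map_preimage, IsOpenImmersion.lift_fac]

end AlgebraicGeometry.Proj

/-- Rescaling all variables by `c` multiplies the value of a form of degree `n` by `c ^ n`. -/
lemma MvPolynomial.IsHomogeneous.map_eq_pow_mul {σ k R : Type*} [CommSemiring k] [CommSemiring R]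
    {p : MvPolynomial σ k} {n : ℕ} (hp : p.IsHomogeneous n) {φ ψ : MvPolynomial σ k →+* R} {c : R}
    (hC : ∀ a, ψ (C a) = φ (C a)) (hX : ∀ l, ψ (X l) = c * φ (X l)) : ψ p = c ^ n * φ p := by
  rw [← support_sum_monomial_coeff p, map_sum, map_sum, Finset.mul_sum]
  refine Finset.sum_congr rfl fun d hd ↦ ?_
  have hdeg : d.degree = n := by
    have := hp (mem_support_iff.mp hd)
    rwa [Finsupp.degree_eq_weight_one]
  rw [monomial_eq, map_mul, map_mul, hC, Finsupp.prod, map_prod, map_prod, mul_left_comm]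
  congr 1
  simp only [map_pow, hX, mul_pow]
  rw [Finset.prod_mul_distrib, Finset.prod_pow_eq_pow_sum, ← hdeg]
  rfl

namespace ProjSpace
open HomogeneousLocalization

variable {k : Type} [Field k] {n : ℕ} {R R' : Type} [CommRing R] [CommRing R']

lemma X_mem (i : Fin (n + 1)) : (X i : MvPolynomial (Fin (n + 1)) k) ∈
    homogeneousSubmodule (Fin (n + 1)) k 1 := isHomogeneous_X k i

/-- The `R`-point of projective space with homogeneous coordinates `φ (X l)`, where `φ (X i)` is
a unit. -/
def point (φ : MvPolynomial (Fin (n + 1)) k →+* R) (i : Fin (n + 1)) (hu : IsUnit (φ (X i))) :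
    Spec (.of R) ⟶ ProjSpace k n :=
  Proj.ofUnit φ (X_mem i) one_pos hu

lemma SpecMap_point (φ : MvPolynomial (Fin (n + 1)) k →+* R) (i : Fin (n + 1))
    (hu : IsUnit (φ (X i))) (g : R →+* R') (hu' : IsUnit (g.comp φ (X i))) :
    Spec.map (CommRingCat.ofHom g) ≫ point φ i hu = point (g.comp φ) i hu' :=
  Proj.SpecMap_ofUnit φ _ _ hu g hu'

lemma point_congr (φ : MvPolynomial (Fin (n + 1)) k →+* R) {i j : Fin (n + 1)}
    (hi : IsUnit (φ (X i))) (hj : IsUnit (φ (X j))) : point φ i hi = point φ j hj :=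
  Proj.ofUnit_eq_of_isUnit φ _ _ hi _ _ hj

lemma point_structMap (φ : MvPolynomial (Fin (n + 1)) k →+* R) (i : Fin (n + 1))
    (hu : IsUnit (φ (X i))) :
    point φ i hu ≫ structMap k n = Spec.map (CommRingCat.ofHom (φ.comp C)) := by
  change Proj.ofUnit φ (X_mem i) one_pos hu ≫ Proj.toSpecZero _ ≫ Spec.map _ = _
  rw [← Category.assoc, Proj.ofUnit_toSpecZero, ← Spec.map_comp, ← CommRingCat.ofHom_comp]
  rfl

lemma point_mem_basicOpen_iff (φ : MvPolynomial (Fin (n + 1)) k →+* R) (i j : Fin (n + 1))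
    (hu : IsUnit (φ (X i))) (p : Spec (.of R)) :
    point φ i hu p ∈ Proj.basicOpen (homogeneousSubmodule (Fin (n + 1)) k) (X j) ↔
      φ (X j) ∉ p.asIdeal :=
  Proj.ofUnit_mem_basicOpen_iff φ _ _ hu (X_mem j) one_pos p

lemma point_eq_of_smul {φ ψ : MvPolynomial (Fin (n + 1)) k →+* R} {i : Fin (n + 1)}
    (hu : IsUnit (φ (X i))) (hu' : IsUnit (ψ (X i))) {c : R} (hC : ∀ a, ψ (C a) = φ (C a))
    (hX : ∀ l, ψ (X l) = c * φ (X l)) : point φ i hu = point ψ i hu' := by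
  refine (Proj.ofUnit_eq_iff _ _ hu hu').mpr fun n x hx ↦ ?_
  rw [smul_eq_mul, mul_one] at hx
  rw [IsHomogeneous.map_eq_pow_mul hx hC hX, hX, mul_pow]
  ring

lemma exists_smul_of_point_eq {φ ψ : MvPolynomial (Fin (n + 1)) k →+* R} {i : Fin (n + 1)}
    {hu : IsUnit (φ (X i))} {hu' : IsUnit (ψ (X i))} (h : point φ i hu = point ψ i hu') :
    (∀ a, ψ (C a) = φ (C a)) ∧ ∃ c, ∀ l, ψ (X l) = c * φ (X l) := by
  have h' := (Proj.ofUnit_eq_iff _ _ hu hu').mp h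
  refine ⟨fun a ↦ ?_, ψ (X i) * hu.unit⁻¹, fun l ↦ ?_⟩
  · have := h' 0 (C a) (by rw [zero_smul]; exact isHomogeneous_C _ a)
    simpa using this.symm
  · have := h' 1 (X l) (by rw [one_smul]; exact X_mem l)
    rw [pow_one, pow_one] at this
    refine hu.mul_right_cancel ?_
    rw [← this, mul_assoc, mul_comm, mul_right_comm, mul_assoc, mul_assoc,
      mul_comm (φ (X l)), ← mul_assoc]
    simp [mul_comm]

/-- Dehomogenisation with respect to the `i`-th variable. -/
def dehomogenize (k : Type) [Field k] {n : ℕ} (i : Fin (n + 1)) : MvPolynomial (Fin (n + 1)) k →+*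
    Away (homogeneousSubmodule (Fin (n + 1)) k) (X i) :=
  eval₂Hom ((fromZeroRingHom _ _).comp (algebraMap k (homogeneousSubmodule (Fin (n + 1)) k 0)))
    fun l ↦ Away.mk _ (X_mem i) 1 (X l) (by rw [one_smul]; exact X_mem l)

lemma dehomogenize_of_mem (i : Fin (n + 1)) {d : ℕ} {x : MvPolynomial (Fin (n + 1)) k}
    (hx : x ∈ homogeneousSubmodule (Fin (n + 1)) k (d • 1)) :
    dehomogenize k i x = Away.mk _ (X_mem i) d x hx := by
  rw [HomogeneousLocalization.ext_iff_val, Away.val_mk]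
  have hx' : x.IsHomogeneous d := by rwa [smul_eq_mul, mul_one] at hx
  have h := IsHomogeneous.map_eq_pow_mul hx'
    (φ := algebraMap _ (Localization.Away (X i : MvPolynomial (Fin (n + 1)) k)))
    (ψ := (algebraMap (Away _ _) (Localization.Away (X i : MvPolynomial (Fin (n + 1)) k))).comp
      (dehomogenize k i)) (c := Localization.mk 1 ⟨X i, 1, pow_one _⟩) ?_ ?_
  · refine h.trans ?_
    rw [← Localization.mk_one_eq_algebraMap, Localization.mk_pow, Localization.mk_mul]
    congr 1
    · simp
    · ext; simp
  · intro a
    simp only [dehomogenize, RingHom.comp_apply, coe_eval₂Hom, eval₂_C]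
    refine (HomogeneousLocalization.val_mk _).trans ?_
    rw [← Localization.mk_one_eq_algebraMap]
    rfl
  · intro l
    simp only [dehomogenize, RingHom.comp_apply, coe_eval₂Hom, eval₂_X]
    refine (Away.val_mk _ 1 (X_mem i) _ _).trans ?_
    rw [← Localization.mk_one_eq_algebraMap, Localization.mk_mul]
    congr 1
    · simp
    · ext; simp

lemma dehomogenize_X_self (i : Fin (n + 1)) : dehomogenize k i (X i) = 1 := by
  rw [dehomogenize_of_mem i (d := 1) (by rw [one_smul]; exact X_mem i),
    HomogeneousLocalization.ext_iff_val, Away.val_mk, val_one, Localization.mk_eq_mk',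
    IsLocalization.mk'_eq_iff_eq_mul]
  simp

/-- A morphism from an affine scheme to a standard chart is given by homogeneous coordinates. -/
lemma exists_eq_point (i : Fin (n + 1)) (p : Spec (.of R) ⟶ ProjSpace k n)
    (h : ∀ x, p x ∈ Proj.basicOpen (homogeneousSubmodule (Fin (n + 1)) k) (X i)) :
    ∃ φ hu, p = point φ i hu := by
  obtain ⟨γ, rfl⟩ := Proj.exists_eq_ofUnit (X_mem i) one_pos p h
  have hu : IsUnit (γ.comp (dehomogenize k i) (X i)) := by simp [dehomogenize_X_self]
  refine ⟨γ.comp (dehomogenize k i), hu, ?_⟩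
  rw [point, Proj.ofUnit]
  congr 3
  ext a
  obtain ⟨d, x, hx, rfl⟩ := Away.mk_surjective _ (X_mem i) a
  have := Away.lift_mk_mul_pow _ hu (X_mem i) d x hx
  rw [RingHom.comp_apply, dehomogenize_X_self, map_one, one_pow, mul_one] at this
  rw [this, RingHom.comp_apply, dehomogenize_of_mem i hx]

lemma exists_mem_basicOpen (t : ProjSpace k n) :
    ∃ i, t ∈ Proj.basicOpen (homogeneousSubmodule (Fin (n + 1)) k) (X i) := by
  have h := Proj.iSup_basicOpen_eq_top' (𝒜 := homogeneousSubmodule (Fin (n + 1)) k)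
    (X : Fin (n + 1) → _) (fun i ↦ ⟨1, X_mem i⟩) ?_
  · exact TopologicalSpace.Opens.mem_iSup.mp (h.ge (Set.mem_univ t))
  · refine eq_top_iff.mpr fun x _ ↦ ?_
    induction x using MvPolynomial.induction_on with
    | C a =>
      exact Subalgebra.algebraMap_mem
        (Algebra.adjoin (homogeneousSubmodule (Fin (n + 1)) k 0) (Set.range X))
        ⟨C a, isHomogeneous_C _ a⟩
    | add p q hp hq => exact add_mem (hp trivial) (hq trivial)
    | mul_X p i hp => exact mul_mem (hp trivial) (Algebra.subset_adjoin ⟨i, rfl⟩)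

end ProjSpace

namespace ProjSpace

variable {k : Type} [Field k] {n₁ n₂ : ℕ} {R R' : Type} [CommRing R] [CommRing R']

/-- The first projection from the product of two projective spaces. -/
def prodFst (k : Type) [Field k] (n₁ n₂ : ℕ) :
    (ProjOver k n₁ ⨯ ProjOver k n₂).left ⟶ ProjSpace k n₁ :=
  (prod.fst : ProjOver k n₁ ⨯ ProjOver k n₂ ⟶ _).left

/-- The second projection from the product of two projective spaces. -/
def prodSnd (k : Type) [Field k] (n₁ n₂ : ℕ) :
    (ProjOver k n₁ ⨯ ProjOver k n₂).left ⟶ ProjSpace k n₂ :=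
  (prod.snd : ProjOver k n₁ ⨯ ProjOver k n₂ ⟶ _).left

lemma prodFst_structMap : prodFst k n₁ n₂ ≫ structMap k n₁ =
    (ProjOver k n₁ ⨯ ProjOver k n₂).hom :=
  Over.w (prod.fst : ProjOver k n₁ ⨯ ProjOver k n₂ ⟶ _)

lemma prodSnd_structMap : prodSnd k n₁ n₂ ≫ structMap k n₂ =
    (ProjOver k n₁ ⨯ ProjOver k n₂).hom :=
  Over.w (prod.snd : ProjOver k n₁ ⨯ ProjOver k n₂ ⟶ _)

lemma prod_hom_ext {W : Scheme} {f g : W ⟶ (ProjOver k n₁ ⨯ ProjOver k n₂).left}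
    (h₁ : f ≫ prodFst k n₁ n₂ = g ≫ prodFst k n₁ n₂)
    (h₂ : f ≫ prodSnd k n₁ n₂ = g ≫ prodSnd k n₁ n₂) : f = g := by
  have hw : g ≫ (ProjOver k n₁ ⨯ ProjOver k n₂).hom =
      f ≫ (ProjOver k n₁ ⨯ ProjOver k n₂).hom := by
    rw [← prodFst_structMap, ← Category.assoc, ← Category.assoc, h₁]
  let f' : Over.mk (f ≫ (ProjOver k n₁ ⨯ ProjOver k n₂).hom) ⟶
    ProjOver k n₁ ⨯ ProjOver k n₂ := Over.homMk f rfl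
  let g' : Over.mk (f ≫ (ProjOver k n₁ ⨯ ProjOver k n₂).hom) ⟶
    ProjOver k n₁ ⨯ ProjOver k n₂ := Over.homMk g hw
  have : f' = g' := by
    apply Limits.prod.hom_ext
    · ext1; exact h₁
    · ext1; exact h₂
  exact congrArg (fun u ↦ u.left) this

/-- The restriction of a ring map on `k[x, y]` to `k[x]`. -/
abbrev mapLeft (φ : MvPolynomial (Fin (n₁ + 1) ⊕ Fin (n₂ + 1)) k →+* R) :
    MvPolynomial (Fin (n₁ + 1)) k →+* R :=
  φ.comp (rename (R := k) Sum.inl).toRingHom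

/-- The restriction of a ring map on `k[x, y]` to `k[y]`. -/
abbrev mapRight (φ : MvPolynomial (Fin (n₁ + 1) ⊕ Fin (n₂ + 1)) k →+* R) :
    MvPolynomial (Fin (n₂ + 1)) k →+* R :=
  φ.comp (rename (R := k) Sum.inr).toRingHom

variable {φ ψ : MvPolynomial (Fin (n₁ + 1) ⊕ Fin (n₂ + 1)) k →+* R}
  {i i' : Fin (n₁ + 1)} {j j' : Fin (n₂ + 1)}

lemma mapLeft_X (l : Fin (n₁ + 1)) : mapLeft φ (X l) = φ (X (Sum.inl l)) := by simp

lemma mapRight_X (l : Fin (n₂ + 1)) : mapRight φ (X l) = φ (X (Sum.inr l)) := by simp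

lemma mapLeft_comp_C : (mapLeft φ).comp C = φ.comp C := by ext; simp

lemma mapRight_comp_C : (mapRight φ).comp C = φ.comp C := by ext; simp

/-- The `R`-point of the product of two projective spaces with the given pair of systems of
homogeneous coordinates. -/
def biPoint (φ : MvPolynomial (Fin (n₁ + 1) ⊕ Fin (n₂ + 1)) k →+* R)
    (hi : IsUnit (φ (X (Sum.inl i)))) (hj : IsUnit (φ (X (Sum.inr j)))) :
    Spec (.of R) ⟶ (ProjOver k n₁ ⨯ ProjOver k n₂).left :=
  (prod.lift
    (Over.homMk (point (mapLeft φ) i (mapLeft_X (φ := φ) i ▸ hi))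
      (by rw [← mapLeft_comp_C]; exact point_structMap _ _ _) :
      Over.mk (Spec.map (CommRingCat.ofHom (φ.comp C))) ⟶ ProjOver k n₁)
    (Over.homMk (point (mapRight φ) j (mapRight_X (φ := φ) j ▸ hj))
      (by rw [← mapRight_comp_C]; exact point_structMap _ _ _) :
      Over.mk (Spec.map (CommRingCat.ofHom (φ.comp C))) ⟶ ProjOver k n₂)).left

lemma biPoint_fst (hi : IsUnit (φ (X (Sum.inl i)))) (hj : IsUnit (φ (X (Sum.inr j)))) :
    biPoint φ hi hj ≫ prodFst k n₁ n₂ = point (mapLeft φ) i (mapLeft_X (φ := φ) i ▸ hi) := by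
  rw [biPoint, prodFst, ← Over.comp_left, prod.lift_fst]
  rfl

lemma biPoint_snd (hi : IsUnit (φ (X (Sum.inl i)))) (hj : IsUnit (φ (X (Sum.inr j)))) :
    biPoint φ hi hj ≫ prodSnd k n₁ n₂ = point (mapRight φ) j (mapRight_X (φ := φ) j ▸ hj) := by
  rw [biPoint, prodSnd, ← Over.comp_left, prod.lift_snd]
  rfl

lemma biPoint_congr (hi : IsUnit (φ (X (Sum.inl i)))) (hj : IsUnit (φ (X (Sum.inr j))))
    (hi' : IsUnit (φ (X (Sum.inl i')))) (hj' : IsUnit (φ (X (Sum.inr j')))) :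
    biPoint φ hi hj = biPoint φ hi' hj' := by
  apply prod_hom_ext
  · rw [biPoint_fst, biPoint_fst]; exact point_congr _ _ _
  · rw [biPoint_snd, biPoint_snd]; exact point_congr _ _ _

lemma SpecMap_biPoint (hi : IsUnit (φ (X (Sum.inl i)))) (hj : IsUnit (φ (X (Sum.inr j))))
    (g : R →+* R') (hi' : IsUnit (g.comp φ (X (Sum.inl i))))
    (hj' : IsUnit (g.comp φ (X (Sum.inr j)))) :
    Spec.map (CommRingCat.ofHom g) ≫ biPoint φ hi hj = biPoint (g.comp φ) hi' hj' := by
  apply prod_hom_ext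
  · rw [Category.assoc, biPoint_fst, biPoint_fst]; exact SpecMap_point _ _ _ _ _
  · rw [Category.assoc, biPoint_snd, biPoint_snd]; exact SpecMap_point _ _ _ _ _

/-- Two ring maps on `k[x, y]` agree up to rescaling the `x` and the `y` coordinates. -/
def IsBiscaling (φ ψ : MvPolynomial (Fin (n₁ + 1) ⊕ Fin (n₂ + 1)) k →+* R) : Prop :=
  (∀ a, ψ (C a) = φ (C a)) ∧ (∃ c, ∀ l, ψ (X (Sum.inl l)) = c * φ (X (Sum.inl l))) ∧
    ∃ d, ∀ l, ψ (X (Sum.inr l)) = d * φ (X (Sum.inr l))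

lemma IsBiscaling.biPoint_eq (h : IsBiscaling φ ψ)
    (hi : IsUnit (φ (X (Sum.inl i)))) (hj : IsUnit (φ (X (Sum.inr j))))
    (hi' : IsUnit (ψ (X (Sum.inl i)))) (hj' : IsUnit (ψ (X (Sum.inr j)))) :
    biPoint φ hi hj = biPoint ψ hi' hj' := by
  obtain ⟨hC, ⟨c, hc⟩, d, hd⟩ := h
  apply prod_hom_ext
  · rw [biPoint_fst, biPoint_fst]
    exact point_eq_of_smul _ _ (c := c) (by simpa using hC) (by simpa using hc)
  · rw [biPoint_snd, biPoint_snd]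
    exact point_eq_of_smul _ _ (c := d) (by simpa using hC) (by simpa using hd)

lemma isBiscaling_of_biPoint_eq
    {hi : IsUnit (φ (X (Sum.inl i)))} {hj : IsUnit (φ (X (Sum.inr j)))}
    {hi' : IsUnit (ψ (X (Sum.inl i)))} {hj' : IsUnit (ψ (X (Sum.inr j)))}
    (h : biPoint φ hi hj = biPoint ψ hi' hj') : IsBiscaling φ ψ := by
  have h₁ := biPoint_fst hi hj
  rw [h, biPoint_fst] at h₁
  have h₂ := biPoint_snd hi hj
  rw [h, biPoint_snd] at h₂
  obtain ⟨hC, c, hc⟩ := exists_smul_of_point_eq h₁.symm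
  obtain ⟨-, d, hd⟩ := exists_smul_of_point_eq h₂.symm
  exact ⟨by simpa using hC, ⟨c, by simpa using hc⟩, d, by simpa using hd⟩

/-- The standard affine chart `x i ≠ 0, y j ≠ 0` of the product of two projective spaces. -/
def chart (k : Type) [Field k] {n₁ n₂ : ℕ} (i : Fin (n₁ + 1)) (j : Fin (n₂ + 1)) :
    (ProjOver k n₁ ⨯ ProjOver k n₂).left.Opens :=
  prodFst k n₁ n₂ ⁻¹ᵁ Proj.basicOpen (homogeneousSubmodule (Fin (n₁ + 1)) k) (X i) ⊓
    prodSnd k n₁ n₂ ⁻¹ᵁ Proj.basicOpen (homogeneousSubmodule (Fin (n₂ + 1)) k) (X j)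

lemma exists_mem_chart (t : (ProjOver k n₁ ⨯ ProjOver k n₂).left) : ∃ i j, t ∈ chart k i j := by
  obtain ⟨i, hi⟩ := exists_mem_basicOpen (prodFst k n₁ n₂ t)
  obtain ⟨j, hj⟩ := exists_mem_basicOpen (prodSnd k n₁ n₂ t)
  exact ⟨i, j, hi, hj⟩

lemma biPoint_mem_chart_iff (hi : IsUnit (φ (X (Sum.inl i)))) (hj : IsUnit (φ (X (Sum.inr j))))
    (p : Spec (.of R)) : biPoint φ hi hj p ∈ chart k i' j' ↔
      φ (X (Sum.inl i')) ∉ p.asIdeal ∧ φ (X (Sum.inr j')) ∉ p.asIdeal := by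
  change (biPoint φ hi hj ≫ prodFst k n₁ n₂) p ∈ Proj.basicOpen _ _ ∧
    (biPoint φ hi hj ≫ prodSnd k n₁ n₂) p ∈ Proj.basicOpen _ _ ↔ _
  rw [biPoint_fst, biPoint_snd]
  refine and_congr ((point_mem_basicOpen_iff _ _ _ _ _).trans ?_)
    ((point_mem_basicOpen_iff _ _ _ _ _).trans ?_)
  · rw [mapLeft_X]
  · rw [mapRight_X]

lemma exists_eq_biPoint (p : Spec (.of R) ⟶ (ProjOver k n₁ ⨯ ProjOver k n₂).left)
    (h : ∀ x, p x ∈ chart k i j) :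
    ∃ (φ : MvPolynomial (Fin (n₁ + 1) ⊕ Fin (n₂ + 1)) k →+* R)
      (hi : IsUnit (φ (X (Sum.inl i)))) (hj : IsUnit (φ (X (Sum.inr j)))),
      p = biPoint φ hi hj := by
  obtain ⟨φ, hφ, h₁⟩ := exists_eq_point i (p ≫ prodFst k n₁ n₂) fun x ↦ (h x).1
  obtain ⟨ψ, hψ, h₂⟩ := exists_eq_point j (p ≫ prodSnd k n₁ n₂) fun x ↦ (h x).2
  have hC : φ.comp C = ψ.comp C := by
    have e : Spec.map (CommRingCat.ofHom (φ.comp C)) = Spec.map (CommRingCat.ofHom (ψ.comp C)) := by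
      rw [← point_structMap φ i hφ, ← point_structMap ψ j hψ, ← h₁, ← h₂, Category.assoc,
        Category.assoc, prodFst_structMap, prodSnd_structMap]
    exact congrArg CommRingCat.Hom.hom (Spec.map_injective e)
  let χ : MvPolynomial (Fin (n₁ + 1) ⊕ Fin (n₂ + 1)) k →+* R :=
    eval₂Hom (φ.comp C) (Sum.elim (fun l ↦ φ (X l)) fun l ↦ ψ (X l))
  have hl : mapLeft χ = φ := by ext <;> simp [χ]
  have hr : mapRight χ = ψ := by
    ext a
    · simpa [χ] using RingHom.congr_fun hC a
    · simp [χ]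
  have hi : IsUnit (χ (X (Sum.inl i))) := by simpa [χ] using hφ
  have hj : IsUnit (χ (X (Sum.inr j))) := by simpa [χ] using hψ
  refine ⟨χ, hi, hj, prod_hom_ext ?_ ?_⟩
  · rw [h₁, biPoint_fst]; simp only [hl]
  · rw [h₂, biPoint_snd]; simp only [hr]

end ProjSpace

namespace ProjSpace

variable {k : Type} [Field k] {n₁ n₂ : ℕ} {R R' : Type} [CommRing R] [CommRing R']

/-- The map `k[x, y] → R[u, v]` obtained from `φ : k[x, y] → R` by multiplying the values of the
`x`-variables by `u` and those of the `y`-variables by `v`. -/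
def bihomogenize (φ : MvPolynomial (Fin (n₁ + 1) ⊕ Fin (n₂ + 1)) k →+* R) :
    MvPolynomial (Fin (n₁ + 1) ⊕ Fin (n₂ + 1)) k →+* MvPolynomial (Fin 2) R :=
  eval₂Hom (C.comp (φ.comp C)) (Sum.elim (fun l ↦ C (φ (X (Sum.inl l))) * X 0)
    fun l ↦ C (φ (X (Sum.inr l))) * X 1)

variable {φ ψ : MvPolynomial (Fin (n₁ + 1) ⊕ Fin (n₂ + 1)) k →+* R}

@[simp]
lemma bihomogenize_C (a : k) : bihomogenize φ (C a) = C (φ (C a)) := by simp [bihomogenize]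

@[simp]
lemma bihomogenize_X_inl (l : Fin (n₁ + 1)) :
    bihomogenize φ (X (Sum.inl l)) = C (φ (X (Sum.inl l))) * X 0 := by simp [bihomogenize]

@[simp]
lemma bihomogenize_X_inr (l : Fin (n₂ + 1)) :
    bihomogenize φ (X (Sum.inr l)) = C (φ (X (Sum.inr l))) * X 1 := by simp [bihomogenize]

lemma map_comp_bihomogenize (g : R →+* R') :
    (map g).comp (bihomogenize φ) = bihomogenize (g.comp φ) := by
  ext i
  · simp
  · obtain l | l := i <;> simp

lemma IsBiscaling.eval₂Hom_comp {c d : R} (hC : ∀ a, ψ (C a) = φ (C a))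
    (hc : ∀ l, ψ (X (Sum.inl l)) = c * φ (X (Sum.inl l)))
    (hd : ∀ l, ψ (X (Sum.inr l)) = d * φ (X (Sum.inr l))) :
    (eval₂Hom C ![C c * X 0, C d * X 1]).comp (bihomogenize φ) = bihomogenize ψ := by
  refine MvPolynomial.ringHom_ext (fun a ↦ ?_) fun i ↦ ?_
  · simp [hC]
  · obtain l | l := i
    · simp [hc]; ring
    · simp [hd]; ring

lemma IsBiscaling.ker_le (h : IsBiscaling φ ψ) :
    RingHom.ker (bihomogenize φ) ≤ RingHom.ker (bihomogenize ψ) := by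
  obtain ⟨hC, ⟨c, hc⟩, d, hd⟩ := h
  intro f hf
  rw [RingHom.mem_ker] at hf ⊢
  rw [← IsBiscaling.eval₂Hom_comp hC hc hd, RingHom.comp_apply, hf, map_zero]

lemma eval_one_comp_bihomogenize : (eval fun _ ↦ (1 : R)).comp (bihomogenize φ) = φ := by
  ext i
  · simp
  · obtain l | l := i <;> simp

lemma ker_bihomogenize_le : RingHom.ker (bihomogenize φ) ≤ RingHom.ker φ := by
  intro f hf
  rw [RingHom.mem_ker] at hf ⊢
  rw [← eval_one_comp_bihomogenize (φ := φ), RingHom.comp_apply, hf, map_zero]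

lemma ker_bihomogenize_comp_of_injective (g : R →+* R') (hg : Function.Injective g) :
    RingHom.ker (bihomogenize (g.comp φ)) = RingHom.ker (bihomogenize φ) := by
  ext f
  rw [RingHom.mem_ker, RingHom.mem_ker, ← map_comp_bihomogenize, RingHom.comp_apply,
    map_eq_zero_iff _ (map_injective g hg)]

lemma ker_bihomogenize_comp_le {R₁ R₂ : Type} [CommRing R₁] [CommRing R₂] (g₁ : R →+* R₁)
    (g₂ : R →+* R₂) (h : RingHom.ker g₁ ≤ RingHom.ker g₂) :
    RingHom.ker (bihomogenize (g₁.comp φ)) ≤ RingHom.ker (bihomogenize (g₂.comp φ)) := by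
  intro f hf
  rw [RingHom.mem_ker, ← map_comp_bihomogenize, RingHom.comp_apply] at hf ⊢
  ext s
  have := congrArg (coeff s) hf
  rw [coeff_map, coeff_zero] at this ⊢
  exact h this

lemma IsHomogeneous.bihomogenize {f : MvPolynomial (Fin (n₁ + 1) ⊕ Fin (n₂ + 1)) k} {d : ℕ}
    (hf : f.IsHomogeneous d) : (bihomogenize φ f).IsHomogeneous d := by
  have := hf.eval₂ (n := 1) (C.comp (φ.comp C)) (Sum.elim (fun l ↦ C (φ (X (Sum.inl l))) * X 0)
    fun l ↦ C (φ (X (Sum.inr l))) * (X 1 : MvPolynomial (Fin 2) R)) (fun a ↦ isHomogeneous_C _ _) ?_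
  · rwa [one_mul] at this
  · rintro (l | l)
    · simpa using (isHomogeneous_C _ _).mul (isHomogeneous_X R (0 : Fin 2))
    · simpa using (isHomogeneous_C _ _).mul (isHomogeneous_X R (1 : Fin 2))

lemma isHomogeneous_ker_bihomogenize :
    (RingHom.ker (bihomogenize φ)).IsHomogeneous
      (homogeneousSubmodule (Fin (n₁ + 1) ⊕ Fin (n₂ + 1)) k) := by
  intro d f hf
  rw [RingHom.mem_ker] at hf ⊢
  rw [show (DirectSum.decompose (homogeneousSubmodule (Fin (n₁ + 1) ⊕ Fin (n₂ + 1)) k) f d :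
    MvPolynomial _ k) = homogeneousComponent d f from decomposition.decompose'_apply f d]
  have h := congrArg (homogeneousComponent d) hf
  rw [← sum_homogeneousComponent f, map_sum, map_sum, map_zero] at h
  by_cases hd : d ∈ Finset.range (f.totalDegree + 1)
  · rw [Finset.sum_eq_single_of_mem d hd] at h
    · rwa [homogeneousComponent_of_mem (IsHomogeneous.bihomogenize
        (homogeneousComponent_isHomogeneous d f)), if_pos rfl] at h
    · intro e _ hed
      rw [homogeneousComponent_of_mem (IsHomogeneous.bihomogenize
        (homogeneousComponent_isHomogeneous e f)), if_neg hed.symm]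
  · rw [Finset.mem_range, not_lt] at hd
    rw [homogeneousComponent_eq_zero _ _ (by omega), map_zero]

lemma two_le_quotDim_ker_bihomogenize [IsDomain R] {i : Fin (n₁ + 1)} {j : Fin (n₂ + 1)}
    (hi : φ (X (Sum.inl i)) ≠ 0) (hj : φ (X (Sum.inr j)) ≠ 0) :
    2 ≤ (RingHom.ker (bihomogenize φ)).quotDim := by
  set s : MvPolynomial (Fin 2) R →+* MvPolynomial (Fin 2) R := eval₂Hom C ![0, X 1]
  set P₁ := RingHom.ker (s.comp (bihomogenize φ))
  set P₂ := RingHom.ker (((constantCoeff).comp s).comp (bihomogenize φ))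
  have : (RingHom.ker (bihomogenize φ)).IsPrime := RingHom.ker_isPrime _
  have : P₁.IsPrime := RingHom.ker_isPrime _
  have : P₂.IsPrime := RingHom.ker_isPrime _
  have h₁ : RingHom.ker (bihomogenize φ) < P₁ := by
    refine lt_of_le_of_ne (fun f hf ↦ ?_) fun h ↦ ?_
    · rw [RingHom.mem_ker] at hf ⊢
      rw [RingHom.comp_apply, hf, map_zero]
    · have : X (Sum.inl i) ∈ P₁ := by simp [P₁, s, RingHom.mem_ker]
      rw [← h, RingHom.mem_ker] at this
      simp [hi] at this
  have h₂ : P₁ < P₂ := by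
    refine lt_of_le_of_ne (fun f hf ↦ ?_) fun h ↦ ?_
    · rw [RingHom.mem_ker] at hf ⊢
      rw [RingHom.comp_assoc, RingHom.comp_apply, hf, map_zero]
    · have : X (Sum.inr j) ∈ P₂ := by simp [P₂, s, RingHom.mem_ker]
      rw [← h, RingHom.mem_ker] at this
      simp [s, hj] at this
  have := Ideal.quotDim_succ_le_of_lt (Ideal.IsPrime.ne_top ‹P₁.IsPrime›) h₁
  have := Ideal.quotDim_succ_le_of_lt (Ideal.IsPrime.ne_top ‹P₂.IsPrime›) h₂
  omega

end ProjSpace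

namespace ProjSpace

variable {k : Type} [Field k] {n₁ n₂ : ℕ}

lemma exists_fromSpecResidueField_eq_biPoint (t : (ProjOver k n₁ ⨯ ProjOver k n₂).left) :
    ∃ (φ : MvPolynomial (Fin (n₁ + 1) ⊕ Fin (n₂ + 1)) k →+*
        (ProjOver k n₁ ⨯ ProjOver k n₂).left.residueField t) (i : Fin (n₁ + 1)) (j : Fin (n₂ + 1))
      (hi : IsUnit (φ (X (Sum.inl i)))) (hj : IsUnit (φ (X (Sum.inr j)))),
      (ProjOver k n₁ ⨯ ProjOver k n₂).left.fromSpecResidueField t = biPoint φ hi hj := by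
  obtain ⟨i, j, ht⟩ := exists_mem_chart t
  obtain ⟨φ, hi, hj, h⟩ := exists_eq_biPoint (i := i) (j := j)
    (R := (ProjOver k n₁ ⨯ ProjOver k n₂).left.residueField t)
    ((ProjOver k n₁ ⨯ ProjOver k n₂).left.fromSpecResidueField t) fun x ↦ by
      have e := Scheme.fromSpecResidueField_apply (X := (ProjOver k n₁ ⨯ ProjOver k n₂).left) t x
      exact (congrArg (· ∈ chart k i j) e).mpr ht
  exact ⟨φ, i, j, hi, hj, h⟩

/-- The bihomogeneous prime ideal of `k[x, y]` of a point of the product of two projective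
spaces. -/
def cone (t : (ProjOver k n₁ ⨯ ProjOver k n₂).left) :
    Ideal (MvPolynomial (Fin (n₁ + 1) ⊕ Fin (n₂ + 1)) k) :=
  RingHom.ker (bihomogenize (exists_fromSpecResidueField_eq_biPoint t).choose)

instance (t : (ProjOver k n₁ ⨯ ProjOver k n₂).left) : (cone t).IsPrime := RingHom.ker_isPrime _

lemma isHomogeneous_cone (t : (ProjOver k n₁ ⨯ ProjOver k n₂).left) :
    (cone t).IsHomogeneous (homogeneousSubmodule (Fin (n₁ + 1) ⊕ Fin (n₂ + 1)) k) :=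
  isHomogeneous_ker_bihomogenize

lemma two_le_quotDim_cone (t : (ProjOver k n₁ ⨯ ProjOver k n₂).left) : 2 ≤ (cone t).quotDim := by
  obtain ⟨i, j, hi, hj, -⟩ := (exists_fromSpecResidueField_eq_biPoint t).choose_spec
  exact two_le_quotDim_ker_bihomogenize hi.ne_zero hj.ne_zero

lemma isBiscaling_symm_of_biPoint_eq {K : Type} [Field K]
    {φ ψ : MvPolynomial (Fin (n₁ + 1) ⊕ Fin (n₂ + 1)) k →+* K}
    {i i' : Fin (n₁ + 1)} {j j' : Fin (n₂ + 1)}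
    {hi : IsUnit (φ (X (Sum.inl i)))} {hj : IsUnit (φ (X (Sum.inr j)))}
    {hi' : IsUnit (ψ (X (Sum.inl i')))} {hj' : IsUnit (ψ (X (Sum.inr j')))}
    (h : biPoint φ hi hj = biPoint ψ hi' hj') : IsBiscaling φ ψ ∧ IsBiscaling ψ φ := by
  let x : Spec (.of K) := IsLocalRing.closedPoint K
  have hx : biPoint φ hi hj x ∈ chart k i' j' := by
    rw [h, biPoint_mem_chart_iff]
    exact ⟨fun h ↦ x.isPrime.ne_top (Ideal.eq_top_of_isUnit_mem _ h hi'),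
      fun h ↦ x.isPrime.ne_top (Ideal.eq_top_of_isUnit_mem _ h hj')⟩
  rw [biPoint_mem_chart_iff] at hx
  have hi₁ : IsUnit (φ (X (Sum.inl i'))) :=
    isUnit_iff_ne_zero.mpr fun h0 ↦ hx.1 (by rw [h0]; exact zero_mem _)
  have hj₁ : IsUnit (φ (X (Sum.inr j'))) :=
    isUnit_iff_ne_zero.mpr fun h0 ↦ hx.2 (by rw [h0]; exact zero_mem _)
  rw [biPoint_congr hi hj hi₁ hj₁] at h
  exact ⟨isBiscaling_of_biPoint_eq h, isBiscaling_of_biPoint_eq h.symm⟩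

/-- The prime ideal of a point can be computed from any field-valued point lying over it. -/
lemma cone_biPoint {K : Type} [Field K]
    {φ : MvPolynomial (Fin (n₁ + 1) ⊕ Fin (n₂ + 1)) k →+* K}
    {i : Fin (n₁ + 1)} {j : Fin (n₂ + 1)}
    (hi : IsUnit (φ (X (Sum.inl i)))) (hj : IsUnit (φ (X (Sum.inr j)))) (x : Spec (.of K)) :
    cone (biPoint φ hi hj x) = RingHom.ker (bihomogenize φ) := by
  obtain rfl : x = IsLocalRing.closedPoint K := Subsingleton.elim (α := PrimeSpectrum K) _ _
  set t := biPoint φ hi hj (IsLocalRing.closedPoint K) with ht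
  obtain ⟨i', j', hi', hj', h⟩ := (exists_fromSpecResidueField_eq_biPoint
    (biPoint φ hi hj (IsLocalRing.closedPoint K))).choose_spec
  have hd := Scheme.descResidueField_stalkClosedPointTo_fromSpecResidueField K _ (biPoint φ hi hj)
  let g := (ProjOver k n₁ ⨯ ProjOver k n₂).left.descResidueField
    (Scheme.stalkClosedPointTo (biPoint φ hi hj))
  have e : biPoint φ hi hj = biPoint (g.hom.comp _) (hi'.map g.hom) (hj'.map g.hom) :=
    hd.symm.trans ((congrArg (Spec.map g ≫ ·) h).trans (SpecMap_biPoint hi' hj' g.hom _ _))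
  obtain ⟨h₁, h₂⟩ := isBiscaling_symm_of_biPoint_eq e
  refine (ker_bihomogenize_comp_of_injective g.hom g.hom.injective).symm.trans ?_
  exact le_antisymm h₂.ker_le h₁.ker_le

lemma biPoint_comp_apply {R K : Type} [CommRing R] [Field K]
    {φ : MvPolynomial (Fin (n₁ + 1) ⊕ Fin (n₂ + 1)) k →+* R}
    {i : Fin (n₁ + 1)} {j : Fin (n₂ + 1)}
    (hi : IsUnit (φ (X (Sum.inl i)))) (hj : IsUnit (φ (X (Sum.inr j))))
    (z : PrimeSpectrum R) (f : R →+* K) (hf : RingHom.ker f = z.asIdeal)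
    (hi' : IsUnit (f.comp φ (X (Sum.inl i)))) (hj' : IsUnit (f.comp φ (X (Sum.inr j))))
    (x : Spec (.of K)) : biPoint (f.comp φ) hi' hj' x = biPoint φ hi hj z := by
  refine (congrArg (fun u : Spec (.of K) ⟶ (ProjOver k n₁ ⨯ ProjOver k n₂).left ↦ u x)
    (SpecMap_biPoint hi hj f hi' hj')).symm.trans ?_
  refine congrArg (biPoint φ hi hj) (PrimeSpectrum.ext ?_)
  refine Eq.trans (b := Ideal.comap f x.asIdeal) rfl ?_
  have hx : x.asIdeal = (⊥ : Ideal K) := (Ideal.eq_bot_or_top _).resolve_right x.isPrime.ne_top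
  exact (congrArg (Ideal.comap f) hx).trans hf

lemma cone_biPoint_apply {R K : Type} [CommRing R] [Field K]
    {φ : MvPolynomial (Fin (n₁ + 1) ⊕ Fin (n₂ + 1)) k →+* R}
    {i : Fin (n₁ + 1)} {j : Fin (n₂ + 1)}
    (hi : IsUnit (φ (X (Sum.inl i)))) (hj : IsUnit (φ (X (Sum.inr j))))
    (z : PrimeSpectrum R) (f : R →+* K) (hf : RingHom.ker f = z.asIdeal) :
    cone (biPoint φ hi hj z) = RingHom.ker (bihomogenize (f.comp φ)) := by
  rw [← biPoint_comp_apply hi hj z f hf (hi.map f) (hj.map f) (IsLocalRing.closedPoint K)]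
  exact cone_biPoint _ _ _

lemma cone_biPoint_le {R : Type} [CommRing R]
    {φ : MvPolynomial (Fin (n₁ + 1) ⊕ Fin (n₂ + 1)) k →+* R}
    {i : Fin (n₁ + 1)} {j : Fin (n₂ + 1)}
    (hi : IsUnit (φ (X (Sum.inl i)))) (hj : IsUnit (φ (X (Sum.inr j))))
    {z w : PrimeSpectrum R} (h : z.asIdeal ≤ w.asIdeal) :
    cone (biPoint φ hi hj z) ≤ cone (biPoint φ hi hj w) := by
  have hf (z : PrimeSpectrum R) : RingHom.ker ((algebraMap (R ⧸ z.asIdeal)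
      (FractionRing (R ⧸ z.asIdeal))).comp (Ideal.Quotient.mk z.asIdeal)) = z.asIdeal := by
    rw [RingHom.ker_comp_of_injective _ (IsFractionRing.injective _ _), Ideal.mk_ker]
  rw [cone_biPoint_apply hi hj z _ (hf z), cone_biPoint_apply hi hj w _ (hf w)]
  exact ker_bihomogenize_comp_le _ _ (by rwa [hf, hf])

lemma cone_le_cone_of_specializes {t t' : (ProjOver k n₁ ⨯ ProjOver k n₂).left} (h : t ⤳ t') :
    cone t ≤ cone t' := by
  obtain ⟨i, j, ht'⟩ := exists_mem_chart t'
  obtain ⟨φ, hi, hj, hφ⟩ := exists_eq_biPoint (i := i) (j := j)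
    (R := (ProjOver k n₁ ⨯ ProjOver k n₂).left.presheaf.stalk t')
    ((ProjOver k n₁ ⨯ ProjOver k n₂).left.fromSpecStalk t') fun x ↦
      Specializes.mem_open ((Scheme.range_fromSpecStalk (x := t')).le (Set.mem_range_self x))
        (chart k i j).2 ht'
  obtain ⟨p, hp⟩ := (Scheme.range_fromSpecStalk (x := t')).ge h
  rw [hφ] at hp
  have hc := Scheme.fromSpecStalk_closedPoint (x := t')
  rw [hφ] at hc
  have hle := cone_biPoint_le hi hj (z := p) (w := IsLocalRing.closedPoint _)
    (IsLocalRing.le_maximalIdeal p.isPrime.ne_top)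
  exact ((congrArg cone hp).ge.trans hle).trans (congrArg cone hc).le

end ProjSpace

namespace ProjSpace

variable {k : Type} [Field k] {n₁ n₂ : ℕ}

/-- The quotient map by a prime ideal, with values in the fraction field of the quotient. -/
abbrev toFractionRing {S : Type} [CommRing S] (p : Ideal S) : S →+* FractionRing (S ⧸ p) :=
  (algebraMap (S ⧸ p) (FractionRing (S ⧸ p))).comp (Ideal.Quotient.mk p)

lemma ker_toFractionRing {S : Type} [CommRing S] (p : Ideal S) :
    RingHom.ker (toFractionRing p) = p := by
  rw [RingHom.ker_comp_of_injective _ (IsFractionRing.injective _ _), Ideal.mk_ker]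

lemma isUnit_toFractionRing {S : Type} [CommRing S] {p : Ideal S} [p.IsPrime] {a : S}
    (ha : a ∉ p) : IsUnit (toFractionRing p a) :=
  isUnit_iff_ne_zero.mpr fun h ↦ ha <| by
    rw [← ker_toFractionRing p]; exact h

lemma exists_comp_toFractionRing_eq {S K : Type} [CommRing S] [Field K] {p : Ideal S} [p.IsPrime]
    {f : S →+* K} (hf : RingHom.ker f = p) :
    ∃ g : FractionRing (S ⧸ p) →+* K, g.comp (toFractionRing p) = f := by
  have hg₀ : Function.Injective (Ideal.Quotient.lift p f fun a ha ↦ by rwa [← hf] at ha) :=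
    RingHom.lift_injective_of_ker_le_ideal _ _ hf.le
  exact ⟨IsFractionRing.lift hg₀, RingHom.ext fun a ↦ IsFractionRing.lift_algebraMap hg₀ _⟩

/-- The point of the product of two projective spaces whose homogeneous coordinates are those of
the generic point of a given prime ideal of `k[x, y]`. -/
def conePoint (p : Ideal (MvPolynomial (Fin (n₁ + 1) ⊕ Fin (n₂ + 1)) k)) [p.IsPrime]
    (hx : ¬ ∀ i, X (Sum.inl i) ∈ p) (hy : ¬ ∀ j, X (Sum.inr j) ∈ p) :
    (ProjOver k n₁ ⨯ ProjOver k n₂).left :=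
  biPoint (toFractionRing p) (isUnit_toFractionRing (not_forall.mp hx).choose_spec)
    (isUnit_toFractionRing (not_forall.mp hy).choose_spec) (IsLocalRing.closedPoint _)

variable {i : Fin (n₁ + 1)} {j : Fin (n₂ + 1)}

lemma conePoint_eq {R : Type} [CommRing R]
    {φ : MvPolynomial (Fin (n₁ + 1) ⊕ Fin (n₂ + 1)) k →+* R}
    (hi : IsUnit (φ (X (Sum.inl i)))) (hj : IsUnit (φ (X (Sum.inr j)))) (z : PrimeSpectrum R)
    {p : Ideal (MvPolynomial (Fin (n₁ + 1) ⊕ Fin (n₂ + 1)) k)} [p.IsPrime]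
    (hp : z.asIdeal.comap φ = p) (hx : ¬ ∀ i, X (Sum.inl i) ∈ p)
    (hy : ¬ ∀ j, X (Sum.inr j) ∈ p) : conePoint p hx hy = biPoint φ hi hj z := by
  have hker : RingHom.ker ((toFractionRing z.asIdeal).comp φ) = p := by
    rw [← RingHom.comap_ker, ker_toFractionRing, hp]
  obtain ⟨g, hg⟩ := exists_comp_toFractionRing_eq hker
  let x : Spec (.of (FractionRing (R ⧸ z.asIdeal))) := IsLocalRing.closedPoint _
  have hi' := isUnit_toFractionRing (not_forall.mp hx).choose_spec
  have hj' := isUnit_toFractionRing (not_forall.mp hy).choose_spec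
  refine (biPoint_comp_apply hi' hj' (IsLocalRing.closedPoint _) g ?_ (hi'.map g) (hj'.map g)
    x).symm.trans ?_
  · rw [(RingHom.injective_iff_ker_eq_bot g).mp g.injective]
    exact (IsLocalRing.maximalIdeal_eq_bot).symm
  · refine Eq.trans ?_ (biPoint_comp_apply hi hj z (toFractionRing z.asIdeal)
      (ker_toFractionRing _) (hi.map (toFractionRing _))
      (hj.map (toFractionRing _)) x)
    simp only [hg]
    rw [biPoint_congr]

lemma conePoint_ker_bihomogenize {K : Type} [Field K]
    {φ : MvPolynomial (Fin (n₁ + 1) ⊕ Fin (n₂ + 1)) k →+* K}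
    (hi : IsUnit (φ (X (Sum.inl i)))) (hj : IsUnit (φ (X (Sum.inr j)))) (x : Spec (.of K))
    (hx : ¬ ∀ i, X (Sum.inl i) ∈ RingHom.ker (bihomogenize φ))
    (hy : ¬ ∀ j, X (Sum.inr j) ∈ RingHom.ker (bihomogenize φ)) :
    have := RingHom.ker_isPrime (bihomogenize φ)
    conePoint (RingHom.ker (bihomogenize φ)) hx hy = biPoint φ hi hj x := by
  have := RingHom.ker_isPrime (bihomogenize φ)
  let ι := algebraMap (MvPolynomial (Fin 2) K) (FractionRing (MvPolynomial (Fin 2) K))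
  have hι : Function.Injective ι := IsFractionRing.injective _ _
  let ψ := ι.comp (bihomogenize φ)
  have hX (l : Fin 2) : IsUnit (ι (X l)) :=
    isUnit_iff_ne_zero.mpr fun h ↦ X_ne_zero l (hι (h.trans (map_zero ι).symm))
  have hi' : IsUnit (ψ (X (Sum.inl i))) := by
    simpa only [ψ, RingHom.comp_apply, bihomogenize_X_inl, map_mul] using
      ((hi.map C).map ι).mul (hX 0)
  have hj' : IsUnit (ψ (X (Sum.inr j))) := by
    simpa only [ψ, RingHom.comp_apply, bihomogenize_X_inr, map_mul] using
      ((hj.map C).map ι).mul (hX 1)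
  have hs : IsBiscaling ((ι.comp C).comp φ) ψ :=
    ⟨by simp [ψ], ⟨ι (X 0), by simp [ψ, mul_comm]⟩, ι (X 1), by simp [ψ, mul_comm]⟩
  have h := hs.biPoint_eq (hi.map (ι.comp C)) (hj.map (ι.comp C)) hi' hj'
  let y : PrimeSpectrum (FractionRing (MvPolynomial (Fin 2) K)) := IsLocalRing.closedPoint _
  have hy0 : y.asIdeal = ⊥ := IsLocalRing.maximalIdeal_eq_bot
  refine (conePoint_eq hi' hj' y ?_ hx hy).trans ?_
  · rw [hy0]
    exact RingHom.ker_comp_of_injective _ hι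
  · rw [← h]
    refine biPoint_comp_apply hi hj x (ι.comp C) ?_ _ _ _
    have hx : x.asIdeal = (⊥ : Ideal K) := (Ideal.eq_bot_or_top _).resolve_right x.isPrime.ne_top
    rw [hx, (RingHom.injective_iff_ker_eq_bot _).mp (ι.comp C).injective]

variable (t : (ProjOver k n₁ ⨯ ProjOver k n₂).left)

lemma not_forall_X_inl_mem_cone : ¬ ∀ i, X (Sum.inl i) ∈ cone t := fun h ↦ by
  obtain ⟨i, j, hi, hj, -⟩ := (exists_fromSpecResidueField_eq_biPoint t).choose_spec
  have := h i
  rw [cone, RingHom.mem_ker, bihomogenize_X_inl, mul_eq_zero, C_eq_zero] at this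
  exact this.elim hi.ne_zero (X_ne_zero 0)

lemma not_forall_X_inr_mem_cone : ¬ ∀ j, X (Sum.inr j) ∈ cone t := fun h ↦ by
  obtain ⟨i, j, hi, hj, -⟩ := (exists_fromSpecResidueField_eq_biPoint t).choose_spec
  have := h j
  rw [cone, RingHom.mem_ker, bihomogenize_X_inr, mul_eq_zero, C_eq_zero] at this
  exact this.elim hj.ne_zero (X_ne_zero 1)

lemma conePoint_cone :
    conePoint (cone t) (not_forall_X_inl_mem_cone t) (not_forall_X_inr_mem_cone t) = t := by
  obtain ⟨i, j, hi, hj, h⟩ := (exists_fromSpecResidueField_eq_biPoint t).choose_spec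
  let x := IsLocalRing.closedPoint ((ProjOver k n₁ ⨯ ProjOver k n₂).left.residueField t)
  refine (conePoint_ker_bihomogenize hi hj x _ _).trans ?_
  have e := Scheme.fromSpecResidueField_apply (X := (ProjOver k n₁ ⨯ ProjOver k n₂).left) t x
  rw [h] at e
  exact e

variable {t} {p : Ideal (MvPolynomial (Fin (n₁ + 1) ⊕ Fin (n₂ + 1)) k)} [p.IsPrime]
    {hx : ¬ ∀ i, X (Sum.inl i) ∈ p} {hy : ¬ ∀ j, X (Sum.inr j) ∈ p}

lemma cone_conePoint_le : cone (conePoint p hx hy) ≤ p :=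
  (cone_biPoint _ _ _).le.trans (ker_bihomogenize_le.trans (ker_toFractionRing p).le)

lemma exists_ideal_conePoint_mem_iff {C : Set (ProjOver k n₁ ⨯ ProjOver k n₂).left}
    (hC : IsClosed C) : ∃ J : Ideal (MvPolynomial (Fin (n₁ + 1) ⊕ Fin (n₂ + 1)) k),
      ∀ (p : Ideal (MvPolynomial (Fin (n₁ + 1) ⊕ Fin (n₂ + 1)) k)) [p.IsPrime]
        (hx : ¬ ∀ i, X (Sum.inl i) ∈ p) (hy : ¬ ∀ j, X (Sum.inr j) ∈ p),
        conePoint p hx hy ∈ C ↔ J ≤ p := by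
  let m (i : Fin (n₁ + 1)) (j : Fin (n₂ + 1)) :
    MvPolynomial (Fin (n₁ + 1) ⊕ Fin (n₂ + 1)) k := X (Sum.inl i) * X (Sum.inr j)
  let A (i : Fin (n₁ + 1)) (j : Fin (n₂ + 1)) := Localization.Away (m i j)
  let a (i : Fin (n₁ + 1)) (j : Fin (n₂ + 1)) :
    MvPolynomial (Fin (n₁ + 1) ⊕ Fin (n₂ + 1)) k →+* A i j := algebraMap _ _
  have hu (i : Fin (n₁ + 1)) (j : Fin (n₂ + 1)) : IsUnit (a i j (X (Sum.inl i))) ∧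
      IsUnit (a i j (X (Sum.inr j))) := by
    rw [← IsUnit.mul_iff, ← map_mul]
    exact IsLocalization.Away.algebraMap_isUnit (m i j)
  let U (i : Fin (n₁ + 1)) (j : Fin (n₂ + 1)) : Set (PrimeSpectrum (A i j)) :=
    biPoint (a i j) (hu i j).1 (hu i j).2 ⁻¹' Cᶜ
  have hU (i : Fin (n₁ + 1)) (j : Fin (n₂ + 1)) : IsOpen (U i j) :=
    hC.isOpen_compl.preimage (biPoint _ (hu i j).1 _).continuous
  let W : Set (PrimeSpectrum (MvPolynomial (Fin (n₁ + 1) ⊕ Fin (n₂ + 1)) k)) :=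
    ⋃ i, ⋃ j, PrimeSpectrum.comap (a i j) '' U i j
  have hW : IsOpen W := isOpen_iUnion fun i ↦ isOpen_iUnion fun j ↦
    (PrimeSpectrum.localization_away_isOpenEmbedding (A i j) (m i j)).isOpenMap _ (hU i j)
  obtain ⟨J, hJ⟩ := (PrimeSpectrum.isClosed_iff_zeroLocus_ideal _).mp hW.isClosed_compl
  refine ⟨J, fun p hp hx hy ↦ ?_⟩
  have hJ' : J ≤ p ↔ (⟨p, hp⟩ : PrimeSpectrum _) ∉ W := by
    rw [← Set.mem_compl_iff, hJ]; rfl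
  rw [hJ', ← not_iff_not, not_not]
  simp only [W, Set.mem_iUnion, Set.mem_image]
  constructor
  · intro h
    obtain ⟨i, hi⟩ := not_forall.mp hx
    obtain ⟨j, hj⟩ := not_forall.mp hy
    obtain ⟨z, hz⟩ : (⟨p, hp⟩ : PrimeSpectrum _) ∈
        Set.range (PrimeSpectrum.comap (a i j)) := by
      rw [PrimeSpectrum.localization_away_comap_range (A i j) (m i j)]
      exact hp.mul_notMem hi hj
    refine ⟨i, j, z, ?_, hz⟩
    rw [conePoint_eq (hu i j).1 (hu i j).2 z (congrArg PrimeSpectrum.asIdeal hz)] at h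
    exact h
  · rintro ⟨i, j, z, hz, e⟩
    rw [conePoint_eq (hu i j).1 (hu i j).2 z (congrArg PrimeSpectrum.asIdeal e)]
    exact hz

lemma conePoint_mem_closure_singleton_of_cone_le (h : cone t ≤ p) :
    conePoint p hx hy ∈ closure {t} := by
  obtain ⟨J, hJ⟩ := exists_ideal_conePoint_mem_iff (isClosed_closure (s := {t}))
  rw [hJ]
  refine le_trans ((hJ (cone t) (not_forall_X_inl_mem_cone t) (not_forall_X_inr_mem_cone t)).mp ?_)
    h
  rw [conePoint_cone]
  exact subset_closure rfl

lemma cone_le_of_conePoint_mem_closure_singleton (h : conePoint p hx hy ∈ closure {t}) :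
    cone t ≤ p :=
  (cone_le_cone_of_specializes (specializes_iff_mem_closure.mpr h)).trans cone_conePoint_le

end ProjSpace

namespace ProjSpace

variable {k : Type} [Field k] {n₁ n₂ : ℕ}

lemma quotDim_cone_lt_of_specializes {t t' : (ProjOver k n₁ ⨯ ProjOver k n₂).left} (h : t ⤳ t')
    (hne : t ≠ t') : (cone t').quotDim < (cone t).quotDim := by
  refine Ideal.quotDim_succ_le_of_lt Ideal.IsPrime.ne_top'
    ((cone_le_cone_of_specializes h).lt_of_ne fun e ↦ hne ?_)
  rw [← conePoint_cone t, ← conePoint_cone t']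
  simp only [e]

lemma topologicalKrullDim_le {Y : Set (ProjOver k n₁ ⨯ ProjOver k n₂).left} (hY : IsClosed Y)
    {t : (ProjOver k n₁ ⨯ ProjOver k n₂).left} (ht : IsGenericPoint t Y) :
    topologicalKrullDim Y ≤ ((cone t).quotDim - 2 : ℕ) := by
  have hirr (c : TopologicalSpace.IrreducibleCloseds Y) :
      IsIrreducible ((↑) '' (c : Set Y) : Set (ProjOver k n₁ ⨯ ProjOver k n₂).left) :=
    c.isIrreducible.image _ continuous_subtype_val.continuousOn
  have hcl (c : TopologicalSpace.IrreducibleCloseds Y) :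
      IsClosed ((↑) '' (c : Set Y) : Set (ProjOver k n₁ ⨯ ProjOver k n₂).left) :=
    hY.isClosedEmbedding_subtypeVal.isClosedMap _ c.isClosed
  choose g hg using fun c ↦ QuasiSober.sober (hirr c) (hcl c)
  have hmono : StrictMono fun c ↦ (cone (g c)).quotDim := fun c d h ↦ by
    refine quotDim_cone_lt_of_specializes ?_ fun e ↦ h.ne ?_
    · rw [specializes_iff_mem_closure, (hg d).def]
      exact Set.image_mono h.le ((hg c).def ▸ subset_closure rfl)
    · refine TopologicalSpace.IrreducibleCloseds.ext (Subtype.val_injective.image_injective ?_)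
      rw [← (hg c).def, ← (hg d).def, e]
  have hle (c) : (cone (g c)).quotDim ≤ (cone t).quotDim := by
    refine Ideal.quotDim_anti Ideal.IsPrime.ne_top' (cone_le_cone_of_specializes ?_)
    rw [specializes_iff_mem_closure, ht.def]
    have : g c ∈ closure {g c} := subset_closure rfl
    rw [(hg c).def] at this
    exact Subtype.coe_image_subset _ _ this
  refine iSup_le fun l ↦ ?_
  have h₁ := LTSeries.head_add_length_le_nat (l.map _ hmono)
  have h₂ := two_le_quotDim_cone (g l.head)
  have h₃ := hle l.last
  simp only [LTSeries.head_map, LTSeries.last_map, LTSeries.map_length] at h₁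
  have : l.length ≤ (cone t).quotDim - 2 := by omega
  exact_mod_cast this

lemma two_mul_add_le_quotDim_add_quotDim {Y Z : Set (ProjOver k n₁ ⨯ ProjOver k n₂).left}
    (hY : IsClosed Y) (hZ : IsClosed Z) {y z : (ProjOver k n₁ ⨯ ProjOver k n₂).left}
    (hy : IsGenericPoint y Y) (hz : IsGenericPoint z Z) (h : ((2 * n₁ + n₂ : ℕ) : WithBot ℕ∞) <
      topologicalKrullDim Y + topologicalKrullDim Z) :
    2 * n₁ + n₂ + 5 ≤ (cone y).quotDim + (cone z).quotDim := by
  have h₁ := h.trans_le (add_le_add (topologicalKrullDim_le hY hy) (topologicalKrullDim_le hZ hz))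
  have h₂ : 2 * n₁ + n₂ < ((cone y).quotDim - 2) + ((cone z).quotDim - 2) := by exact_mod_cast h₁
  have := two_le_quotDim_cone y
  have := two_le_quotDim_cone z
  omega

variable {Y Z : Set (ProjOver k n₁ ⨯ ProjOver k n₂).left}
  {y z : (ProjOver k n₁ ⨯ ProjOver k n₂).left}
  {p : Ideal (MvPolynomial (Fin (n₁ + 1) ⊕ Fin (n₂ + 1)) k)} [p.IsPrime]
  {hx : ¬ ∀ i, X (Sum.inl i) ∈ p} {hy : ¬ ∀ j, X (Sum.inr j) ∈ p}

lemma conePoint_mem_iff (ht : IsGenericPoint y Y) : conePoint p hx hy ∈ Y ↔ cone y ≤ p := by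
  rw [← ht.def]
  exact ⟨cone_le_of_conePoint_mem_closure_singleton,
    conePoint_mem_closure_singleton_of_cone_le⟩

lemma conePoint_mem_iff_sInf_le {C : Set (ProjOver k n₁ ⨯ ProjOver k n₂).left} (hC : IsClosed C) :
    conePoint p hx hy ∈ C ↔ sInf (cone '' C) ≤ p := by
  refine ⟨fun h ↦ (sInf_le (Set.mem_image_of_mem _ h)).trans cone_conePoint_le, fun h ↦ ?_⟩
  obtain ⟨J, hJ⟩ := exists_ideal_conePoint_mem_iff hC
  rw [hJ]
  refine le_trans (le_sInf ?_) h
  rintro _ ⟨t, ht, rfl⟩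
  rw [← hJ _ (not_forall_X_inl_mem_cone t) (not_forall_X_inr_mem_cone t), conePoint_cone]
  exact ht

lemma isHomogeneous_sInf_cone (C : Set (ProjOver k n₁ ⨯ ProjOver k n₂).left) :
    (sInf (cone '' C)).IsHomogeneous (homogeneousSubmodule (Fin (n₁ + 1) ⊕ Fin (n₂ + 1)) k) := by
  refine isHomogeneous_sInf ?_
  rintro _ ⟨t, -, rfl⟩
  exact isHomogeneous_cone t

end ProjSpace

open ProjSpace

/-- **Corollary 4.3 (connectedness content).**  Let `k` be an algebraically closed field,
`n₁ ≥ n₂ ≥ 1` and `P = ℙ^{n₁} ×_k ℙ^{n₂}`.  If `Y, Z ⊆ P` are closed irreducible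
subvarieties with `dim Y + dim Z > 2n₁ + n₂`, then `Y ∩ Z` is nonempty and connected. -/
theorem intersection_connected_of_dim_sum
    (k : Type) [Field k] [IsAlgClosed k]
    (n₁ n₂ : ℕ) (hn₂ : 1 ≤ n₂) (hn : n₂ ≤ n₁)
    (Y Z : Set ((ProjOver k n₁ ⨯ ProjOver k n₂).left))
    (hYcl : IsClosed Y) (hYirr : IsIrreducible Y)
    (hZcl : IsClosed Z) (hZirr : IsIrreducible Z)
    (hdim : ((2 * n₁ + n₂ : ℕ) : WithBot ℕ∞) <
      topologicalKrullDim Y + topologicalKrullDim Z) :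
    IsConnected (Y ∩ Z) := by
  obtain ⟨y, hy⟩ := QuasiSober.sober hYirr hYcl
  obtain ⟨z, hz⟩ := QuasiSober.sober hZirr hZcl
  have hcard : Fintype.card (Fin (n₂ + 1)) ≤ Fintype.card (Fin (n₁ + 1)) := by simpa using hn
  have hd : 2 * Fintype.card (Fin (n₁ + 1)) + Fintype.card (Fin (n₂ + 1)) + 2 ≤
      (cone y).quotDim + (cone z).quotDim := by
    have := two_mul_add_le_quotDim_add_quotDim hYcl hZcl hy hz hdim
    simp only [Fintype.card_fin]
    omega
  have hmem (p : Ideal (MvPolynomial (Fin (n₁ + 1) ⊕ Fin (n₂ + 1)) k)) [p.IsPrime]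
      (h₁ : ¬ ∀ i, X (Sum.inl i) ∈ p) (h₂ : ¬ ∀ j, X (Sum.inr j) ∈ p) :
      conePoint p h₁ h₂ ∈ Y ∩ Z ↔ cone y ⊔ cone z ≤ p := by
    rw [Set.mem_inter_iff, conePoint_mem_iff hy, conePoint_mem_iff hz, sup_le_iff]
  constructor
  · obtain ⟨p, hp, hle, h₁, h₂⟩ := exists_isPrime_of_card_le (isHomogeneous_cone y)
      (isHomogeneous_cone z) hcard hd
    exact ⟨conePoint p h₁ h₂, (hmem p h₁ h₂).mpr hle⟩
  · rw [isPreconnected_closed_iff]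
    intro C₁ C₂ hC₁ hC₂ hcover ⟨t₁, ht₁, ht₁'⟩ ⟨t₂, ht₂, ht₂'⟩
    have hYZ := hYcl.inter hZcl
    have hrel (C : Set (ProjOver k n₁ ⨯ ProjOver k n₂).left) {t} (ht : t ∈ C) :
        ∃ p, p.IsPrime ∧ (¬ ∀ i, X (Sum.inl i) ∈ p) ∧ (¬ ∀ j, X (Sum.inr j) ∈ p) ∧
          sInf (cone '' C) ≤ p :=
      ⟨cone t, inferInstance, not_forall_X_inl_mem_cone t, not_forall_X_inr_mem_cone t,
        sInf_le (Set.mem_image_of_mem _ ht)⟩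
    obtain ⟨p, hp, h₁, h₂, hp₁, hp₂⟩ := exists_isPrime_sup_le_of_card_le (isHomogeneous_cone y)
      (isHomogeneous_cone z) hcard hd (isHomogeneous_sInf_cone (Y ∩ Z ∩ C₁))
      (isHomogeneous_sInf_cone (Y ∩ Z ∩ C₂)) (fun p hp h₁ h₂ ↦ by
        rw [← hmem p h₁ h₂, ← conePoint_mem_iff_sInf_le (hx := h₁) (hy := h₂) (hYZ.inter hC₁),
          ← conePoint_mem_iff_sInf_le (hx := h₁) (hy := h₂) (hYZ.inter hC₂), ← Set.mem_union,
          ← Set.inter_union_distrib_left, Set.inter_eq_left.mpr hcover])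
      (hrel _ ⟨ht₁, ht₁'⟩) (hrel _ ⟨ht₂, ht₂'⟩)
    rw [← conePoint_mem_iff_sInf_le (hx := h₁) (hy := h₂) (hYZ.inter hC₁)] at hp₁
    rw [← conePoint_mem_iff_sInf_le (hx := h₁) (hy := h₂) (hYZ.inter hC₂)] at hp₂
    exact ⟨_, hp₁.1, hp₁.2, hp₂.2⟩

end
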